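/- Let f be a holomorphic function on an open Ω ⊂ ℂ^n, not identically zero on any component. For χ : [0,∞) → [0,1] smooth with χ ≡ 0 near 0 and χ ≡ 1 near ∞, and for any test (n, n−1)-form φ on Ω, one has lim_{ε→0⁺} ∫_Ω (∂̄χ(|f|²/ε))/f ∧ φ = ⟨∂̄(1/f), φ⟩, where 1/f is the Herrera–Lieberman principal value current and ∂̄(1/f) its ∂̄-image. Moreover, the same limit is obtained with χ = 1_{[1,∞)}, in which case the left-hand side is the residue integral ∫_{|f|²=ε} φ/f over regular values ε of |f|². -/

import Mathlib

open MeasureTheory Filter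

/-- The i-th Wirtinger antiholomorphic derivative ∂ψ/∂z̄_i on ℂⁿ. -/
noncomputable def dbarCoord (n : ℕ) (i : Fin n) (ψ : (Fin n → ℂ) → ℂ)
    (x : Fin n → ℂ) : ℂ :=
  (fderiv ℝ ψ x (Pi.single i 1) + Complex.I * fderiv ℝ ψ x (Pi.single i Complex.I)) / 2

open scoped Topology ContDiff

/-- Complex coordinate space of dimension `N`. -/
abbrev CSpace (N : ℕ) := Fin N → ℂ

/-- `f` is holomorphic near `p`. -/
def HolAt {N : ℕ} {E : Type*} [NormedAddCommGroup E] [NormedSpace ℂ E]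
    (f : CSpace N → E) (p : CSpace N) : Prop :=
  ∀ᶠ x in 𝓝 p, DifferentiableAt ℂ f x

section Param

variable {N : ℕ}

theorem norm_fderiv_le_of_bound {G : CSpace N → ℂ} {y : CSpace N} {r M : ℝ} (hr : 0 < r)
    (hG : DifferentiableOn ℂ G (Metric.ball y r)) (hM : ∀ z ∈ Metric.ball y r, ‖G z‖ ≤ M) :
    ‖fderiv ℂ G y‖ ≤ 2 * (M + 1) / r := by
  have h0 : ‖G y‖ ≤ M := hM y (Metric.mem_ball_self hr)
  refine Complex.norm_fderiv_le_div_of_mapsTo_ball hG (R₂ := 2 * (M + 1)) ?_ hr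
  intro z hz
  rw [Metric.mem_closedBall, dist_eq_norm]
  linarith [norm_sub_le (G z) (G y), hM z hz]

theorem differentiableAt_param {G : CSpace N → ℂ} {W : Set (CSpace N)} (hW : IsOpen W)
    (hG : DifferentiableOn ℂ G W) {A : ℝ → CSpace N →L[ℂ] CSpace N} (hA : Continuous A)
    {b : ℝ → CSpace N} (hb : Continuous b) {c : ℝ → ℂ} (hc : Continuous c) {α β : ℝ}
    {p : CSpace N} (hp : ∀ t ∈ Set.uIcc α β, A t p + b t ∈ W) :
    DifferentiableAt ℂ (fun x => ∫ t in α..β, c t * G (A t x + b t)) p := by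
  set K := (fun t => A t p + b t) '' Set.uIcc α β with hKdef
  have hK : IsCompact K := isCompact_uIcc.image (by fun_prop)
  have hKW : K ⊆ W := by rintro _ ⟨t, ht, rfl⟩; exact hp t ht
  obtain ⟨δ, hδ, hδW⟩ := hK.exists_cthickening_subset_open hW hKW
  have hcpt : IsCompact (Metric.cthickening δ K) := hK.cthickening
  obtain ⟨M, hM⟩ := hcpt.exists_bound_of_continuousOn (hG.continuousOn.mono hδW)
  obtain ⟨C, hC⟩ := (isCompact_uIcc (a := α) (b := β)).exists_bound_of_continuousOn hA.continuousOn
  obtain ⟨D, hD⟩ := (isCompact_uIcc (a := α) (b := β)).exists_bound_of_continuousOn hc.continuousOn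
  have hC0 : 0 ≤ C := (norm_nonneg _).trans (hC α Set.left_mem_uIcc)
  have hD0 : 0 ≤ D := (norm_nonneg _).trans (hD α Set.left_mem_uIcc)
  set s := Metric.ball p (δ / 2 / (C + 1)) with hs
  have hsub : ∀ t ∈ Set.uIcc α β, ∀ x ∈ s,
      Metric.ball (A t x + b t) (δ / 2) ⊆ Metric.cthickening δ K := by
    intro t ht x hx z hz
    refine Metric.mem_cthickening_of_dist_le z (A t p + b t) δ K ⟨t, ht, rfl⟩ ?_
    have h1 : dist (A t x + b t) (A t p + b t) ≤ δ / 2 := by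
      rw [dist_add_right, dist_eq_norm, ← map_sub]
      calc ‖A t (x - p)‖ ≤ ‖A t‖ * ‖x - p‖ := (A t).le_opNorm _
        _ ≤ (C + 1) * (δ / 2 / (C + 1)) := by
            have := hC t ht
            have h2 : ‖x - p‖ < δ / 2 / (C + 1) := by rwa [← dist_eq_norm]
            gcongr; linarith
        _ = δ / 2 := by field_simp
    rw [Metric.mem_ball] at hz
    linarith [dist_triangle z (A t x + b t) (A t p + b t)]
  have hmem : ∀ t ∈ Set.uIcc α β, ∀ x ∈ s, A t x + b t ∈ W := fun t ht x hx =>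
    hδW (hsub t ht x hx (Metric.mem_ball_self (by positivity)))
  have hps : p ∈ s := Metric.mem_ball_self (by positivity)
  have hcont : ∀ x ∈ s, ContinuousOn (fun t => c t * G (A t x + b t)) (Set.uIcc α β) := by
    intro x hx
    refine hc.continuousOn.mul (hG.continuousOn.comp (by fun_prop) ?_)
    exact fun t ht => hmem t ht x hx
  have hmeas : AEStronglyMeasurable
      (fun t => c t • (fderiv ℂ G (A t p + b t)).comp (A t))
      (volume.restrict (Set.uIoc α β)) := by
    refine hc.aestronglyMeasurable.smul ?_
    have h1 : StronglyMeasurable (fun t => fderiv ℂ G (A t p + b t)) :=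
      ((measurable_fderiv ℂ G).comp (by fun_prop : Measurable fun t => A t p + b t)).stronglyMeasurable
    have h2 : StronglyMeasurable A := hA.stronglyMeasurable
    have h3 : Continuous fun q : (CSpace N →L[ℂ] ℂ) × (CSpace N →L[ℂ] CSpace N) => q.1.comp q.2 := by
      fun_prop
    exact (h3.comp_stronglyMeasurable (h1.prodMk h2)).aestronglyMeasurable
  refine (intervalIntegral.hasFDerivAt_integral_of_dominated_of_fderiv_le
    (𝕜 := ℂ) (s := s) (F := fun x t => c t * G (A t x + b t))
    (F' := fun x t => c t • (fderiv ℂ G (A t x + b t)).comp (A t))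
    (bound := fun _ => D * (2 * (M + 1) / (δ / 2) * C)) (Metric.ball_mem_nhds _ (by positivity))
    ?_ ?_ hmeas ?_ ?_ ?_).differentiableAt
  · filter_upwards [Metric.ball_mem_nhds p (show 0 < δ / 2 / (C + 1) by positivity)] with x hx
    exact ((hcont x hx).mono Set.uIoc_subset_uIcc).aestronglyMeasurable measurableSet_uIoc
  · exact (hcont p hps).intervalIntegrable
  · refine Eventually.of_forall fun t ht x hx => ?_
    have ht' := Set.uIoc_subset_uIcc ht
    rw [norm_smul]
    have h1 : ‖fderiv ℂ G (A t x + b t)‖ ≤ 2 * (M + 1) / (δ / 2) :=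
      norm_fderiv_le_of_bound (by positivity) (hG.mono ((hsub t ht' x hx).trans hδW))
        fun z hz => hM z (hsub t ht' x hx hz)
    have h2 := (ContinuousLinearMap.opNorm_comp_le (fderiv ℂ G (A t x + b t)) (A t)).trans
      (mul_le_mul h1 (hC t ht') (norm_nonneg _) ((norm_nonneg _).trans h1))
    exact mul_le_mul (hD t ht') h2 (norm_nonneg _) hD0
  · simp
  · refine Eventually.of_forall fun t ht x hx => ?_
    have ht' := Set.uIoc_subset_uIcc ht
    have h1 : HasFDerivAt G (fderiv ℂ G (A t x + b t)) (A t x + b t) :=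
      (hG.differentiableAt (hW.mem_nhds (hmem t ht' x hx))).hasFDerivAt
    have h2 : HasFDerivAt (fun x => A t x + b t) (A t) x := (A t).hasFDerivAt.add_const _
    exact (h1.comp x h2).const_mul (c t)

end Param

section HolBasic

variable {N : ℕ} {E : Type*} [NormedAddCommGroup E] [NormedSpace ℂ E]

theorem differentiableOn_fderiv_apply {G : CSpace N → ℂ} {W : Set (CSpace N)}
    (hW : IsOpen W) (hG : DifferentiableOn ℂ G W) (v : CSpace N) :
    DifferentiableOn ℂ (fun x => fderiv ℂ G x v) W := by
  intro p hp
  refine DifferentiableAt.differentiableWithinAt ?_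
  obtain ⟨ρ, hρ, hρW⟩ := Metric.isOpen_iff.1 hW p hp
  set R := ρ / 2 / (‖v‖ + 1) with hR
  have hR0 : 0 < R := by positivity
  have hRv : R * ‖v‖ ≤ ρ / 2 := by
    rw [hR, div_mul_eq_mul_div, div_le_iff₀ (by positivity)]
    nlinarith [norm_nonneg v]
  have key : ∀ x ∈ Metric.ball p (ρ / 2), ∀ z ∈ Metric.closedBall (0 : ℂ) R, x + z • v ∈ W := by
    intro x hx z hz
    apply hρW
    rw [Metric.mem_ball] at hx ⊢
    have h1 : dist (x + z • v) x ≤ ρ / 2 := by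
      rw [dist_eq_norm, add_sub_cancel_left, norm_smul]
      exact (mul_le_mul_of_nonneg_right (by simpa using hz) (norm_nonneg v)).trans hRv
    linarith [dist_triangle (x + z • v) x p]
  have hline : ∀ x (z : ℂ), HasDerivAt (fun z : ℂ => x + z • v) v z := fun x z => by
    simpa using ((hasDerivAt_id z).smul_const v).const_add x
  have hev : (fun x => fderiv ℂ G x v) =ᶠ[𝓝 p] fun x => (2 * Real.pi * Complex.I)⁻¹ *
      ∫ t in (0 : ℝ)..2 * Real.pi, (circleMap 0 R t * Complex.I * (1 / (circleMap 0 R t) ^ 2)) *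
        G (ContinuousLinearMap.id ℂ _ x + circleMap 0 R t • v) := by
    filter_upwards [Metric.ball_mem_nhds p (half_pos hρ)] with x hx
    have hd : ∀ z ∈ Metric.closedBall (0 : ℂ) R,
        HasDerivAt (fun z : ℂ => G (x + z • v)) (fderiv ℂ G (x + z • v) v) z := fun z hz =>
      (hG.differentiableAt (hW.mem_nhds (key x hx z hz))).hasFDerivAt.comp_hasDerivAt z (hline x z)
    have h1 := DifferentiableOn.deriv_eq_smul_circleIntegral (f := fun z : ℂ => G (x + z • v)) hR0
      (c := 0) (fun z hz => (hd z hz).differentiableAt.differentiableWithinAt)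
    have h2 := (hd 0 (by simp [hR0.le])).deriv
    rw [h2] at h1
    simp only [zero_smul, add_zero] at h1
    rw [eq_inv_mul_iff_mul_eq₀ (by simp [Real.pi_ne_zero]), ← smul_eq_mul, ← h1, circleIntegral]
    congr 1
    ext t
    simp [deriv_circleMap]
    ring
  refine DifferentiableAt.congr_of_eventuallyEq ?_ hev
  refine DifferentiableAt.const_mul ?_ _
  refine differentiableAt_param hW hG (A := fun _ => ContinuousLinearMap.id ℂ _) continuous_const
    (b := fun t => circleMap 0 R t • v)
    (c := fun t => circleMap 0 R t * Complex.I * (1 / (circleMap 0 R t) ^ 2))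
    (by fun_prop) ?_ ?_
  · have : Continuous (circleMap 0 R) := by fun_prop
    refine (this.mul continuous_const).mul (continuous_const.div (this.pow 2) ?_)
    intro t
    simp [hR0.ne']
  · intro t _
    exact key p (Metric.mem_ball_self (half_pos hρ)) _ (by simp [circleMap, abs_of_pos hR0])

theorem contDiffOn_nat_of_differentiableOn_open {W : Set (CSpace N)} (hW : IsOpen W) (n : ℕ) :
    ∀ {G : CSpace N → ℂ}, DifferentiableOn ℂ G W → ContDiffOn ℂ n G W := by
  induction n with
  | zero => intro G hG; simpa using hG.continuousOn
  | succ n ih =>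
    intro G hG
    rw [Nat.cast_add, Nat.cast_one, contDiffOn_succ_iff_fderiv_of_isOpen hW]
    refine ⟨hG, by simp, contDiffOn_clm_apply.2 fun v => ih (differentiableOn_fderiv_apply hW hG v)⟩

theorem holAt_of_open {W : Set (CSpace N)} (hW : IsOpen W) {f : CSpace N → E}
    (hf : DifferentiableOn ℂ f W) {p} (hp : p ∈ W) : HolAt f p :=
  (hW.eventually_mem hp).mono fun _ hx => hf.differentiableAt (hW.mem_nhds hx)

theorem HolAt.exists_open {f : CSpace N → E} {p} (h : HolAt f p) :
    ∃ W, IsOpen W ∧ p ∈ W ∧ DifferentiableOn ℂ f W := by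
  obtain ⟨W, hW, hWo, hp⟩ := eventually_nhds_iff.1 h
  exact ⟨W, hWo, hp, fun x hx => (hW x hx).differentiableWithinAt⟩

theorem HolAt.differentiableAt {f : CSpace N → E} {p} (h : HolAt f p) : DifferentiableAt ℂ f p :=
  h.self_of_nhds

theorem HolAt.continuousAt {f : CSpace N → E} {p} (h : HolAt f p) : ContinuousAt f p :=
  h.differentiableAt.continuousAt

theorem HolAt.congr {f g : CSpace N → E} {p} (h : HolAt f p) (hfg : f =ᶠ[𝓝 p] g) : HolAt g p := by
  filter_upwards [h, eventually_eventually_nhds.2 hfg] with x hx hxx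
  exact hx.congr_of_eventuallyEq (hxx.mono fun _ h => h.symm)

theorem Differentiable.holAt {f : CSpace N → E} (h : Differentiable ℂ f) (p) : HolAt f p :=
  Eventually.of_forall fun x => h x

theorem HolAt.add {f g : CSpace N → E} {p} (hf : HolAt f p) (hg : HolAt g p) :
    HolAt (fun x => f x + g x) p := by
  filter_upwards [hf, hg] with x h1 h2 using h1.add h2

theorem HolAt.sub {f g : CSpace N → E} {p} (hf : HolAt f p) (hg : HolAt g p) :
    HolAt (fun x => f x - g x) p := by
  filter_upwards [hf, hg] with x h1 h2 using h1.sub h2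

theorem HolAt.mul {f g : CSpace N → ℂ} {p} (hf : HolAt f p) (hg : HolAt g p) :
    HolAt (fun x => f x * g x) p := by
  filter_upwards [hf, hg] with x h1 h2 using h1.mul h2

theorem HolAt.pow {f : CSpace N → ℂ} {p} (hf : HolAt f p) (n : ℕ) :
    HolAt (fun x => f x ^ n) p := by
  filter_upwards [hf] with x h1 using h1.pow n

theorem holAt_const (c : E) (p : CSpace N) : HolAt (fun _ => c) p :=
  (differentiable_const c).holAt p

theorem holAt_coord (i : Fin N) (p : CSpace N) : HolAt (fun x : CSpace N => x i) p :=
  (differentiable_apply i).holAt p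

theorem HolAt.sum {ι : Type*} {s : Finset ι} {f : ι → CSpace N → ℂ} {p}
    (h : ∀ i ∈ s, HolAt (f i) p) : HolAt (fun x => ∑ i ∈ s, f i x) p := by
  have := (Finset.eventually_all s).2 h
  filter_upwards [this] with x hx
  exact DifferentiableAt.fun_sum hx

theorem HolAt.prod {ι : Type*} {s : Finset ι} {f : ι → CSpace N → ℂ} {p}
    (h : ∀ i ∈ s, HolAt (f i) p) : HolAt (fun x => ∏ i ∈ s, f i x) p := by
  classical
  have := (Finset.eventually_all s).2 h
  filter_upwards [this] with x hx
  have := (HasFDerivAt.finsetProd fun i hi => (hx i hi).hasFDerivAt).differentiableAt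
  simpa [Finset.prod_fn] using this

theorem HolAt.comp {f : CSpace N → E} {σ : CSpace N → CSpace N} {p}
    (hf : HolAt f (σ p)) (hσ : HolAt σ p) : HolAt (fun x => f (σ x)) p := by
  filter_upwards [hσ, hσ.continuousAt.eventually hf] with x h1 h2
  exact h2.comp x h1

theorem HolAt.pi {σ : CSpace N → CSpace N} {p} (h : ∀ i, HolAt (fun x => σ x i) p) : HolAt σ p := by
  filter_upwards [eventually_all.2 h] with x hx using differentiableAt_pi.2 hx

theorem HolAt.coord {σ : CSpace N → CSpace N} {p} (h : HolAt σ p) (i : Fin N) :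
    HolAt (fun x => σ x i) p := by
  filter_upwards [h] with x hx using differentiableAt_pi.1 hx i

theorem HolAt.fderiv_apply {f : CSpace N → ℂ} {p} (hf : HolAt f p) (v : CSpace N) :
    HolAt (fun x => fderiv ℂ f x v) p := by
  obtain ⟨W, hW, hp, hd⟩ := hf.exists_open
  exact holAt_of_open hW (differentiableOn_fderiv_apply hW hd v) hp

theorem HolAt.contDiffAt {f : CSpace N → ℂ} {p} (hf : HolAt f p) : ContDiffAt ℂ ∞ f p := by
  obtain ⟨W, hW, hp, hd⟩ := hf.exists_open
  exact (contDiffOn_infty.2 fun n => contDiffOn_nat_of_differentiableOn_open hW n hd).contDiffAt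
    (hW.mem_nhds hp)

theorem HolAt.contDiffAt_map {σ : CSpace N → CSpace N} {p} (h : HolAt σ p) :
    ContDiffAt ℂ ∞ σ p :=
  contDiffAt_pi.2 fun i => (h.coord i).contDiffAt

/-- Setting one coordinate to a holomorphic value is holomorphic. -/
theorem HolAt.update {σ : CSpace N → CSpace N} {a : CSpace N → ℂ} {p} (hσ : HolAt σ p)
    (ha : HolAt a p) (j : Fin N) : HolAt (fun x => Function.update (σ x) j (a x)) p := by
  refine HolAt.pi fun i => ?_
  by_cases hij : i = j
  · subst hij; simpa using ha
  · simpa [hij] using hσ.coord i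

theorem holAt_id (p : CSpace N) : HolAt (fun x : CSpace N => x) p := differentiable_id.holAt p

theorem eventuallyEq_zero_of_lines {f : CSpace N → ℂ} {p : CSpace N} {r : ℝ}
    (hf : DifferentiableOn ℂ f (Metric.ball p r)) {q : CSpace N} (hq : q ∈ Metric.ball p r)
    (h0 : ∀ᶠ x in 𝓝 q, f x = 0) : ∀ x ∈ Metric.ball p r, f x = 0 := by
  intro x hx
  set L : ℂ → CSpace N := fun z => q + z • (x - q) with hL
  have hLd : Differentiable ℂ L := by fun_prop
  set U := L ⁻¹' Metric.ball p r
  have hUo : IsOpen U := Metric.isOpen_ball.preimage hLd.continuous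
  have hUc : Convex ℝ U := by
    intro z hz w hw a b ha hb hab
    have : L (a • z + b • w) = a • L z + b • L w := by
      simp only [hL]
      have hb' : b = 1 - a := by linarith
      subst hb'
      ext i
      simp
      ring
    simp only [U, Set.mem_preimage, this]
    exact convex_ball p r hz hw ha hb hab
  have hd : DifferentiableOn ℂ (f ∘ L) U := hf.comp hLd.differentiableOn (fun z hz => hz)
  have hL0 : L 0 = q := by simp [hL]
  have hL1 : L 1 = x := by simp [hL]
  have := (hd.analyticOnNhd hUo).eqOn_zero_of_preconnected_of_eventuallyEq_zero hUc.isPreconnected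
    (z₀ := 0) (by simp [U, hL0, hq]) (by
      have : Tendsto L (𝓝 0) (𝓝 q) := by simpa [hL0] using hLd.continuous.tendsto 0
      exact this.eventually h0)
  have h1 := this (x := 1) (by simp only [U, Set.mem_preimage, hL1]; exact hx)
  simpa [hL1] using h1

theorem HolAt.exists_ball {f : CSpace N → E} {p} (h : HolAt f p) :
    ∃ r > 0, DifferentiableOn ℂ f (Metric.ball p r) := by
  obtain ⟨r, hr, h⟩ := Metric.eventually_nhds_iff_ball.1 h
  exact ⟨r, hr, fun x hx => (h x hx).differentiableWithinAt⟩

theorem HolAt.mul_eq_zero {f g : CSpace N → ℂ} {p} (hf : HolAt f p) (hg : HolAt g p)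
    (h : ∀ᶠ x in 𝓝 p, f x * g x = 0) : (∀ᶠ x in 𝓝 p, f x = 0) ∨ ∀ᶠ x in 𝓝 p, g x = 0 := by
  obtain ⟨r, hr, h1⟩ := Metric.eventually_nhds_iff_ball.1 ((hf.and hg).and h)
  have hfd : DifferentiableOn ℂ f (Metric.ball p r) := fun x hx => (h1 x hx).1.1.differentiableWithinAt
  have hgd : DifferentiableOn ℂ g (Metric.ball p r) := fun x hx => (h1 x hx).1.2.differentiableWithinAt
  by_cases hz : ∀ x ∈ Metric.ball p r, f x = 0
  · exact Or.inl (Metric.eventually_nhds_iff_ball.2 ⟨r, hr, hz⟩)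
  · push Not at hz
    obtain ⟨q, hq, hfq⟩ := hz
    refine Or.inr (Metric.eventually_nhds_iff_ball.2 ⟨r, hr, eventuallyEq_zero_of_lines hgd hq ?_⟩)
    filter_upwards [(h1 q hq).1.1.continuousAt.eventually_ne hfq,
      Metric.isOpen_ball.eventually_mem hq] with x hx hxb
    exact (_root_.mul_eq_zero.1 (h1 x hxb).2).resolve_left hx

theorem eventually_eq_zero_of_prod {ι : Type*} (s : Finset ι) {f : ι → CSpace N → ℂ} {p}
    (h : ∀ i ∈ s, HolAt (f i) p) (h0 : ∀ᶠ x in 𝓝 p, ∏ i ∈ s, f i x = 0) :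
    ∃ i ∈ s, ∀ᶠ x in 𝓝 p, f i x = 0 := by
  classical
  induction s using Finset.induction_on with
  | empty => simpa using h0.exists
  | insert a s ha ih =>
    simp only [Finset.prod_insert ha] at h0
    rcases (h a (by simp)).mul_eq_zero (HolAt.prod fun i hi => h i (by simp [hi])) h0 with h1 | h1
    · exact ⟨a, by simp, h1⟩
    · obtain ⟨i, hi, h2⟩ := ih (fun i hi => h i (by simp [hi])) h1
      exact ⟨i, by simp [hi], h2⟩

/-- Hadamard division by a coordinate. -/
theorem HolAt.exists_eq_coord_mul {g : CSpace N → ℂ} (hg : HolAt g 0) (j : Fin N)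
    (h0 : ∀ᶠ x in 𝓝 0, g (Function.update x j 0) = 0) :
    ∃ h : CSpace N → ℂ, HolAt h 0 ∧ ∀ᶠ x in 𝓝 0, g x = x j * h x := by
  obtain ⟨r, hr, hd⟩ := hg.exists_ball
  let A : ℝ → CSpace N →L[ℂ] CSpace N := fun t =>
    ContinuousLinearMap.id ℂ _ - ((1 - t : ℝ) : ℂ) •
      (ContinuousLinearMap.proj j : CSpace N →L[ℂ] ℂ).smulRight (Pi.single j 1)
  have hAx : ∀ t x, A t x = Function.update x j ((t : ℂ) * x j) := by
    intro t x
    ext i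
    by_cases hij : i = j
    · subst hij; simp [A]; ring
    · simp [A, hij]
  have hA : Continuous A := by
    simp only [A]
    fun_prop
  have hnorm : ∀ t ∈ Set.uIcc (0 : ℝ) 1, ∀ x, ‖A t x‖ ≤ ‖x‖ := by
    intro t ht x
    rw [Set.uIcc_of_le zero_le_one] at ht
    rw [hAx, pi_norm_le_iff_of_nonneg (norm_nonneg x)]
    intro i
    by_cases hij : i = j
    · subst hij
      simp only [Function.update_self, norm_mul, Complex.norm_real, Real.norm_eq_abs,
        abs_of_nonneg ht.1]
      exact (mul_le_of_le_one_left (norm_nonneg _) ht.2).trans (norm_le_pi_norm x i)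
    · simpa [hij] using norm_le_pi_norm x i
  have hD := differentiableOn_fderiv_apply Metric.isOpen_ball hd (Pi.single j (1 : ℂ))
  refine ⟨fun x => ∫ t in (0 : ℝ)..1, (1 : ℂ) *
    (fderiv ℂ g (A t x + 0) (Pi.single j (1 : ℂ))), ?_, ?_⟩
  · filter_upwards [Metric.ball_mem_nhds (0 : CSpace N) hr] with x hx
    refine differentiableAt_param Metric.isOpen_ball hD hA (b := fun _ => 0) continuous_const
      (c := fun _ => 1) continuous_const fun t ht => ?_
    simpa using (hnorm t ht x).trans_lt (by simpa using hx)
  · filter_upwards [Metric.ball_mem_nhds (0 : CSpace N) hr, h0] with x hx hx0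
    have hmem : ∀ t ∈ Set.uIcc (0 : ℝ) 1, A t x ∈ Metric.ball (0 : CSpace N) r := fun t ht => by
      simpa using (hnorm t ht x).trans_lt (by simpa using hx)
    have hder : ∀ t ∈ Set.uIcc (0 : ℝ) 1, HasDerivAt (fun t : ℝ => g (A t x))
        (fderiv ℂ g (A t x) (Pi.single j (x j))) t := by
      intro t ht
      have h1 : HasFDerivAt g ((fderiv ℂ g (A t x)).restrictScalars ℝ) (A t x) :=
        (hd.differentiableAt (Metric.isOpen_ball.mem_nhds (hmem t ht))).hasFDerivAt.restrictScalars ℝ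
      refine HasFDerivAt.comp_hasDerivAt (f := fun t : ℝ => A t x) t h1 ?_
      rw [hasDerivAt_pi]
      intro i
      by_cases hij : i = j
      · subst hij
        simp only [hAx, Function.update_self, Pi.single_eq_same]
        simpa using (Complex.ofRealCLM.hasDerivAt (x := t)).mul_const (x i)
      · simpa [hAx, hij] using hasDerivAt_const t (x i)
    have hcont : ContinuousOn (fun t : ℝ => fderiv ℂ g (A t x) (Pi.single j (x j)))
        (Set.uIcc 0 1) :=
      (differentiableOn_fderiv_apply Metric.isOpen_ball hd (Pi.single j (x j))).continuousOn.comp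
        (by fun_prop) hmem
    have h2 := intervalIntegral.integral_eq_sub_of_hasDerivAt hder hcont.intervalIntegrable
    have e1 : A 1 x = x := by simp [A]
    have e0 : A 0 x = Function.update x j 0 := by rw [hAx]; simp
    rw [e1, e0, hx0, sub_zero] at h2
    rw [← h2, ← intervalIntegral.integral_const_mul]
    congr 1
    ext t
    have : (Pi.single j (x j) : CSpace N) = x j • Pi.single j (1 : ℂ) := by
      ext i; by_cases hij : i = j
      · subst hij; simp
      · simp [hij]
    rw [this, map_smul]
    simp

end HolBasic

section Upd

variable {N : ℕ}

/-- The map replacing the `j`-th coordinate of `x` by `a x`. -/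
def upd (j : Fin N) (a : CSpace N → ℂ) (x : CSpace N) : CSpace N := Function.update x j (a x)

@[simp] theorem upd_self (j : Fin N) (a : CSpace N → ℂ) (x) : upd j a x j = a x := by simp [upd]

theorem upd_of_ne {i j : Fin N} (h : i ≠ j) (a : CSpace N → ℂ) (x) : upd j a x i = x i := by
  simp [upd, h]

theorem HolAt.upd {a : CSpace N → ℂ} {p} (ha : HolAt a p) (j : Fin N) : HolAt (upd j a) p :=
  (holAt_id p).update ha j

/-- The derivative of `upd j a`. -/
noncomputable def updLin (j : Fin N) (a' : CSpace N →L[ℂ] ℂ) : CSpace N →L[ℂ] CSpace N :=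
  ContinuousLinearMap.pi fun i => if i = j then a' else ContinuousLinearMap.proj i

theorem hasFDerivAt_upd {a : CSpace N → ℂ} {a' : CSpace N →L[ℂ] ℂ} {x} (j : Fin N)
    (h : HasFDerivAt a a' x) : HasFDerivAt (upd j a) (updLin j a') x := by
  refine hasFDerivAt_pi.2 fun i => ?_
  by_cases hij : i = j
  · subst hij; simpa using h
  · simp only [hij, if_false, upd_of_ne hij]
    exact (ContinuousLinearMap.proj i : CSpace N →L[ℂ] ℂ).hasFDerivAt

theorem det_updLin (j : Fin N) (a' : CSpace N →L[ℂ] ℂ) :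
    LinearMap.det (updLin j a' : CSpace N →ₗ[ℂ] CSpace N) = a' (Pi.single j 1) := by
  rw [← LinearMap.det_toMatrix']
  have : LinearMap.toMatrix' (updLin j a' : CSpace N →ₗ[ℂ] CSpace N) =
      (1 : Matrix (Fin N) (Fin N) ℂ).updateRow j (fun k => a' (Pi.single k 1)) := by
    ext i k
    rw [LinearMap.toMatrix'_apply]
    by_cases hij : i = j
    · subst hij
      simp [updLin]
    · simp [updLin, hij, Matrix.one_apply, Pi.single_apply]
  rw [this, ← Matrix.cramer_transpose_apply]
  simp

theorem abs_det_updLin (j : Fin N) (a' : CSpace N →L[ℂ] ℂ) :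
    |((updLin j a').restrictScalars ℝ).det| = ‖a' (Pi.single j 1)‖ ^ 2 := by
  have h : ((updLin j a').restrictScalars ℝ).det =
      LinearMap.det ((updLin j a' : CSpace N →ₗ[ℂ] CSpace N).restrictScalars ℝ) := rfl
  rw [h, LinearMap.det_restrictScalars, det_updLin, Algebra.norm_complex_apply,
    Complex.normSq_eq_norm_sq, abs_of_nonneg (by positivity)]

theorem setIntegral_image_upd {j : Fin N} {a : CSpace N → ℂ} {A : Set (CSpace N)}
    (hA : MeasurableSet A) (ha : ∀ x ∈ A, DifferentiableAt ℂ a x) (hinj : Set.InjOn (upd j a) A)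
    (H : CSpace N → ℂ) :
    ∫ y in upd j a '' A, H y =
      ∫ x in A, ((‖fderiv ℂ a x (Pi.single j 1)‖ ^ 2 : ℝ) : ℂ) * H (upd j a x) := by
  rw [integral_image_eq_integral_abs_det_fderiv_smul volume hA
    (f' := fun x => (updLin j (fderiv ℂ a x)).restrictScalars ℝ)
    (fun x hx => ((hasFDerivAt_upd j (ha x hx).hasFDerivAt).restrictScalars ℝ).hasFDerivWithinAt)
    hinj H]
  simp only [abs_det_updLin, Complex.real_smul]

theorem updLin_injective {j : Fin N} {a' : CSpace N →L[ℂ] ℂ} (h : a' (Pi.single j 1) ≠ 0) :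
    IsUnit (LinearMap.det (updLin j a' : CSpace N →ₗ[ℂ] CSpace N)) := by
  rw [det_updLin]; exact h.isUnit

/-- The derivative of `upd j a` as an equivalence. -/
noncomputable def updEquiv (j : Fin N) (a' : CSpace N →L[ℂ] ℂ) (h : a' (Pi.single j 1) ≠ 0) :
    CSpace N ≃L[ℂ] CSpace N :=
  (LinearEquiv.ofIsUnitDet (f := (updLin j a' : CSpace N →ₗ[ℂ] CSpace N))
    (v := Pi.basisFun ℂ (Fin N)) (v' := Pi.basisFun ℂ (Fin N))
    (by rw [LinearMap.det_toMatrix]; exact updLin_injective h)).toContinuousLinearEquiv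

theorem coe_updEquiv (j : Fin N) (a' : CSpace N →L[ℂ] ℂ) (h : a' (Pi.single j 1) ≠ 0) :
    (updEquiv j a' h : CSpace N →L[ℂ] CSpace N) = updLin j a' := by
  ext; rfl

/-- The inverse function theorem for coordinate replacements. -/
theorem exists_homeo_upd {j : Fin N} {a : CSpace N → ℂ} {p : CSpace N} (ha : HolAt a p)
    (h : fderiv ℂ a p (Pi.single j 1) ≠ 0) :
    ∃ e : OpenPartialHomeomorph (CSpace N) (CSpace N), (e : CSpace N → CSpace N) = upd j a ∧
      p ∈ e.source ∧ HolAt e.symm (upd j a p) := by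
  have h1 : HasFDerivAt (upd j a) (updEquiv j _ h : CSpace N →L[ℂ] CSpace N) p := by
    rw [coe_updEquiv]; exact hasFDerivAt_upd j ha.differentiableAt.hasFDerivAt
  have h2 := (ha.upd j).contDiffAt_map
  refine ⟨h2.toOpenPartialHomeomorph _ h1 (by simp), rfl,
    h2.mem_toOpenPartialHomeomorph_source h1 (by simp), ?_⟩
  have h3 : ContDiffAt ℂ ∞ (h2.toOpenPartialHomeomorph _ h1 (by simp)).symm (upd j a p) :=
    h2.to_localInverse h1 (by simp)
  have h4 : ContDiffAt ℂ 1 (h2.toOpenPartialHomeomorph _ h1 (by simp)).symm (upd j a p) :=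
    h3.of_le (by simp)
  exact (h4.eventually (by simp)).mono fun x hx => hx.differentiableAt (by simp)

theorem exists_upd_inverse {j : Fin N} {a : CSpace N → ℂ} (ha : HolAt a 0) (ha0 : a 0 = 0)
    (h : fderiv ℂ a 0 (Pi.single j 1) ≠ 0) :
    ∃ b : CSpace N → ℂ, HolAt b 0 ∧ b 0 = 0 ∧ (∀ᶠ x in 𝓝 0, upd j a (upd j b x) = x) ∧
      (∀ᶠ x in 𝓝 0, upd j b (upd j a x) = x) ∧ fderiv ℂ b 0 (Pi.single j 1) ≠ 0 := by
  obtain ⟨e, he, hs, hsymm⟩ := exists_homeo_upd ha h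
  have hU0 : upd j a 0 = 0 := by
    ext i; by_cases hij : i = j
    · subst hij; simp [ha0]
    · simp [upd_of_ne hij]
  rw [hU0] at hsymm
  have hes0 : e.symm 0 = 0 := by
    have h1 := e.left_inv hs
    rwa [he, hU0] at h1
  have ht : (0 : CSpace N) ∈ e.target := by
    rw [← hU0, ← he]; exact e.map_source hs
  have hb : HolAt (fun x => e.symm x j) 0 := hsymm.coord j
  have hupd : ∀ᶠ x in 𝓝 (0 : CSpace N), upd j (fun x => e.symm x j) x = e.symm x := by
    filter_upwards [e.open_target.eventually_mem ht] with x hx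
    have h1 : upd j a (e.symm x) = x := by rw [← he]; exact e.right_inv hx
    ext i
    by_cases hij : i = j
    · subst hij; simp
    · rw [upd_of_ne hij]
      conv_lhs => rw [← h1]
      rw [upd_of_ne hij]
  have hba : ∀ᶠ x in 𝓝 (0 : CSpace N), upd j (fun x => e.symm x j) (upd j a x) = x := by
    have hc : Tendsto (upd j a) (𝓝 0) (𝓝 0) := by
      have := (ha.upd j).continuousAt.tendsto; rwa [hU0] at this
    filter_upwards [hc.eventually hupd, e.open_source.eventually_mem hs] with x hx hxs
    rw [hx, ← he, e.left_inv hxs]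
  refine ⟨fun x => e.symm x j, hb, by simp [hes0], ?_, hba, ?_⟩
  · filter_upwards [hupd, e.open_target.eventually_mem ht] with x hx hxt
    rw [hx, ← he]; exact e.right_inv hxt
  · intro h0
    have hb' : HasFDerivAt (fun x => e.symm x j) (fderiv ℂ (fun x => e.symm x j) 0) (upd j a 0) := by
      rw [hU0]; exact hb.differentiableAt.hasFDerivAt
    have h1 := hb'.comp 0 (hasFDerivAt_upd j ha.differentiableAt.hasFDerivAt)
    have h2 : HasFDerivAt (fun x : CSpace N => x j) (ContinuousLinearMap.proj j : CSpace N →L[ℂ] ℂ) 0 :=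
      (ContinuousLinearMap.proj j : CSpace N →L[ℂ] ℂ).hasFDerivAt
    have h3 := (h1.congr_of_eventuallyEq (f₁ := fun x : CSpace N => x j) ?_).unique h2
    · have h4 := congrArg (fun L => L (Pi.single j (1 : ℂ))) h3
      have h5 : updLin j (fderiv ℂ a 0) (Pi.single j 1) =
          fderiv ℂ a 0 (Pi.single j 1) • Pi.single j (1 : ℂ) := by
        ext i
        by_cases hij : i = j
        · subst hij; simp [updLin]
        · simp [updLin, hij]
      simp [h5, h0] at h4
    · filter_upwards [hba] with x hx
      have := congrFun hx j
      simp only [upd_self] at this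
      exact this.symm

end Upd

section Smooth

variable {N : ℕ}

theorem exists_bump {K U : Set (CSpace N)} (hK : IsCompact K) (hU : IsOpen U) (hKU : K ⊆ U) :
    ∃ χ : CSpace N → ℝ, ContDiff ℝ ∞ χ ∧ (∀ᶠ x in 𝓝ˢ K, χ x = 1) ∧ tsupport χ ⊆ U := by
  obtain ⟨K', hK', h1, h2⟩ := exists_compact_between hK hU hKU
  obtain ⟨f, hf1, hf0, -⟩ := exists_contMDiffMap_one_nhds_of_subset_interior
    (n := ⊤) (modelWithCornersSelf ℝ (CSpace N)) hK.isClosed h1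
  refine ⟨f, f.contMDiff.contDiff, hf1, (closure_minimal ?_ hK'.isClosed).trans h2⟩
  intro x hx
  by_contra hxK
  exact hx (hf0 x hxK)

theorem contDiff_of_zero_off_compact {A K : Set (CSpace N)} {g : CSpace N → ℂ} (hA : IsOpen A)
    (hg : ContDiffOn ℝ ∞ g A) (hK : IsCompact K) (hKA : K ⊆ A) (h0 : ∀ x ∉ K, g x = 0) :
    ContDiff ℝ ∞ g ∧ HasCompactSupport g ∧ tsupport g ⊆ K := by
  have hts : tsupport g ⊆ K := closure_minimal (fun x hx => by
    by_contra hxK; exact hx (h0 x hxK)) hK.isClosed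
  refine ⟨contDiff_iff_contDiffAt.2 fun x => ?_, HasCompactSupport.intro hK h0, hts⟩
  by_cases hx : x ∈ K
  · exact hg.contDiffAt (hA.mem_nhds (hKA hx))
  · have : g =ᶠ[𝓝 x] fun _ => 0 := by
      filter_upwards [hK.isClosed.isOpen_compl.eventually_mem hx] with y hy using h0 y hy
    exact contDiffAt_const.congr_of_eventuallyEq this

end Smooth

section PV

variable {N : ℕ}

/-- The truncated principal value integrand. -/
noncomputable def pvInt (F θ : CSpace N → ℂ) (ε : ℝ) (x : CSpace N) : ℂ :=
  if ε < ‖F x‖ ^ 2 then θ x / F x else 0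

/-- The principal value of `θ / F` exists. -/
def HasPV (F θ : CSpace N → ℂ) : Prop :=
  ∃ L : ℂ, Tendsto (fun ε : ℝ => ∫ x, pvInt F θ ε x) (𝓝[>] 0) (𝓝 L)

/-- The principal value current of `1 / F` exists on `U`. -/
def GoodOn (F : CSpace N → ℂ) (U : Set (CSpace N)) : Prop :=
  ∀ θ : CSpace N → ℂ, ContDiff ℝ ∞ θ → HasCompactSupport θ → tsupport θ ⊆ U → HasPV F θ

/-- The principal value current of `1 / F` exists near `p`. -/
def GoodAt (F : CSpace N → ℂ) (p : CSpace N) : Prop :=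
  ∃ U, IsOpen U ∧ p ∈ U ∧ ContinuousOn F U ∧ GoodOn F U

theorem pvInt_of_zero {F θ : CSpace N → ℂ} {ε : ℝ} {x} (h : θ x = 0) : pvInt F θ ε x = 0 := by
  simp [pvInt, h]

theorem integrable_pvInt {F θ : CSpace N → ℂ} {U : Set (CSpace N)} (hU : IsOpen U)
    (hF : ContinuousOn F U) (hθ : Continuous θ) (hc : HasCompactSupport θ) (hs : tsupport θ ⊆ U)
    {ε : ℝ} (hε : 0 < ε) : Integrable (pvInt F θ ε) := by
  set O := U ∩ (fun x => ‖F x‖ ^ 2) ⁻¹' Set.Ioi ε with hO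
  have hOo : IsOpen O := (hF.norm.pow 2).isOpen_inter_preimage hU isOpen_Ioi
  have heq : pvInt F θ ε = O.indicator fun x => θ x / F x := by
    ext x
    by_cases hx : x ∈ U
    · simp [pvInt, Set.indicator, hO, hx]
    · have : θ x = 0 := image_eq_zero_of_notMem_tsupport fun h => hx (hs h)
      simp [pvInt, Set.indicator, this]
  have hne : ∀ x ∈ O, F x ≠ 0 := fun x hx h0 => by
    have := hx.2
    simp only [Set.mem_preimage, h0, Set.mem_Ioi] at this
    norm_num at this
    linarith
  have hmeas : AEStronglyMeasurable (pvInt F θ ε) := by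
    rw [heq, aestronglyMeasurable_indicator_iff hOo.measurableSet]
    exact (hθ.continuousOn.div (hF.mono Set.inter_subset_left) hne).aestronglyMeasurable
      hOo.measurableSet
  have hintg : Integrable fun x => ‖θ x‖ / √ε :=
    ((hθ.integrable_of_hasCompactSupport hc).norm).div_const _
  refine hintg.mono' hmeas (Eventually.of_forall fun x => ?_)
  unfold pvInt
  split_ifs with h
  · rw [norm_div]
    have : √ε ≤ ‖F x‖ := Real.sqrt_le_iff.2 ⟨norm_nonneg _, h.le⟩
    have : 0 < √ε := Real.sqrt_pos.2 hε
    gcongr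
  · simp; positivity

theorem HasPV.add {F θ₁ θ₂ : CSpace N → ℂ}
    (hi₁ : ∀ ε > 0, Integrable (pvInt F θ₁ ε)) (hi₂ : ∀ ε > 0, Integrable (pvInt F θ₂ ε))
    (h₁ : HasPV F θ₁) (h₂ : HasPV F θ₂) : HasPV F fun x => θ₁ x + θ₂ x := by
  obtain ⟨L₁, h₁⟩ := h₁
  obtain ⟨L₂, h₂⟩ := h₂
  refine ⟨L₁ + L₂, (h₁.add h₂).congr' ?_⟩
  filter_upwards [self_mem_nhdsWithin] with ε hε
  rw [← integral_add (hi₁ ε hε) (hi₂ ε hε)]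
  congr 1
  ext x
  unfold pvInt
  split_ifs <;> ring

theorem HasPV.congr_near {F G θ : CSpace N → ℂ} (h : HasPV F θ) (hFG : ∀ x, θ x ≠ 0 → F x = G x) :
    HasPV G θ := by
  obtain ⟨L, hL⟩ := h
  refine ⟨L, hL.congr fun ε => ?_⟩
  congr 1
  ext x
  by_cases hx : θ x = 0
  · rw [pvInt_of_zero hx, pvInt_of_zero hx]
  · simp [pvInt, hFG x hx]

theorem GoodAt.congr {F G : CSpace N → ℂ} {p} (h : GoodAt F p) (hFG : F =ᶠ[𝓝 p] G) :
    GoodAt G p := by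
  obtain ⟨U, hU, hp, hc, hg⟩ := h
  obtain ⟨V, hV, hVo, hpV⟩ := eventually_nhds_iff.1 hFG
  refine ⟨U ∩ V, hU.inter hVo, ⟨hp, hpV⟩, ?_, fun θ h1 h2 h3 => ?_⟩
  · exact (hc.mono Set.inter_subset_left).congr fun x hx => (hV x hx.2).symm
  · refine (hg θ h1 h2 (h3.trans Set.inter_subset_left)).congr_near fun x hx => hV x ?_
    exact (h3 (subset_tsupport _ hx)).2

theorem GoodOn.union {F : CSpace N → ℂ} {U V : Set (CSpace N)} (hU : IsOpen U) (hV : IsOpen V)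
    (hF : ContinuousOn F (U ∪ V)) (h₁ : GoodOn F U) (h₂ : GoodOn F V) : GoodOn F (U ∪ V) := by
  intro θ hθ hc hs
  have hK : IsCompact (tsupport θ \ V) := hc.isCompact.diff hV
  obtain ⟨χ, hχ, hχ1, hχs⟩ := exists_bump hK hU (fun x hx => (hs hx.1).resolve_right hx.2)
  have hχc : ContDiff ℝ ∞ fun x => ((χ x : ℝ) : ℂ) := Complex.ofRealCLM.contDiff.comp hχ
  have hA : ContDiff ℝ ∞ fun x => (χ x : ℂ) * θ x := hχc.mul hθ
  have hB : ContDiff ℝ ∞ fun x => (1 - (χ x : ℂ)) * θ x := (contDiff_const.sub hχc).mul hθ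
  have hAc : HasCompactSupport fun x => (χ x : ℂ) * θ x := hc.mul_left
  have hBc : HasCompactSupport fun x => (1 - (χ x : ℂ)) * θ x := hc.mul_left
  have hAs : tsupport (fun x => (χ x : ℂ) * θ x) ⊆ U := by
    refine Set.Subset.trans (closure_mono ?_) hχs
    intro x hx h0
    simp [h0] at hx
  have hBs : tsupport (fun x => (1 - (χ x : ℂ)) * θ x) ⊆ V := by
    intro x hx
    have hxt : x ∈ tsupport θ := tsupport_mul_subset_right hx
    by_contra hxV
    have h1 : ∀ᶠ y in 𝓝 x, χ y = 1 := (eventually_nhdsSet_iff_forall.1 hχ1) x ⟨hxt, hxV⟩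
    exact (notMem_tsupport_iff_eventuallyEq.2 (h1.mono fun y hy => by simp [hy])) hx
  have := HasPV.add
    (fun ε hε => integrable_pvInt (hU.union hV) hF hA.continuous hAc
      (hAs.trans Set.subset_union_left) hε)
    (fun ε hε => integrable_pvInt (hU.union hV) hF hB.continuous hBc
      (hBs.trans Set.subset_union_right) hε)
    (h₁ _ hA hAc hAs) (h₂ _ hB hBc hBs)
  convert this using 2
  ring

theorem exists_goodOn_of_compact {F : CSpace N → ℂ} {K : Set (CSpace N)} (hK : IsCompact K)
    (h : ∀ p ∈ K, GoodAt F p) : ∃ V, IsOpen V ∧ K ⊆ V ∧ ContinuousOn F V ∧ GoodOn F V := by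
  refine hK.induction_on (p := fun K => ∃ V, IsOpen V ∧ K ⊆ V ∧ ContinuousOn F V ∧ GoodOn F V)
    ⟨∅, isOpen_empty, le_rfl, continuousOn_empty F, ?_⟩ ?_ ?_ ?_
  · intro θ h1 h2 h3
    have h0 : ∀ x, θ x = 0 := fun x => image_eq_zero_of_notMem_tsupport fun h => h3 h
    exact ⟨0, by simp [pvInt, h0]⟩
  · rintro s t hst ⟨V, h1, h2, h3⟩
    exact ⟨V, h1, hst.trans h2, h3⟩
  · rintro s t ⟨V, h1, h2, h3, h4⟩ ⟨W, h1', h2', h3', h4'⟩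
    have hc := h3.union_of_isOpen h3' h1 h1'
    exact ⟨V ∪ W, h1.union h1', Set.union_subset_union h2 h2', hc, h4.union h1 h1' hc h4'⟩
  · intro x hx
    obtain ⟨U, h1, h2, h3⟩ := h x hx
    exact ⟨U, mem_nhdsWithin_of_mem_nhds (h1.mem_nhds h2), U, h1, le_rfl, h3⟩

theorem GoodAt.of_translate {F : CSpace N → ℂ} {p c : CSpace N}
    (h : GoodAt (fun x => F (x + c)) p) : GoodAt F (p + c) := by
  obtain ⟨U, hU, hp, hF, hg⟩ := h
  refine ⟨(fun x => x - c) ⁻¹' U, hU.preimage (by fun_prop), by simpa using hp, ?_, ?_⟩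
  · have : F = (fun x => F (x + c)) ∘ fun x => x - c := by ext x; simp
    rw [this]
    exact hF.comp (by fun_prop) fun x hx => hx
  · intro θ h1 h2 h3
    have hs : tsupport (fun x => θ (x + c)) ⊆ U := by
      have := tsupport_comp_eq_preimage θ (Homeomorph.addRight c)
      intro x hx
      have hx' : x ∈ tsupport (θ ∘ (Homeomorph.addRight c)) := hx
      rw [this] at hx'
      have := h3 hx'
      simpa using this
    obtain ⟨L, hL⟩ := hg (fun x => θ (x + c)) (h1.comp (by fun_prop))
      (h2.comp_homeomorph (Homeomorph.addRight c)) hs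
    refine ⟨L, hL.congr fun ε => ?_⟩
    exact integral_add_right_eq_self (fun x => pvInt F θ ε x) c

theorem contDiff_normSq {g : CSpace N → ℂ} {A : Set (CSpace N)} (hg : ContDiffOn ℝ ∞ g A) :
    ContDiffOn ℝ ∞ (fun x => ((‖g x‖ ^ 2 : ℝ) : ℂ)) A := by
  have : ContDiffOn ℝ ∞ (fun x => ‖g x‖ ^ 2) A := hg.norm_sq ℝ
  exact Complex.ofRealCLM.contDiff.comp_contDiffOn this

theorem contDiffOn_real_of_hol {g : CSpace N → ℂ} {A : Set (CSpace N)}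
    (hg : ∀ x ∈ A, HolAt g x) : ContDiffOn ℝ ∞ g A :=
  fun x hx => (((hg x hx).contDiffAt).restrict_scalars ℝ).contDiffWithinAt

theorem contDiffOn_upd {a : CSpace N → ℂ} {A : Set (CSpace N)} (j : Fin N)
    (ha : ∀ x ∈ A, HolAt a x) : ContDiffOn ℝ ∞ (upd j a) A :=
  fun x hx => ((((ha x hx).upd j).contDiffAt_map).restrict_scalars ℝ).contDiffWithinAt

theorem GoodAt.of_upd {F a : CSpace N → ℂ} {j : Fin N} {p : CSpace N} (ha : HolAt a p)
    (h : fderiv ℂ a p (Pi.single j 1) ≠ 0) (hF : GoodAt (fun x => F (upd j a x)) p) :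
    GoodAt F (upd j a p) := by
  obtain ⟨e, he, hs, -⟩ := exists_homeo_upd ha h
  obtain ⟨U, hU, hp, hc, hg⟩ := hF
  obtain ⟨W, hW, hpW, haW⟩ := ha.exists_open
  set A := e.source ∩ U ∩ W with hA
  have hAo : IsOpen A := (e.open_source.inter hU).inter hW
  have hAe : A ⊆ e.source := fun x hx => hx.1.1
  have hhol : ∀ x ∈ A, HolAt a x := fun x hx => holAt_of_open hW haW hx.2
  have hinj : Set.InjOn (upd j a) A := by rw [← he]; exact e.injOn.mono hAe
  have hVo : IsOpen (upd j a '' A) := by rw [← he]; exact e.isOpen_image_of_subset_source hAo hAe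
  have hmem : ∀ y ∈ upd j a '' A, e.symm y ∈ A ∧ upd j a (e.symm y) = y := by
    rintro _ ⟨x, hx, rfl⟩
    have : e.symm (upd j a x) = x := by rw [← he]; exact e.left_inv (hAe hx)
    rw [this]; exact ⟨hx, rfl⟩
  have hVt : upd j a '' A ⊆ e.target := by
    rintro _ ⟨x, hx, rfl⟩; rw [← he]; exact e.map_source (hAe hx)
  refine ⟨upd j a '' A, hVo, ⟨p, ⟨⟨hs, hp⟩, hpW⟩, rfl⟩, ?_, fun θ h1 h2 h3 => ?_⟩
  · have : ContinuousOn (fun y => F (upd j a (e.symm y))) (upd j a '' A) :=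
      hc.comp (e.symm.continuousOn.mono hVt) fun y hy => (hmem y hy).1.1.2
    exact this.congr fun y hy => by simp only [(hmem y hy).2]
  · classical
    set θ' : CSpace N → ℂ := A.indicator fun x =>
      ((‖fderiv ℂ a x (Pi.single j 1)‖ ^ 2 : ℝ) : ℂ) * θ (upd j a x) with hθ'
    have hK : IsCompact (e.symm '' tsupport θ) :=
      h2.isCompact.image_of_continuousOn (e.symm.continuousOn.mono (h3.trans hVt))
    have hKA : e.symm '' tsupport θ ⊆ A := by
      rintro _ ⟨y, hy, rfl⟩; exact (hmem y (h3 hy)).1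
    have hsm : ContDiffOn ℝ ∞ θ' A := by
      refine ContDiffOn.congr ?_ fun x hx => Set.indicator_of_mem hx _
      refine (contDiff_normSq (contDiffOn_real_of_hol fun x hx => (hhol x hx).fderiv_apply _)).mul ?_
      exact h1.comp_contDiffOn (contDiffOn_upd j hhol)
    have hz : ∀ x ∉ e.symm '' tsupport θ, θ' x = 0 := by
      intro x hx
      by_cases hxA : x ∈ A
      · rw [hθ', Set.indicator_of_mem hxA]
        have : upd j a x ∉ tsupport θ := fun h => hx ⟨_, h, by
          rw [← he]; exact e.left_inv (hAe hxA)⟩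
        rw [image_eq_zero_of_notMem_tsupport this, mul_zero]
      · exact Set.indicator_of_notMem hxA _
    obtain ⟨k1, k2, k3⟩ := contDiff_of_zero_off_compact (g := θ') hAo hsm hK hKA hz
    obtain ⟨L, hL⟩ := hg θ' k1 k2 (k3.trans (hKA.trans fun x hx => hx.1.2))
    refine ⟨L, hL.congr fun ε => ?_⟩
    have e1 : ∫ y, pvInt F θ ε y = ∫ y in upd j a '' A, pvInt F θ ε y := by
      refine (setIntegral_eq_integral_of_forall_compl_eq_zero fun y hy => ?_).symm
      exact pvInt_of_zero (image_eq_zero_of_notMem_tsupport fun h => hy (h3 h))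
    rw [e1, setIntegral_image_upd hAo.measurableSet (fun x hx => (hhol x hx).differentiableAt) hinj,
      ← integral_indicator hAo.measurableSet]
    congr 1
    ext x
    by_cases hx : x ∈ A
    · simp only [pvInt, hθ', Set.indicator_of_mem hx]
      split_ifs <;> ring
    · simp only [pvInt, hθ', Set.indicator_of_notMem hx, zero_div, ite_self]

end PV

section Charts

variable {N : ℕ}

theorem ae_coord_ne_zero (k : Fin N) : ∀ᵐ x : CSpace N, x k ≠ 0 := by
  have h : (volume : Measure (CSpace N))
      ((LinearMap.ker (LinearMap.proj k : CSpace N →ₗ[ℝ] ℂ) : Submodule ℝ (CSpace N)) :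
        Set (CSpace N)) = 0 := by
    refine Measure.addHaar_submodule _ _ fun h => ?_
    have : (Pi.single k 1 : CSpace N) ∈ LinearMap.ker (LinearMap.proj k : CSpace N →ₗ[ℝ] ℂ) := by
      rw [h]; trivial
    simp at this
  rw [ae_iff]
  convert h using 2
  ext x
  simp

theorem setIntegral_coord_ne_zero (k : Fin N) (H : CSpace N → ℂ) :
    ∫ x in {x : CSpace N | x k ≠ 0}, H x = ∫ x, H x := by
  have h : ∀ᵐ x : CSpace N, x ∈ {x : CSpace N | x k ≠ 0} := ae_coord_ne_zero k
  rw [Measure.restrict_eq_self_of_ae_mem h]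

theorem measurableSet_coord_ne_zero (k : Fin N) : MeasurableSet {x : CSpace N | x k ≠ 0} :=
  (isOpen_ne_fun (continuous_apply k) continuous_const).measurableSet

/-- The affine chart of the blow-up of `x k = x j = 0`, centred at the slope `c`. -/
def blowMap (k j : Fin N) (c : ℂ) (x : CSpace N) : CSpace N := upd j (fun x => x k * (x j + c)) x

theorem holAt_blow (k j : Fin N) (c : ℂ) (p : CSpace N) :
    HolAt (fun x : CSpace N => x k * (x j + c)) p :=
  (holAt_coord k p).mul ((holAt_coord j p).add (holAt_const c p))

theorem integral_blowMap {k j : Fin N} (hkj : k ≠ j) (H : CSpace N → ℂ) :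
    ∫ x, H x = ∫ x, ((‖x k‖ ^ 2 : ℝ) : ℂ) * H (blowMap k j 0 x) := by
  rw [← setIntegral_coord_ne_zero k H,
    ← setIntegral_coord_ne_zero k fun x => ((‖x k‖ ^ 2 : ℝ) : ℂ) * H (blowMap k j 0 x)]
  have himg : upd j (fun x : CSpace N => x k * (x j + 0)) '' {x | x k ≠ 0} = {x | x k ≠ 0} := by
    ext y
    constructor
    · rintro ⟨x, hx, rfl⟩
      simpa [upd_of_ne hkj] using hx
    · intro hy
      have hy' : y k ≠ 0 := hy
      refine ⟨Function.update y j (y j / y k), by simpa [hkj] using hy, ?_⟩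
      ext i
      by_cases hij : i = j
      · subst hij; simp [hkj]; field_simp
      · simp [upd_of_ne hij, hij]
  have hinj : Set.InjOn (upd j (fun x : CSpace N => x k * (x j + 0))) {x | x k ≠ 0} := by
    intro x hx y hy hxy
    have hk := congrFun hxy k
    rw [upd_of_ne hkj, upd_of_ne hkj] at hk
    have hx' : x k ≠ 0 := hx
    ext i
    by_cases hij : i = j
    · subst hij
      have := congrFun hxy i
      simp only [upd_self, add_zero, hk] at this
      exact mul_left_cancel₀ (hk ▸ hx') this
    · have := congrFun hxy i
      rwa [upd_of_ne hij, upd_of_ne hij] at this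
  conv_lhs => rw [← himg]
  rw [setIntegral_image_upd (measurableSet_coord_ne_zero k)
    (fun x _ => (holAt_blow k j 0 x).differentiableAt) hinj]
  congr 1
  ext x
  have hd : HasFDerivAt (fun x : CSpace N => x k * (x j + 0))
      (x k • (ContinuousLinearMap.proj j : CSpace N →L[ℂ] ℂ) +
        (x j + 0) • (ContinuousLinearMap.proj k : CSpace N →L[ℂ] ℂ)) x :=
    ((ContinuousLinearMap.proj k : CSpace N →L[ℂ] ℂ).hasFDerivAt).mul
      (((ContinuousLinearMap.proj j : CSpace N →L[ℂ] ℂ).hasFDerivAt).add_const 0)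
  rw [hd.fderiv]
  simp [hkj, blowMap]

theorem hasPV_chart {k j : Fin N} (hkj : k ≠ j) {F θ : CSpace N → ℂ} {W : CSpace N → ℝ}
    {w : ℂ → ℝ} {R η : ℝ} {V : Set (CSpace N)} (hw : ContDiff ℝ ∞ w)
    (hw0 : ∀ z, R < ‖z‖ ^ 2 → w z = 0) (hWw : ∀ x : CSpace N, x k ≠ 0 → W (blowMap k j 0 x) = w (x j))
    (hV : {x : CSpace N | (∀ i, i ≠ j → ‖x i‖ ≤ η) ∧ ‖x j‖ ^ 2 ≤ R} ⊆ V)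
    (hG : GoodOn (fun x => F (blowMap k j 0 x)) V) (hθ : ContDiff ℝ ∞ θ)
    (hθs : tsupport θ ⊆ Metric.ball 0 η) : HasPV F fun x => (W x : ℂ) * θ x := by
  set θ' : CSpace N → ℂ := fun x => ((‖x k‖ ^ 2 : ℝ) : ℂ) * ((w (x j) : ℂ) * θ (blowMap k j 0 x))
    with hθ'
  set K : Set (CSpace N) := {x | (∀ i, i ≠ j → ‖x i‖ ≤ η) ∧ ‖x j‖ ^ 2 ≤ R} with hKdef
  have hKc : IsCompact K := by
    refine Metric.isCompact_of_isClosed_isBounded ?_ ?_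
    · have : K = (⋂ i, ⋂ (_ : i ≠ j), {x : CSpace N | ‖x i‖ ≤ η}) ∩ {x | ‖x j‖ ^ 2 ≤ R} := by
        ext x; simp [hKdef]
      rw [this]
      exact (isClosed_iInter fun i => isClosed_iInter fun _ =>
        isClosed_le (by fun_prop) continuous_const).inter (isClosed_le (by fun_prop) continuous_const)
    · refine (Metric.isBounded_closedBall (x := (0 : CSpace N)) (r := |η| + √R)).subset fun x hx => ?_
      rw [mem_closedBall_zero_iff, pi_norm_le_iff_of_nonneg (by positivity)]
      intro i
      by_cases hij : i = j
      · subst hij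
        have := Real.le_sqrt_of_sq_le hx.2
        linarith [abs_nonneg η]
      · linarith [hx.1 i hij, le_abs_self η, Real.sqrt_nonneg R]
  have hsm : ContDiffOn ℝ ∞ θ' Set.univ := by
    refine (contDiff_normSq (contDiffOn_real_of_hol fun x _ => holAt_coord k x)).mul ?_
    refine ContDiffOn.mul ?_ ?_
    · refine (Complex.ofRealCLM.contDiff.comp (hw.comp ?_)).contDiffOn
      exact contDiff_apply ℝ ℂ j
    · exact hθ.comp_contDiffOn (contDiffOn_upd j fun x _ => holAt_blow k j 0 x)
  have hz : ∀ x ∉ K, θ' x = 0 := by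
    intro x hx
    by_cases h1 : ‖x j‖ ^ 2 ≤ R
    · have : ∃ i, i ≠ j ∧ η < ‖x i‖ := by
        by_contra hcon
        push Not at hcon
        exact hx ⟨hcon, h1⟩
      obtain ⟨i, hij, hi⟩ := this
      have : θ (blowMap k j 0 x) = 0 := image_eq_zero_of_notMem_tsupport fun h => by
        have h2 := hθs h
        rw [mem_ball_zero_iff] at h2
        have h3 := norm_le_pi_norm (blowMap k j 0 x) i
        rw [blowMap, upd_of_ne hij] at h3
        exact absurd (h3.trans_lt h2) (not_lt.2 hi.le)
      simp [hθ', this]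
    · simp [hθ', hw0 _ (not_le.1 h1)]
  obtain ⟨k1, k2, k3⟩ := contDiff_of_zero_off_compact isOpen_univ hsm hKc (Set.subset_univ _) hz
  obtain ⟨L, hL⟩ := hG θ' k1 k2 (k3.trans hV)
  refine ⟨L, hL.congr fun ε => ?_⟩
  rw [integral_blowMap hkj (pvInt F _ ε)]
  refine integral_congr_ae ?_
  filter_upwards [ae_coord_ne_zero k] with x hx
  simp only [pvInt, hθ', hWw x hx]
  split_ifs <;> ring

theorem GoodAt.of_blow {k j : Fin N} (hkj : k ≠ j) {F : CSpace N → ℂ} (hF : HolAt F 0)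
    (h₁ : ∀ c, GoodAt (fun x => F (blowMap k j c x)) 0)
    (h₂ : GoodAt (fun x => F (blowMap j k 0 x)) 0) : GoodAt F 0 := by
  obtain ⟨U₂, hU₂, h0₂, -, hg₂⟩ := h₂
  obtain ⟨r, hr, hrU⟩ := Metric.isOpen_iff.1 hU₂ 0 h0₂
  set C : ℝ := 8 / r ^ 2 + 1 with hC
  have hC1 : 2 / (C - 1) = (r / 2) ^ 2 := by rw [hC]; field_simp; ring
  have hCp : 1 < C := by rw [hC]; linarith [show 0 < 8 / r ^ 2 by positivity]
  have hK : IsCompact ((fun z : ℂ => (Pi.single j z : CSpace N)) '' Metric.closedBall 0 (√C)) :=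
    (isCompact_closedBall _ _).image (continuous_single (A := fun _ : Fin N => ℂ) j)
  obtain ⟨V, hV, hKV, hcV, hgV⟩ := exists_goodOn_of_compact (F := fun x => F (blowMap k j 0 x)) hK (by
    rintro _ ⟨c, -, rfl⟩
    have := GoodAt.of_translate (F := fun x => F (blowMap k j 0 x)) (p := 0)
      (c := (Pi.single j c : CSpace N)) ?_
    · simpa using this
    · convert h₁ c using 3 with x
      ext i
      by_cases hij : i = j
      · subst hij; simp [blowMap, hkj]
      · simp [blowMap, upd_of_ne hij, hij])
  obtain ⟨δ, hδ, hδV⟩ := hK.exists_cthickening_subset_open hV hKV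
  obtain ⟨O, hO, hO0, hFO⟩ := hF.exists_open
  set η := min δ (r / 2) with hη
  have hηp : 0 < η := by positivity
  have hUo : IsOpen (Metric.ball (0 : CSpace N) η ∩ O) := Metric.isOpen_ball.inter hO
  refine ⟨_, hUo, ⟨Metric.mem_ball_self hηp, hO0⟩,
    hFO.continuousOn.mono Set.inter_subset_right, fun θ h1 h2 h3 => ?_⟩
  set W : CSpace N → ℝ := fun x =>
    Real.smoothTransition ((C * ‖x k‖ ^ 2 - ‖x j‖ ^ 2) / (‖x k‖ ^ 2 + ‖x j‖ ^ 2)) with hW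
  have hWm : Measurable W :=
    Real.smoothTransition.continuous.measurable.comp (by fun_prop)
  have hn : ContDiff ℝ ∞ fun z : ℂ => ‖z‖ ^ 2 := contDiff_norm_sq ℝ
  have hA : HasPV F fun x => (W x : ℂ) * θ x := by
    refine hasPV_chart (V := V) (R := C) (η := η) hkj
      (w := fun z => Real.smoothTransition ((C - ‖z‖ ^ 2) / (1 + ‖z‖ ^ 2))) ?_ ?_ ?_ ?_ hgV h1
      (h3.trans Set.inter_subset_left)
    · refine Real.smoothTransition.contDiff.comp ((contDiff_const.sub hn).div
        (contDiff_const.add hn) fun z => by positivity)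
    · intro z hz
      exact Real.smoothTransition.zero_of_nonpos
        (div_nonpos_of_nonpos_of_nonneg (by linarith) (by positivity))
    · intro x hx
      have hx' : ‖x k‖ ≠ 0 := norm_ne_zero_iff.2 hx
      simp only [hW, blowMap, upd_self, upd_of_ne hkj, norm_mul, add_zero]
      congr 1
      field_simp
    · rintro x ⟨hx1, hx2⟩
      refine hδV (Metric.mem_cthickening_of_dist_le x (Pi.single j (x j)) δ _
        ⟨x j, by simpa using Real.le_sqrt_of_sq_le hx2, rfl⟩ ?_)
      rw [dist_pi_le_iff hδ.le]
      intro i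
      by_cases hij : i = j
      · subst hij; simp [hδ.le]
      · simpa [hij] using (hx1 i hij).trans (min_le_left _ _)
  have hB : HasPV F fun x => ((1 - W x : ℝ) : ℂ) * θ x := by
    refine hasPV_chart (V := U₂) (R := 2 / (C - 1)) (η := η) hkj.symm
      (w := fun z => 1 - Real.smoothTransition ((C * ‖z‖ ^ 2 - 1) / (‖z‖ ^ 2 + 1))) ?_ ?_ ?_ ?_ hg₂ h1
      (h3.trans Set.inter_subset_left)
    · refine contDiff_const.sub (Real.smoothTransition.contDiff.comp (((contDiff_const.mul hn).sub
        contDiff_const).div (hn.add contDiff_const) fun z => by positivity))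
    · intro z hz
      rw [div_lt_iff₀ (by linarith)] at hz
      rw [Real.smoothTransition.one_of_one_le, sub_self]
      rw [one_le_div (by positivity)]
      nlinarith
    · intro x hx
      have hx' : ‖x j‖ ≠ 0 := norm_ne_zero_iff.2 hx
      simp only [hW, blowMap, upd_self, upd_of_ne hkj.symm, norm_mul, add_zero]
      congr 2
      field_simp
    · rintro x ⟨hx1, hx2⟩
      apply hrU
      rw [mem_ball_zero_iff]
      refine lt_of_le_of_lt ?_ (half_lt_self hr)
      rw [pi_norm_le_iff_of_nonneg (by positivity)]
      intro i
      by_cases hij : i = k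
      · subst hij
        rw [hC1] at hx2
        simpa using abs_le_of_sq_le_sq hx2 (by positivity)
      · exact (hx1 i hij).trans (min_le_right _ _)
  have hi : ∀ ε > 0, Integrable (pvInt F θ ε) := fun ε hε =>
    integrable_pvInt hUo (hFO.continuousOn.mono Set.inter_subset_right) h1.continuous h2 h3 hε
  have hiW : ∀ g : CSpace N → ℝ, Measurable g → (∀ x, g x ∈ Set.Icc (0 : ℝ) 1) → ∀ ε > 0,
      Integrable (pvInt F (fun x => (g x : ℂ) * θ x) ε) := by
    intro g hg hg1 ε hε
    have : pvInt F (fun x => (g x : ℂ) * θ x) ε = fun x => (g x : ℂ) * pvInt F θ ε x := by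
      ext x; unfold pvInt; split_ifs <;> ring
    rw [this]
    refine (hi ε hε).bdd_mul (c := 1) (Complex.measurable_ofReal.comp hg).aestronglyMeasurable
      (Eventually.of_forall fun x => ?_)
    simpa [abs_of_nonneg (hg1 x).1] using (hg1 x).2
  have hW01 : ∀ x, W x ∈ Set.Icc (0 : ℝ) 1 := fun x =>
    ⟨Real.smoothTransition.nonneg _, Real.smoothTransition.le_one _⟩
  have := HasPV.add (hiW W hWm hW01)
    (hiW (fun x => 1 - W x) (measurable_const.sub hWm) fun x =>
      ⟨by linarith [(hW01 x).2], by linarith [(hW01 x).1]⟩) hA hB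
  convert this using 2
  push_cast
  ring

end Charts

section Power

variable {N : ℕ}

/-- Raising one coordinate to the `d`-th power. -/
def powMap (i : Fin N) (d : ℕ) (x : CSpace N) : CSpace N := upd i (fun x => x i ^ d) x

theorem holAt_coord_pow (i : Fin N) (d : ℕ) (p : CSpace N) : HolAt (fun x : CSpace N => x i ^ d) p :=
  (holAt_coord i p).pow d

theorem integral_powMap (i : Fin N) {d : ℕ} (hd : 0 < d) {H : CSpace N → ℂ}
    (hH : Integrable fun x : CSpace N =>
      ((‖(d : ℂ) * x i ^ (d - 1)‖ ^ 2 : ℝ) : ℂ) * H (powMap i d x)) :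
    ∫ x : CSpace N, ((‖(d : ℂ) * x i ^ (d - 1)‖ ^ 2 : ℝ) : ℂ) * H (powMap i d x) =
      d * ∫ x, H x := by
  have hdC : (d : ℂ) ≠ 0 := by exact_mod_cast hd.ne'
  have : NeZero d := ⟨hd.ne'⟩
  have hζ := Complex.isPrimitiveRoot_exp d hd.ne'
  set ζ := Complex.exp (2 * Real.pi * Complex.I / d) with hζd
  have hζ0 : ζ ≠ 0 := Complex.exp_ne_zero _
  let S : ℕ → Set (CSpace N) := fun m =>
    {x | x i ≠ 0} ∩ {x | x i = (x i ^ d) ^ (1 / (d : ℂ)) * ζ ^ m}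
  have hroot : ∀ z : ℂ, (z ^ (1 / (d : ℂ))) ^ d = z := fun z => by
    rw [one_div, Complex.cpow_nat_inv_pow _ hd.ne']
  have hSm : ∀ m, MeasurableSet (S m) := fun m =>
    (measurableSet_coord_ne_zero i).inter (measurableSet_eq_fun (by fun_prop) (by fun_prop))
  have hcov : (⋃ m ∈ Finset.range d, S m) = {x : CSpace N | x i ≠ 0} := by
    ext x
    simp only [Set.mem_iUnion, Finset.mem_range, S]
    constructor
    · rintro ⟨m, -, hx, -⟩; exact hx
    · intro hx
      have hx' : x i ≠ 0 := hx
      have hr : (x i ^ d) ^ (1 / (d : ℂ)) ≠ 0 := fun h0 => by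
        have := hroot (x i ^ d)
        rw [h0, zero_pow hd.ne'] at this
        exact pow_ne_zero d hx' this.symm
      obtain ⟨m, hm, hmx⟩ := hζ.eq_pow_of_pow_eq_one (ξ := x i / (x i ^ d) ^ (1 / (d : ℂ))) (by
        rw [div_pow, hroot, div_self (pow_ne_zero d hx')])
      refine ⟨m, hm, hx, ?_⟩
      simp only [Set.mem_ofPred_eq]
      rw [hmx, mul_div_cancel₀ _ hr]
  have hdisj : Set.Pairwise (↑(Finset.range d)) (Function.onFun Disjoint S) := by
    intro m hm m' hm' hne
    refine Set.disjoint_left.2 fun x hx hx' => hne ?_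
    have h1 : x i = _ := hx.2
    have h2 : x i = _ := hx'.2
    have hr : (x i ^ d) ^ (1 / (d : ℂ)) ≠ 0 := fun h0 => by
      rw [h0, zero_mul] at h1; exact hx.1 h1
    exact hζ.pow_inj (by simpa using hm) (by simpa using hm')
      (mul_left_cancel₀ hr (h1.symm.trans h2))
  have hsec : ∀ m, ∫ x in S m, ((‖(d : ℂ) * x i ^ (d - 1)‖ ^ 2 : ℝ) : ℂ) * H (powMap i d x) =
      ∫ x, H x := by
    intro m
    have himg : upd i (fun x : CSpace N => x i ^ d) '' S m = {x | x i ≠ 0} := by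
      ext y
      constructor
      · rintro ⟨x, hx, rfl⟩
        have : x i ≠ 0 := hx.1
        simpa using fun h => absurd h this
      · intro hy
        have hy' : y i ≠ 0 := hy
        have hpow : (y i ^ (1 / (d : ℂ)) * ζ ^ m) ^ d = y i := by
          rw [mul_pow, hroot, ← pow_mul, mul_comm m d, pow_mul, hζ.pow_eq_one, one_pow, mul_one]
        refine ⟨Function.update y i (y i ^ (1 / (d : ℂ)) * ζ ^ m), ⟨?_, ?_⟩, ?_⟩
        · intro h0
          simp only [Function.update_self] at h0
          rw [h0, zero_pow hd.ne'] at hpow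
          exact hy' hpow.symm
        · simp only [Set.mem_ofPred_eq, Function.update_self, hpow]
        · ext l
          by_cases hl : l = i
          · subst hl; rw [upd_self, Function.update_self, hpow]
          · simp [upd_of_ne hl, hl]
    have hinj : Set.InjOn (upd i (fun x : CSpace N => x i ^ d)) (S m) := by
      intro x hx y hy hxy
      ext l
      have := congrFun hxy l
      by_cases hl : l = i
      · subst hl
        simp only [upd_self] at this
        have h1 : x l = _ := hx.2
        have h2 : y l = _ := hy.2
        rw [h1, h2, this]
      · rwa [upd_of_ne hl, upd_of_ne hl] at this
    rw [← setIntegral_coord_ne_zero i H, ← himg, setIntegral_image_upd (hSm m)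
      (fun x _ => (holAt_coord_pow i d x).differentiableAt) hinj]
    congr 1
    ext x
    have hd : HasFDerivAt (fun x : CSpace N => x i ^ d) _ x :=
      ((ContinuousLinearMap.proj i : CSpace N →L[ℂ] ℂ).hasFDerivAt (x := x)).pow d
    rw [hd.fderiv]
    simp [powMap]
  rw [← setIntegral_coord_ne_zero i, ← hcov, integral_biUnion_finset _ (fun m _ => hSm m) hdisj
    fun m _ => hH.integrableOn]
  rw [Finset.sum_congr rfl fun m _ => hsec m]
  simp

theorem GoodAt.of_pow {i : Fin N} {d : ℕ} (hd : 0 < d) {F : CSpace N → ℂ} (hF : HolAt F 0)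
    (h : GoodAt (fun x => F (powMap i d x)) 0) : GoodAt F 0 := by
  obtain ⟨U, hU, h0, hcU, hg⟩ := h
  obtain ⟨r, hr, hrU⟩ := Metric.isOpen_iff.1 hU 0 h0
  obtain ⟨O, hO, hO0, hFO⟩ := hF.exists_open
  set s := min (r / 2) 1 with hs
  have hsp : 0 < s := by positivity
  have hs1 : s ≤ 1 := min_le_right _ _
  set η := s ^ d with hη
  have hηp : 0 < η := by positivity
  have hηs : η ≤ s := pow_le_of_le_one hsp.le hs1 hd.ne'
  have hUo : IsOpen (Metric.ball (0 : CSpace N) η ∩ O) := Metric.isOpen_ball.inter hO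
  refine ⟨_, hUo, ⟨Metric.mem_ball_self hηp, hO0⟩,
    hFO.continuousOn.mono Set.inter_subset_right, fun θ h1 h2 h3 => ?_⟩
  set θ' : CSpace N → ℂ := fun x =>
    ((‖(d : ℂ) * x i ^ (d - 1)‖ ^ 2 : ℝ) : ℂ) * θ (powMap i d x) with hθ'
  have hsm : ContDiffOn ℝ ∞ θ' Set.univ := by
    refine (contDiff_normSq (contDiffOn_real_of_hol fun x _ =>
      (holAt_const (d : ℂ) x).mul (holAt_coord_pow i (d - 1) x))).mul ?_
    exact h1.comp_contDiffOn (contDiffOn_upd i fun x _ => holAt_coord_pow i d x)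
  have hz : ∀ x ∉ Metric.closedBall (0 : CSpace N) s, θ' x = 0 := by
    intro x hx
    have : θ (powMap i d x) = 0 := image_eq_zero_of_notMem_tsupport fun h => hx (by
      have h2 := (h3 h).1
      rw [mem_ball_zero_iff] at h2
      rw [mem_closedBall_zero_iff, pi_norm_le_iff_of_nonneg hsp.le]
      intro l
      have h4 := (norm_le_pi_norm (powMap i d x) l).trans h2.le
      rw [powMap] at h4
      by_cases hl : l = i
      · subst hl
        rw [upd_self, norm_pow] at h4
        exact le_of_pow_le_pow_left₀ hd.ne' hsp.le h4
      · rw [upd_of_ne hl] at h4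
        exact h4.trans hηs)
    simp [hθ', this]
  obtain ⟨k1, k2, k3⟩ := contDiff_of_zero_off_compact isOpen_univ hsm
    (isCompact_closedBall (0 : CSpace N) s) (Set.subset_univ _) hz
  have hsU : tsupport θ' ⊆ U := k3.trans ((Metric.closedBall_subset_ball (by
    linarith [min_le_left (r / 2) 1])).trans hrU)
  obtain ⟨L, hL⟩ := hg θ' k1 k2 hsU
  refine ⟨(d : ℂ)⁻¹ * L, (hL.const_mul _).congr' ?_⟩
  filter_upwards [self_mem_nhdsWithin] with ε hε
  have heq : pvInt (fun x => F (powMap i d x)) θ' ε = fun x =>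
      ((‖(d : ℂ) * x i ^ (d - 1)‖ ^ 2 : ℝ) : ℂ) * pvInt F θ ε (powMap i d x) := by
    ext x
    simp only [pvInt, hθ']
    split_ifs <;> ring
  have hintg := integrable_pvInt hU hcU k1.continuous k2 hsU hε
  rw [heq] at hintg ⊢
  rw [integral_powMap i hd hintg, inv_mul_cancel_left₀ (by exact_mod_cast hd.ne')]

end Power

section Monomial

variable {N : ℕ}

/-- Multiplication of one coordinate by a unit complex number preserves integrals. -/
theorem integral_rotate (i : Fin N) {c : ℂ} (hc : ‖c‖ = 1) (H : CSpace N → ℂ) :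
    ∫ x, H (upd i (fun x => c * x i) x) = ∫ x, H x := by
  have hc0 : c ≠ 0 := by rintro rfl; simp at hc
  have hder : ∀ x : CSpace N, fderiv ℂ (fun x : CSpace N => c * x i) x (Pi.single i 1) = c := by
    intro x
    have hd : HasFDerivAt (fun x : CSpace N => c * x i) _ x :=
      ((ContinuousLinearMap.proj i : CSpace N →L[ℂ] ℂ).hasFDerivAt (x := x)).const_mul c
    rw [hd.fderiv]
    simp
  have himg : upd i (fun x : CSpace N => c * x i) '' Set.univ = Set.univ := by
    rw [Set.image_univ]
    refine Set.range_eq_univ.2 fun y => ⟨upd i (fun x => c⁻¹ * x i) y, ?_⟩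
    ext l
    by_cases hl : l = i
    · subst hl; simp [hc0]
    · simp [upd_of_ne hl]
  have hinj : Set.InjOn (upd i (fun x : CSpace N => c * x i)) Set.univ := by
    intro x _ y _ hxy
    ext l
    have := congrFun hxy l
    by_cases hl : l = i
    · subst hl
      simpa [hc0] using this
    · rwa [upd_of_ne hl, upd_of_ne hl] at this
  have := setIntegral_image_upd (j := i) MeasurableSet.univ (fun x _ =>
    ((holAt_const c x).mul (holAt_coord i x)).differentiableAt) hinj H
  rw [himg, Measure.restrict_univ] at this
  rw [this]
  congr 1
  ext x
  rw [hder, hc]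
  simp

/-- The monomial `x ^ α`. -/
def mono (α : Fin N → ℕ) (x : CSpace N) : ℂ := ∏ i, x i ^ α i

theorem holAt_mono (α : Fin N → ℕ) (p : CSpace N) : HolAt (mono α) p :=
  HolAt.prod fun i _ => (holAt_coord i p).pow (α i)

theorem continuous_mono (α : Fin N → ℕ) : Continuous (mono α : CSpace N → ℂ) := by
  unfold mono; fun_prop

/-- The truncation of `x ^ (-a) * conj x ^ b` to the set `ε < |x ^ α| ^ 2`. -/
noncomputable def monoKer (α a b : Fin N → ℕ) (ε : ℝ) (x : CSpace N) : ℂ :=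
  if ε < ‖mono α x‖ ^ 2 then ∏ i, (x i ^ a i)⁻¹ * (starRingEnd ℂ) (x i) ^ b i else 0

theorem measurable_monoKer (α a b : Fin N → ℕ) (ε : ℝ) : Measurable (monoKer α a b ε) := by
  refine Measurable.ite (measurableSet_lt measurable_const
    ((continuous_mono α).norm.pow 2).measurable) ?_ measurable_const
  refine Finset.measurable_prod _ fun i _ => ?_
  have : Measurable fun x : CSpace N => (starRingEnd ℂ) (x i) ^ b i :=
    (((Complex.continuous_conj).comp (continuous_apply i)).pow _).measurable
  exact Measurable.mul (by fun_prop) this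

theorem norm_monoKer_le {α a b : Fin N → ℕ} (ha : a ≤ α) {ε : ℝ} (hε : 0 < ε) {R : ℝ} (hR : 1 ≤ R)
    {x : CSpace N} (hx : ∀ i, ‖x i‖ ≤ R) :
    ‖monoKer α a b ε x‖ ≤ (∏ i, R ^ (α i + b i)) / √ε := by
  have hpos : 0 ≤ (∏ i, R ^ (α i + b i)) / √ε := by positivity
  rw [monoKer]
  split_ifs with h
  · have hm : √ε ≤ ‖mono α x‖ := Real.sqrt_le_iff.2 ⟨norm_nonneg _, h.le⟩
    rw [le_div_iff₀ (Real.sqrt_pos.2 hε)]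
    refine (mul_le_mul_of_nonneg_left hm (norm_nonneg _)).trans ?_
    rw [mono, ← norm_mul, ← Finset.prod_mul_distrib, norm_prod]
    refine Finset.prod_le_prod (fun _ _ => norm_nonneg _) fun i _ => ?_
    rw [norm_mul, norm_mul, norm_inv, norm_pow, norm_pow, norm_pow, RCLike.norm_conj, pow_add]
    rw [mul_right_comm]
    refine mul_le_mul ?_ (pow_le_pow_left₀ (norm_nonneg _) (hx i) _) (by positivity) (by positivity)
    by_cases h0 : ‖x i‖ = 0
    · rw [h0]
      rcases Nat.eq_zero_or_pos (a i) with h1 | h1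
      · rw [h1]; simp only [pow_zero, inv_one, one_mul]
        exact pow_le_pow_left₀ le_rfl (by linarith) _
      · rw [zero_pow h1.ne']; simp only [inv_zero, zero_mul]; positivity
    · rw [mul_comm, ← pow_sub₀ _ h0 (ha i)]
      exact (pow_le_pow_left₀ (norm_nonneg _) (hx i) _).trans (pow_le_pow_right₀ hR (Nat.sub_le _ _))
  · simpa using hpos

theorem monoKer_rotate (α a b : Fin N → ℕ) (ε : ℝ) (i : Fin N) {c : ℂ} (hc : ‖c‖ = 1) (x : CSpace N) :
    monoKer α a b ε (upd i (fun x => c * x i) x) =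
      (c ^ (a i + b i))⁻¹ * monoKer α a b ε x := by
  have hc0 : c ≠ 0 := by rintro rfl; simp at hc
  have hm : ‖mono α (upd i (fun x => c * x i) x)‖ = ‖mono α x‖ := by
    simp only [mono, norm_prod]
    refine Finset.prod_congr rfl fun l _ => ?_
    by_cases hl : l = i
    · subst hl; simp [hc]
    · rw [upd_of_ne hl]
  simp only [monoKer, hm]
  split_ifs
  · rw [← Finset.mul_prod_erase _ _ (Finset.mem_univ i), ← Finset.mul_prod_erase _ _ (Finset.mem_univ i),
      ← mul_assoc, Finset.prod_congr rfl (g := fun l => (x l ^ a l)⁻¹ * (starRingEnd ℂ) (x l) ^ b l)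
      fun l hl => by rw [upd_of_ne (Finset.ne_of_mem_erase hl)]]
    congr 1
    rw [upd_self, map_mul, mul_pow, mul_pow, mul_inv, pow_add, mul_inv]
    have : (starRingEnd ℂ) c = c⁻¹ := by
      rw [Complex.inv_def, Complex.normSq_eq_norm_sq, hc]; simp
    rw [this, inv_pow]
    ring
  · simp

/-- The kernel paired with a test function is integrable. -/
theorem integrable_mul_monoKer {α a b : Fin N → ℕ} (ha : a ≤ α) {ε : ℝ} (hε : 0 < ε)
    {θ : CSpace N → ℂ} (hθ : Continuous θ) (hc : HasCompactSupport θ) :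
    Integrable fun x => θ x * monoKer α a b ε x := by
  obtain ⟨R, hR1, hR⟩ : ∃ R : ℝ, 1 ≤ R ∧ ∀ x ∈ tsupport θ, ‖x‖ ≤ R := by
    obtain ⟨R, hR⟩ := hc.isCompact.isBounded.exists_norm_le
    exact ⟨max 1 R, le_max_left _ _, fun x hx => (hR x hx).trans (le_max_right _ _)⟩
  refine ((hθ.integrable_of_hasCompactSupport hc).norm.mul_const
    ((∏ i, R ^ (α i + b i)) / √ε)).mono'
    (hθ.measurable.mul (measurable_monoKer α a b ε)).aestronglyMeasurable
    (Eventually.of_forall fun x => ?_)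
  rw [norm_mul]
  by_cases hx : x ∈ tsupport θ
  · exact mul_le_mul_of_nonneg_left (norm_monoKer_le ha hε hR1 fun i =>
      (norm_le_pi_norm x i).trans (hR x hx)) (norm_nonneg _)
  · simp [image_eq_zero_of_notMem_tsupport hx]

theorem integral_rotate_deriv {α a b : Fin N → ℕ} (ha : a ≤ α) {ε : ℝ} (hε : 0 < ε)
    {θ : CSpace N → ℂ} (hθ : ContDiff ℝ ∞ θ) (hc : HasCompactSupport θ) (i : Fin N) :
    ∫ x, (fderiv ℝ θ x (Pi.single i (Complex.I * x i)) -
      ((a i + b i : ℕ) : ℂ) * Complex.I * θ x) * monoKer α a b ε x = 0 := by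
  set n := a i + b i with hn
  let c : ℝ → ℂ := fun t => Complex.exp (t * Complex.I)
  have hcn : ∀ t, ‖c t‖ = 1 := fun t => Complex.norm_exp_ofReal_mul_I t
  have hcd : ∀ t : ℝ, HasDerivAt c (Complex.I * c t) t := fun t => by
    have := ((Complex.ofRealCLM.hasDerivAt (x := t)).mul_const Complex.I).cexp
    refine this.congr_deriv ?_
    simp [c, mul_comm]
  let Rt : ℝ → CSpace N → CSpace N := fun t => upd i fun x => c t * x i
  have hRn : ∀ t x, ‖Rt t x‖ = ‖x‖ := fun t x => by
    simp only [Pi.norm_def]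
    congr 1
    refine Finset.sup_congr rfl fun l _ => ?_
    by_cases hl : l = i
    · subst hl; ext; simp [Rt, hcn]
    · simp [Rt, upd_of_ne hl]
  let D : CSpace N → ℂ := fun x => fderiv ℝ θ x (Pi.single i (Complex.I * x i)) - (n : ℂ) * Complex.I * θ x
  have hDc : Continuous D := by
    have h1 : Continuous (fderiv ℝ θ) := hθ.continuous_fderiv (by simp)
    have h2 : Continuous fun x : CSpace N => (Pi.single i (Complex.I * x i) : CSpace N) :=
      (continuous_single i).comp (by fun_prop)
    exact (h1.clm_apply h2).sub (continuous_const.mul hθ.continuous)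
  have hDs : HasCompactSupport D := by
    refine HasCompactSupport.intro hc.isCompact fun x hx => ?_
    have h1 : fderiv ℝ θ x = 0 := image_eq_zero_of_notMem_tsupport fun h => hx (tsupport_fderiv_subset ℝ h)
    simp [D, h1, image_eq_zero_of_notMem_tsupport hx]
  obtain ⟨C, hC⟩ := hDs.exists_bound_of_continuous hDc
  obtain ⟨R, hR1, hR⟩ : ∃ R : ℝ, 1 ≤ R ∧ ∀ x ∈ tsupport θ, ‖x‖ ≤ R := by
    obtain ⟨R, hR⟩ := hc.isCompact.isBounded.exists_norm_le
    exact ⟨max 1 R, le_max_left _ _, fun x hx => (hR x hx).trans (le_max_right _ _)⟩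
  let F : ℝ → CSpace N → ℂ := fun t x => (c t ^ n)⁻¹ * θ (Rt t x) * monoKer α a b ε x
  let F' : ℝ → CSpace N → ℂ := fun t x => (c t ^ n)⁻¹ * D (Rt t x) * monoKer α a b ε x
  have hF : ∀ t x, F t x = (fun y => θ y * monoKer α a b ε y) (Rt t x) := fun t x => by
    simp only [F, Rt]
    rw [monoKer_rotate α a b ε i (hcn t)]
    ring
  have hconst : ∀ t, ∫ x, F t x = ∫ x, θ x * monoKer α a b ε x := fun t => by
    simp only [hF]
    exact integral_rotate i (hcn t) fun x => θ x * monoKer α a b ε x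
  have hc0 : c 0 = 1 := by simp [c]
  have hR0 : ∀ x, Rt 0 x = x := fun x => by
    ext l
    by_cases hl : l = i
    · subst hl; simp [Rt, hc0]
    · simp [Rt, upd_of_ne hl]
  have hRc : ∀ t, Continuous (Rt t) := fun t => by
    refine continuous_pi fun l => ?_
    by_cases hl : l = i
    · subst hl; simp only [Rt, upd_self]; fun_prop
    · simp only [Rt, upd_of_ne hl]; fun_prop
  have key := hasDerivAt_integral_of_dominated_loc_of_deriv_le (μ := volume) (F := F) (F' := F') (x₀ := 0)
    (bound := (Metric.closedBall (0 : CSpace N) R).indicator fun _ =>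
      C * ((∏ i, R ^ (α i + b i)) / √ε)) (s := Set.univ) univ_mem
    (Eventually.of_forall fun t =>
      ((measurable_const.mul (hθ.continuous.comp (hRc t)).measurable).mul
        (measurable_monoKer α a b ε)).aestronglyMeasurable)
    (by
      have : F 0 = fun y => θ y * monoKer α a b ε y := by ext x; rw [hF, hR0]
      rw [this]; exact integrable_mul_monoKer ha hε hθ.continuous hc)
    ((measurable_const.mul (hDc.comp (hRc 0)).measurable).mul
        (measurable_monoKer α a b ε)).aestronglyMeasurable
    (Eventually.of_forall fun x t _ => by
      by_cases hx : x ∈ Metric.closedBall (0 : CSpace N) R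
      · rw [Set.indicator_of_mem hx]
        rw [mem_closedBall_zero_iff] at hx
        simp only [F', norm_mul, norm_inv, norm_pow, hcn, one_pow, inv_one, one_mul]
        have hC0 : 0 ≤ C := (norm_nonneg _).trans (hC 0)
        exact mul_le_mul (hC _) (norm_monoKer_le ha hε hR1 fun i => (norm_le_pi_norm x i).trans hx)
          (norm_nonneg _) hC0
      · rw [Set.indicator_of_notMem hx]
        rw [mem_closedBall_zero_iff, ← hRn t] at hx
        have h0 : Rt t x ∉ tsupport θ := fun h => hx (hR _ h)
        have h1 : fderiv ℝ θ (Rt t x) = 0 :=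
          image_eq_zero_of_notMem_tsupport fun h => h0 (tsupport_fderiv_subset ℝ h)
        simp [F', D, h1, image_eq_zero_of_notMem_tsupport h0])
    ((integrable_indicator_iff measurableSet_closedBall).2
      (integrableOn_const (isCompact_closedBall _ _).measure_ne_top))
    (Eventually.of_forall fun x t _ => by
      have h1 : HasDerivAt (fun t => Rt t x) (Pi.single i (Complex.I * (Rt t x) i)) t := by
        refine hasDerivAt_pi.2 fun l => ?_
        by_cases hl : l = i
        · subst hl
          simpa [Rt, mul_assoc] using (hcd t).mul_const (x l)
        · simpa [Rt, upd_of_ne hl, hl] using hasDerivAt_const t (x l)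
      have h2 := ((hθ.differentiable (by simp)) (Rt t x)).hasFDerivAt.comp_hasDerivAt t h1
      have hne : c t ^ n ≠ 0 := pow_ne_zero _ (Complex.exp_ne_zero _)
      have h3 := (((hcd t).pow n).inv hne).mul h2
      refine (h3.mul_const (monoKer α a b ε x)).congr_deriv ?_
      simp only [F', D]
      congr 1
      rcases Nat.eq_zero_or_pos n with hn0 | hn0
      · simp [hn0]
      · obtain ⟨m, hm⟩ := Nat.exists_eq_succ_of_ne_zero hn0.ne'
        have hct : c t ≠ 0 := Complex.exp_ne_zero _
        simp only [hm, Nat.succ_eq_add_one, Nat.add_sub_cancel, Function.comp]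
        simp only [Pi.pow_apply, Pi.inv_apply]
        field_simp
        ring)
  have h0 : HasDerivAt (fun t => ∫ x, F t x) 0 0 := by
    simp only [hconst]; exact hasDerivAt_const _ _
  have := key.2.unique h0
  rw [← this]
  congr 1
  ext x
  simp [F', hc0, hR0, D]

/-- The regularized integrals against `x ^ (-a) * conj x ^ b` converge. -/
def MonoConv (α a b : Fin N → ℕ) : Prop :=
  ∀ θ : CSpace N → ℂ, ContDiff ℝ ∞ θ → HasCompactSupport θ →
    ∃ L : ℂ, Tendsto (fun ε : ℝ => ∫ x, θ x * monoKer α a b ε x) (𝓝[>] 0) (𝓝 L)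

theorem MonoConv.of_le {α a b : Fin N → ℕ} (hab : a ≤ b) : MonoConv α a b := by
  intro θ hθ hc
  obtain ⟨R, hR1, hR⟩ : ∃ R : ℝ, 1 ≤ R ∧ ∀ x ∈ tsupport θ, ‖x‖ ≤ R := by
    obtain ⟨R, hR⟩ := hc.isCompact.isBounded.exists_norm_le
    exact ⟨max 1 R, le_max_left _ _, fun x hx => (hR x hx).trans (le_max_right _ _)⟩
  let G : CSpace N → ℂ := fun x => if 0 < ‖mono α x‖ ^ 2 then
    ∏ i, (x i ^ a i)⁻¹ * (starRingEnd ℂ) (x i) ^ b i else 0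
  refine ⟨∫ x, θ x * G x, tendsto_integral_filter_of_dominated_convergence
    (fun x => ‖θ x‖ * ∏ i, R ^ b i) ?_ ?_ ?_ ?_⟩
  · exact Eventually.of_forall fun ε =>
      (hθ.continuous.measurable.mul (measurable_monoKer α a b ε)).aestronglyMeasurable
  · refine Eventually.of_forall fun ε => Eventually.of_forall fun x => ?_
    rw [norm_mul]
    by_cases hx : x ∈ tsupport θ
    · refine mul_le_mul_of_nonneg_left ?_ (norm_nonneg _)
      rw [monoKer]
      split_ifs
      · rw [norm_prod]
        refine Finset.prod_le_prod (fun _ _ => norm_nonneg _) fun i _ => ?_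
        have hxi : ‖x i‖ ≤ R := (norm_le_pi_norm x i).trans (hR x hx)
        rw [norm_mul, norm_inv, norm_pow, norm_pow, RCLike.norm_conj]
        by_cases h0 : ‖x i‖ = 0
        · rw [h0]
          rcases Nat.eq_zero_or_pos (a i) with h1 | h1
          · rw [h1]; simp only [pow_zero, inv_one, one_mul]
            exact pow_le_pow_left₀ le_rfl (by linarith) _
          · rw [zero_pow h1.ne']; simp only [inv_zero, zero_mul]; positivity
        · rw [mul_comm, ← pow_sub₀ _ h0 (hab i)]
          exact (pow_le_pow_left₀ (norm_nonneg _) hxi _).trans (pow_le_pow_right₀ hR1 (Nat.sub_le _ _))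
      · simp only [norm_zero]; positivity
    · simp [image_eq_zero_of_notMem_tsupport hx]
  · exact (hθ.continuous.integrable_of_hasCompactSupport hc).norm.mul_const _
  · refine Eventually.of_forall fun x => ?_
    refine Tendsto.const_mul _ (tendsto_const_nhds.congr' ?_)
    simp only [monoKer, G]
    by_cases h : 0 < ‖mono α x‖ ^ 2
    · filter_upwards [nhdsWithin_le_nhds (eventually_lt_nhds h)] with ε hε
      simp [h, hε]
    · filter_upwards [self_mem_nhdsWithin] with ε hε
      have hε' : 0 < ε := hε
      rw [if_neg h, if_neg (by linarith)]

theorem contDiff_fderiv_apply_real {θ : CSpace N → ℂ} (hθ : ContDiff ℝ ∞ θ) (v : CSpace N) :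
    ContDiff ℝ ∞ fun x => fderiv ℝ θ x v :=
  (hθ.fderiv_right (m := ∞) (by simp)).clm_apply contDiff_const

theorem hasCompactSupport_fderiv_apply {θ : CSpace N → ℂ} (hc : HasCompactSupport θ) (v : CSpace N) :
    HasCompactSupport fun x => fderiv ℝ θ x v :=
  hc.fderiv_apply ℝ v

theorem single_I_mul_decomp (i : Fin N) (z : ℂ) (A : CSpace N →L[ℝ] ℂ) :
    A (Pi.single i (Complex.I * z)) =
      Complex.I * (z * ((A (Pi.single i 1) - Complex.I * A (Pi.single i Complex.I)) / 2)) -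
      Complex.I * ((starRingEnd ℂ) z * ((A (Pi.single i 1) + Complex.I * A (Pi.single i Complex.I)) / 2)) := by
  have h : (Pi.single i (Complex.I * z) : CSpace N) =
      (-z.im) • (Pi.single i 1 : CSpace N) + z.re • (Pi.single i Complex.I : CSpace N) := by
    rw [← Pi.single_smul, ← Pi.single_smul, ← Pi.single_add]
    congr 1
    apply Complex.ext <;> simp
  rw [h, map_add, map_smul, map_smul]
  obtain ⟨p, q⟩ := z
  have : (⟨p, q⟩ : ℂ) = p + q * Complex.I := Complex.mk_eq_add_mul_I p q
  rw [this]
  simp only [map_add, map_mul, Complex.conj_ofReal, Complex.conj_I, Complex.real_smul, Complex.add_re,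
    Complex.add_im, Complex.ofReal_re, Complex.ofReal_im, Complex.mul_re, Complex.mul_im, Complex.I_re, Complex.I_im]
  push_cast
  linear_combination (-q * A (Pi.single i 1) + p * A (Pi.single i Complex.I)) * Complex.I_sq

theorem MonoConv.step {α a b : Fin N → ℕ} (ha : a ≤ α) {i : Fin N} (hi : 0 < a i)
    (h₁ : MonoConv α (Function.update a i (a i - 1)) b)
    (h₂ : MonoConv α a (Function.update b i (b i + 1))) : MonoConv α a b := by
  intro θ hθ hc
  set θ₁ : CSpace N → ℂ := fun x =>
    (fderiv ℝ θ x (Pi.single i 1) - Complex.I * fderiv ℝ θ x (Pi.single i Complex.I)) / 2 with hθ₁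
  set θ₂ : CSpace N → ℂ := fun x =>
    (fderiv ℝ θ x (Pi.single i 1) + Complex.I * fderiv ℝ θ x (Pi.single i Complex.I)) / 2 with hθ₂
  have s1 : ContDiff ℝ ∞ θ₁ := ((contDiff_fderiv_apply_real hθ _).sub
    (contDiff_const.mul (contDiff_fderiv_apply_real hθ _))).div_const _
  have s2 : ContDiff ℝ ∞ θ₂ := ((contDiff_fderiv_apply_real hθ _).add
    (contDiff_const.mul (contDiff_fderiv_apply_real hθ _))).div_const _
  have hz : ∀ x ∉ tsupport θ, fderiv ℝ θ x = 0 := fun x hx =>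
    image_eq_zero_of_notMem_tsupport fun h => hx (tsupport_fderiv_subset ℝ h)
  have c1 : HasCompactSupport θ₁ := HasCompactSupport.intro hc.isCompact fun x hx => by
    simp [hθ₁, hz x hx]
  have c2 : HasCompactSupport θ₂ := HasCompactSupport.intro hc.isCompact fun x hx => by
    simp [hθ₂, hz x hx]
  obtain ⟨L₁, hL₁⟩ := h₁ θ₁ s1 c1
  obtain ⟨L₂, hL₂⟩ := h₂ θ₂ s2 c2
  set n := a i + b i with hn
  have hn0 : (n : ℂ) ≠ 0 := by exact_mod_cast (by omega : n ≠ 0)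
  refine ⟨(n : ℂ)⁻¹ * (L₁ - L₂), ((hL₁.sub hL₂).const_mul _).congr' ?_⟩
  filter_upwards [self_mem_nhdsWithin] with ε hε
  have hε' : 0 < ε := hε
  have ha' : Function.update a i (a i - 1) ≤ α := fun l => by
    by_cases hl : l = i
    · subst hl; simpa using (Nat.sub_le _ _).trans (ha l)
    · simpa [hl] using ha l
  have e1 : ∀ x : CSpace N, monoKer α (Function.update a i (a i - 1)) b ε x =
      x i * monoKer α a b ε x := by
    intro x
    simp only [monoKer]
    split_ifs with h
    · have hxi : x i ≠ 0 := fun h0 => by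
        have : mono α x = 0 := Finset.prod_eq_zero (Finset.mem_univ i) (by
          rw [h0, zero_pow]; have : a i ≤ α i := ha i; omega)
        rw [this] at h
        simp at h; linarith
      rw [← Finset.mul_prod_erase _ _ (Finset.mem_univ i), ← Finset.mul_prod_erase _ _ (Finset.mem_univ i),
        ← mul_assoc, Finset.prod_congr rfl (g := fun l => (x l ^ a l)⁻¹ * (starRingEnd ℂ) (x l) ^ b l)
        fun l hl => by rw [Function.update_of_ne (Finset.ne_of_mem_erase hl)]]
      congr 1
      obtain ⟨m, hm⟩ := Nat.exists_eq_succ_of_ne_zero hi.ne'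
      rw [Function.update_self, hm, Nat.succ_sub_one, Nat.succ_eq_add_one, pow_succ]
      field_simp
    · simp
  have e2 : ∀ x : CSpace N, monoKer α a (Function.update b i (b i + 1)) ε x =
      (starRingEnd ℂ) (x i) * monoKer α a b ε x := by
    intro x
    simp only [monoKer]
    split_ifs with h
    · rw [← Finset.mul_prod_erase _ _ (Finset.mem_univ i), ← Finset.mul_prod_erase _ _ (Finset.mem_univ i),
        ← mul_assoc, Finset.prod_congr rfl (g := fun l => (x l ^ a l)⁻¹ * (starRingEnd ℂ) (x l) ^ b l)
        fun l hl => by rw [Function.update_of_ne (Finset.ne_of_mem_erase hl)]]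
      congr 1
      rw [Function.update_self, pow_succ]
      ring
    · simp
  have i0 := integrable_mul_monoKer (b := b) ha hε' hθ.continuous hc
  have i1 := integrable_mul_monoKer (b := b) ha' hε' s1.continuous c1
  have i2 := integrable_mul_monoKer (b := Function.update b i (b i + 1)) ha hε' s2.continuous c2
  have hrot := integral_rotate_deriv (b := b) ha hε' hθ hc i
  have heq : ∀ x, (fderiv ℝ θ x (Pi.single i (Complex.I * x i)) -
      ((a i + b i : ℕ) : ℂ) * Complex.I * θ x) * monoKer α a b ε x =
      Complex.I * (θ₁ x * monoKer α (Function.update a i (a i - 1)) b ε x) -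
      Complex.I * (θ₂ x * monoKer α a (Function.update b i (b i + 1)) ε x) -
      (n * Complex.I) * (θ x * monoKer α a b ε x) := by
    intro x
    rw [single_I_mul_decomp, e1, e2]
    simp only [hθ₁, hθ₂, hn]
    ring
  simp only [heq] at hrot
  have j12 : Integrable fun x => Complex.I * (θ₁ x * monoKer α (Function.update a i (a i - 1)) b ε x) -
      Complex.I * (θ₂ x * monoKer α a (Function.update b i (b i + 1)) ε x) :=
    (i1.const_mul _).sub (i2.const_mul _)
  rw [integral_sub j12 (i0.const_mul _),
    integral_sub (i1.const_mul _) (i2.const_mul _), integral_const_mul, integral_const_mul,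
    integral_const_mul] at hrot
  rw [inv_mul_eq_iff_eq_mul₀ hn0]
  have hI := Complex.I_ne_zero
  apply mul_left_cancel₀ hI
  linear_combination hrot

theorem monoConv {α : Fin N → ℕ} : ∀ (m : ℕ) (a b : Fin N → ℕ), a ≤ α → ∑ i, (a i - b i) = m →
    MonoConv α a b := by
  intro m
  induction m with
  | zero =>
    intro a b _ h
    refine MonoConv.of_le fun i => ?_
    have := (Finset.sum_eq_zero_iff.1 h) i (Finset.mem_univ i)
    simp only at this ⊢
    omega
  | succ m ih =>
    intro a b ha h
    obtain ⟨i, -, hi⟩ : ∃ i ∈ Finset.univ, a i - b i ≠ 0 := by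
      by_contra! h0
      rw [Finset.sum_eq_zero h0] at h
      omega
    rw [← Finset.add_sum_erase _ _ (Finset.mem_univ i)] at h
    refine MonoConv.step ha (i := i) (by omega) (ih _ _ (fun l => ?_) ?_) (ih _ _ ha ?_)
    · by_cases hl : l = i
      · subst hl; simpa using (Nat.sub_le _ _).trans (ha l)
      · simpa [hl] using ha l
    · rw [← Finset.add_sum_erase _ _ (Finset.mem_univ i), Function.update_self,
        Finset.sum_congr rfl (g := fun l => a l - b l)
        fun l hl => by rw [Function.update_of_ne (Finset.ne_of_mem_erase hl)]]
      omega
    · rw [← Finset.add_sum_erase _ _ (Finset.mem_univ i), Function.update_self,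
        Finset.sum_congr rfl (g := fun l => a l - b l)
        fun l hl => by rw [Function.update_of_ne (Finset.ne_of_mem_erase hl)]]
      omega

/-- Principal values of inverse monomials exist. -/
theorem goodOn_mono (α : Fin N → ℕ) : GoodOn (mono α) Set.univ := by
  intro θ hθ hc _
  obtain ⟨L, hL⟩ := monoConv _ α 0 le_rfl rfl θ hθ hc
  refine ⟨L, hL.congr fun ε => ?_⟩
  congr 1
  ext x
  simp only [monoKer, pvInt]
  split_ifs
  · simp [mono, Finset.prod_inv_distrib, div_eq_mul_inv]
  · simp

end Monomial

section IsMono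

variable {N : ℕ}

/-- `F` is a monomial times a unit near the origin. -/
def IsMono (F : CSpace N → ℂ) : Prop :=
  ∃ (α : Fin N → ℕ) (u : CSpace N → ℂ), HolAt u 0 ∧ u 0 ≠ 0 ∧ F =ᶠ[𝓝 0] fun x => mono α x * u x

theorem goodAt_of_ne_zero {F : CSpace N → ℂ} {p} (hF : HolAt F p) (h0 : F p ≠ 0) : GoodAt F p := by
  obtain ⟨W, hW, hp, hd⟩ := hF.exists_open
  set c := ‖F p‖ ^ 2 / 2 with hc
  have hc0 : 0 < c := by have := norm_pos_iff.2 h0; positivity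
  have hO : IsOpen (W ∩ (fun x => ‖F x‖ ^ 2) ⁻¹' Set.Ioi c) :=
    (hd.continuousOn.norm.pow 2).isOpen_inter_preimage hW isOpen_Ioi
  refine ⟨_, hO, ⟨hp, ?_⟩, hd.continuousOn.mono Set.inter_subset_left, fun θ h1 h2 h3 => ?_⟩
  · have := norm_pos_iff.2 h0
    simp only [Set.mem_preimage, Set.mem_Ioi, hc]
    linarith [pow_pos this 2]
  · refine ⟨∫ x, θ x / F x, tendsto_const_nhds.congr' ?_⟩
    filter_upwards [nhdsWithin_le_nhds (eventually_lt_nhds hc0)] with ε hε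
    congr 1
    ext x
    by_cases hx : θ x = 0
    · rw [pvInt_of_zero hx, hx, zero_div]
    · have := (h3 (subset_tsupport θ hx)).2
      simp only [Set.mem_preimage, Set.mem_Ioi] at this
      rw [pvInt, if_pos (hε.trans this)]

theorem upd_zero_of {j : Fin N} {a : CSpace N → ℂ} (h : a 0 = 0) : upd j a 0 = 0 := by
  ext i; by_cases hij : i = j
  · subst hij; simpa using h
  · simp [upd_of_ne hij]

theorem HolAt.exists_root {u : CSpace N → ℂ} {p} (hu : HolAt u p) (h0 : u p ≠ 0) {d : ℕ} (hd : d ≠ 0) :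
    ∃ v : CSpace N → ℂ, HolAt v p ∧ v p ≠ 0 ∧ ∀ x, v x ^ d = u x := by
  set c := u p ^ (1 / (d : ℂ)) with hc
  have hcd : ∀ z : ℂ, (z ^ (1 / (d : ℂ))) ^ d = z := fun z => by
    rw [one_div, Complex.cpow_nat_inv_pow _ hd]
  have hv : ∀ x, (c * (u x / u p) ^ (1 / (d : ℂ))) ^ d = u x := fun x => by
    rw [mul_pow, hcd, hcd, mul_div_cancel₀ _ h0]
  refine ⟨fun x => c * (u x / u p) ^ (1 / (d : ℂ)), ?_, fun h => ?_, hv⟩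
  · have hev : ∀ᶠ x in 𝓝 p, u x / u p ∈ Complex.slitPlane := by
      have : ContinuousAt (fun x => u x / u p) p := hu.continuousAt.div_const _
      refine this.eventually_mem (Complex.isOpen_slitPlane.mem_nhds ?_)
      simp [h0]
    filter_upwards [hu, hev] with x h1 h2
    have h3 : DifferentiableAt ℂ (fun x => u x / u p) x := by
      simpa only [div_eq_mul_inv] using h1.mul_const (u p)⁻¹
    exact (h3.cpow (differentiableAt_const (1 / (d : ℂ))) h2).const_mul c
  · have := hv p
    simp only at h
    rw [h, zero_pow hd] at this
    exact h0 this.symm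

theorem IsMono.goodAt {F : CSpace N → ℂ} (h : IsMono F) : GoodAt F 0 := by
  obtain ⟨α, u, hu, hu0, hF⟩ := h
  by_cases hα : ∀ j, α j = 0
  · refine (goodAt_of_ne_zero hu hu0).congr (hF.mono fun x hx => ?_)
    simp [hx, mono, hα]
  · push Not at hα
    obtain ⟨j, hj⟩ := hα
    obtain ⟨v, hv, hv0, hvu⟩ := hu.exists_root hu0 hj
    have ha : HolAt (fun x => x j * v x) 0 := (holAt_coord j 0).mul hv
    have hder : fderiv ℂ (fun x => x j * v x) 0 (Pi.single j 1) ≠ 0 := by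
      have h1 : HasFDerivAt (fun x : CSpace N => x j * v x) _ 0 :=
        ((ContinuousLinearMap.proj j : CSpace N →L[ℂ] ℂ).hasFDerivAt (x := 0)).mul
          hv.differentiableAt.hasFDerivAt
      rw [h1.fderiv]
      simpa using hv0
    obtain ⟨b, hb, hb0, hab, -, hbd⟩ := exists_upd_inverse ha (by simp) hder
    have key : GoodAt (fun x => F (upd j b x)) 0 := by
      have hm : GoodAt (mono α : CSpace N → ℂ) 0 :=
        ⟨Set.univ, isOpen_univ, trivial, (continuous_mono α).continuousOn, goodOn_mono α⟩
      refine hm.congr ?_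
      have hcont : Tendsto (upd j b) (𝓝 0) (𝓝 0) := by
        have := (hb.upd j).continuousAt.tendsto
        rwa [upd_zero_of hb0] at this
      filter_upwards [hab, hcont.eventually hF] with x h1 h2
      have h3 := congrFun h1 j
      rw [upd_self, upd_self] at h3
      rw [h2, ← hvu, mono, mono, ← Finset.mul_prod_erase _ _ (Finset.mem_univ j),
        ← Finset.mul_prod_erase _ (fun i => upd j b x i ^ α i) (Finset.mem_univ j), upd_self,
        Finset.prod_congr rfl (f := fun i => upd j b x i ^ α i) (g := fun i => x i ^ α i)
          fun l hl => by rw [upd_of_ne (Finset.ne_of_mem_erase hl)], ← h3, mul_pow]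
      ring
    have := key.of_upd hb hbd
    rwa [upd_zero_of hb0] at this

end IsMono

section Game

variable {N : ℕ}

/-- `f` depends only on the coordinates in `S`. -/
def DepOn {E : Type*} (S : Finset (Fin N)) (f : CSpace N → E) : Prop :=
  ∀ x y : CSpace N, (∀ i ∈ S, x i = y i) → f x = f y

/-- Germs of maps at the origin which only involve the coordinates in `S`. -/
structure SMap (S : Finset (Fin N)) (σ : CSpace N → CSpace N) : Prop where
  hol : HolAt σ 0
  map_zero : σ 0 = 0
  fix : ∀ i ∉ S, ∀ x, σ x i = x i
  dep : ∀ i ∈ S, DepOn S fun x => σ x i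

theorem SMap.id (S : Finset (Fin N)) : SMap S fun x : CSpace N => x :=
  ⟨holAt_id 0, rfl, fun _ _ _ => rfl, fun i hi _ _ h => h i hi⟩

theorem SMap.comp {S : Finset (Fin N)} {σ τ : CSpace N → CSpace N} (hσ : SMap S σ) (hτ : SMap S τ) :
    SMap S fun x => σ (τ x) := by
  refine ⟨?_, by rw [hτ.map_zero, hσ.map_zero], fun i hi x => by rw [hσ.fix i hi, hτ.fix i hi],
    fun i hi x y h => hσ.dep i hi _ _ fun l hl => hτ.dep l hl _ _ h⟩
  have : HolAt σ (τ 0) := by rw [hτ.map_zero]; exact hσ.hol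
  exact this.comp hτ.hol

theorem SMap.tendsto {S : Finset (Fin N)} {σ : CSpace N → CSpace N} (hσ : SMap S σ) :
    Tendsto σ (𝓝 0) (𝓝 0) := by
  have := hσ.hol.continuousAt.tendsto
  rwa [hσ.map_zero] at this

theorem SMap.upd {S : Finset (Fin N)} {j : Fin N} (hj : j ∈ S) {a : CSpace N → ℂ} (ha : HolAt a 0)
    (h0 : a 0 = 0) (hd : DepOn S a) : SMap S (upd j a) := by
  refine ⟨ha.upd j, upd_zero_of h0, fun i hi x => upd_of_ne (fun h => hi (by rw [h]; exact hj)) a x, fun i hi x y h => ?_⟩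
  by_cases hij : i = j
  · subst hij; simpa using hd x y h
  · simpa [upd_of_ne hij] using h i hi

theorem SMap.mono {S T : Finset (Fin N)} (hST : S ⊆ T) {σ : CSpace N → CSpace N} (hσ : SMap S σ) :
    SMap T σ := by
  refine ⟨hσ.hol, hσ.map_zero, fun i hi => hσ.fix i fun h => hi (hST h), fun i hi x y h => ?_⟩
  by_cases h' : i ∈ S
  · exact hσ.dep i h' x y fun l hl => h l (hST hl)
  · simpa [hσ.fix i h'] using h i hi

theorem HolAt.comp_smap {E : Type*} [NormedAddCommGroup E] [NormedSpace ℂ E] {S : Finset (Fin N)}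
    {f : CSpace N → E} {σ : CSpace N → CSpace N} (hf : HolAt f 0)
    (hσ : SMap S σ) : HolAt (fun x => f (σ x)) 0 := by
  have : HolAt f (σ 0) := by rw [hσ.map_zero]; exact hf
  exact this.comp hσ.hol

theorem DepOn.comp_smap {E : Type*} {S : Finset (Fin N)} {f : CSpace N → E} {σ : CSpace N → CSpace N}
    (hf : DepOn S f) (hσ : SMap S σ) : DepOn S fun x => f (σ x) :=
  fun _ _ h => hf _ _ fun i hi => hσ.dep i hi _ _ h

theorem DepOn.mono {E : Type*} {S T : Finset (Fin N)} (hST : S ⊆ T) {f : CSpace N → E}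
    (hf : DepOn S f) : DepOn T f :=
  fun x y h => hf x y fun i hi => h i (hST hi)

theorem DepOn.mul {S : Finset (Fin N)} {f g : CSpace N → ℂ} (hf : DepOn S f) (hg : DepOn S g) :
    DepOn S fun x => f x * g x := fun x y h => by simp only [hf x y h, hg x y h]

theorem DepOn.add {S : Finset (Fin N)} {f g : CSpace N → ℂ} (hf : DepOn S f) (hg : DepOn S g) :
    DepOn S fun x => f x + g x := fun x y h => by simp only [hf x y h, hg x y h]

theorem DepOn.sub {S : Finset (Fin N)} {f g : CSpace N → ℂ} (hf : DepOn S f) (hg : DepOn S g) :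
    DepOn S fun x => f x - g x := fun x y h => by simp only [hf x y h, hg x y h]

theorem DepOn.pow {S : Finset (Fin N)} {f : CSpace N → ℂ} (hf : DepOn S f) (n : ℕ) :
    DepOn S fun x => f x ^ n := fun x y h => by simp only [hf x y h]

theorem DepOn.sum {ι : Type*} {S : Finset (Fin N)} {s : Finset ι} {f : ι → CSpace N → ℂ}
    (hf : ∀ i ∈ s, DepOn S (f i)) : DepOn S fun x => ∑ i ∈ s, f i x :=
  fun x y h => Finset.sum_congr rfl fun i hi => hf i hi x y h

theorem DepOn.prod {ι : Type*} {S : Finset (Fin N)} {s : Finset ι} {f : ι → CSpace N → ℂ}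
    (hf : ∀ i ∈ s, DepOn S (f i)) : DepOn S fun x => ∏ i ∈ s, f i x :=
  fun x y h => Finset.prod_congr rfl fun i hi => hf i hi x y h

theorem depOn_const {E : Type*} (S : Finset (Fin N)) (c : E) : DepOn S fun _ : CSpace N => c :=
  fun _ _ _ => rfl

theorem depOn_coord {S : Finset (Fin N)} {i : Fin N} (hi : i ∈ S) : DepOn S fun x : CSpace N => x i :=
  fun _ _ h => h i hi

theorem depOn_univ {E : Type*} (f : CSpace N → E) : DepOn Finset.univ f :=
  fun x y h => by rw [show x = y from funext fun i => h i (Finset.mem_univ i)]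

theorem depOn_mono {S : Finset (Fin N)} {α : Fin N → ℕ} (h : ∀ i ∉ S, α i = 0) :
    DepOn S (mono α : CSpace N → ℂ) := fun x y hxy => Finset.prod_congr rfl fun i _ => by
  by_cases hi : i ∈ S
  · rw [hxy i hi]
  · rw [h i hi, pow_zero, pow_zero]

/-- The position `Q` can be won by finitely many coordinate changes, blow-ups and
power substitutions in the coordinates of `S`. -/
inductive Enf (S : Finset (Fin N)) : ((CSpace N → CSpace N) → Prop) → Prop
  | leaf {Q : (CSpace N → CSpace N) → Prop} (h : Q fun x => x) : Enf S Q
  | iso {Q : (CSpace N → CSpace N) → Prop} (j : Fin N) (a : CSpace N → ℂ) (hj : j ∈ S)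
      (ha : HolAt a 0) (h0 : a 0 = 0) (hd : DepOn S a) (hne : fderiv ℂ a 0 (Pi.single j 1) ≠ 0)
      (h : Enf S fun σ => Q fun x => upd j a (σ x)) : Enf S Q
  | blow {Q : (CSpace N → CSpace N) → Prop} (k j : Fin N) (hk : k ∈ S) (hj : j ∈ S) (hkj : k ≠ j)
      (h₁ : ∀ c, Enf S fun σ => Q fun x => blowMap k j c (σ x))
      (h₂ : Enf S fun σ => Q fun x => blowMap j k 0 (σ x)) : Enf S Q
  | pow {Q : (CSpace N → CSpace N) → Prop} (i : Fin N) (d : ℕ) (hi : i ∈ S) (hd : 0 < d)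
      (h : Enf S fun σ => Q fun x => powMap i d (σ x)) : Enf S Q

theorem smap_blow {S : Finset (Fin N)} {k j : Fin N} (hk : k ∈ S) (hj : j ∈ S) (c : ℂ) :
    SMap S (blowMap k j c) :=
  SMap.upd hj (holAt_blow k j c 0) (by simp)
    ((depOn_coord hk).mul ((depOn_coord hj).add (depOn_const S c)))

theorem smap_pow {S : Finset (Fin N)} {i : Fin N} (hi : i ∈ S) {d : ℕ} (hd : 0 < d) :
    SMap S (powMap i d) :=
  SMap.upd hi (holAt_coord_pow i d 0) (by simp [hd.ne']) ((depOn_coord hi).pow d)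

theorem Enf.bind {S T : Finset (Fin N)} (hST : S ⊆ T) {Q : (CSpace N → CSpace N) → Prop} (h : Enf S Q) :
    ∀ {Q' : (CSpace N → CSpace N) → Prop},
      (∀ σ, SMap S σ → Q σ → Enf T fun τ => Q' fun x => σ (τ x)) → Enf T Q' := by
  induction h with
  | leaf h => intro Q' hQ; exact hQ _ (SMap.id S) h
  | iso j a hj ha h0 hd hne _ ih =>
    intro Q' hQ
    exact .iso j a (hST hj) ha h0 (hd.mono hST) hne
      (ih fun σ hσ hq => hQ _ ((SMap.upd hj ha h0 hd).comp hσ) hq)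
  | blow k j hk hj hkj _ _ ih₁ ih₂ =>
    intro Q' hQ
    exact .blow k j (hST hk) (hST hj) hkj
      (fun c => ih₁ c fun σ hσ hq => hQ _ ((smap_blow hk hj c).comp hσ) hq)
      (ih₂ fun σ hσ hq => hQ _ ((smap_blow hj hk 0).comp hσ) hq)
  | pow i d hi hd _ ih =>
    intro Q' hQ
    exact .pow i d (hST hi) hd (ih fun σ hσ hq => hQ _ ((smap_pow hi hd).comp hσ) hq)

theorem Enf.imp {S : Finset (Fin N)} {Q Q' : (CSpace N → CSpace N) → Prop} (h : Enf S Q)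
    (hQ : ∀ σ, SMap S σ → Q σ → Q' σ) : Enf S Q' :=
  h.bind le_rfl fun σ hσ hq => .leaf (hQ σ hσ hq)

theorem Enf.goodAt {S : Finset (Fin N)} {Q : (CSpace N → CSpace N) → Prop} (h : Enf S Q) :
    ∀ {F : CSpace N → ℂ}, HolAt F 0 → (∀ σ, SMap S σ → Q σ → GoodAt (fun x => F (σ x)) 0) →
      GoodAt F 0 := by
  induction h with
  | leaf h => intro F _ hQ; exact hQ _ (SMap.id S) h
  | iso j a hj ha h0 hd hne _ ih =>
    intro F hF hQ
    have hs := SMap.upd hj ha h0 hd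
    have := GoodAt.of_upd ha hne (ih (hF.comp_smap hs) fun σ hσ hq => hQ _ (hs.comp hσ) hq)
    rwa [upd_zero_of h0] at this
  | blow k j hk hj hkj _ _ ih₁ ih₂ =>
    intro F hF hQ
    exact GoodAt.of_blow hkj hF
      (fun c => ih₁ c (hF.comp_smap (smap_blow hk hj c))
        fun σ hσ hq => hQ _ ((smap_blow hk hj c).comp hσ) hq)
      (ih₂ (hF.comp_smap (smap_blow hj hk 0)) fun σ hσ hq => hQ _ ((smap_blow hj hk 0).comp hσ) hq)
  | pow i d hi hd _ ih =>
    intro F hF hQ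
    exact GoodAt.of_pow hd hF (ih (hF.comp_smap (smap_pow hi hd))
      fun σ hσ hq => hQ _ ((smap_pow hi hd).comp hσ) hq)

/-- Setting the coordinates outside `S` to zero. -/
def proj (S : Finset (Fin N)) (x : CSpace N) : CSpace N := fun i => if i ∈ S then x i else 0

theorem DepOn.proj {E : Type*} {S : Finset (Fin N)} {f : CSpace N → E} (hf : DepOn S f) (x) :
    f (proj S x) = f x := hf _ _ fun i hi => by simp [_root_.proj, hi]

theorem depOn_proj {E : Type*} (S : Finset (Fin N)) (f : CSpace N → E) : DepOn S fun x => f (proj S x) := by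
  intro x y h
  have : proj S x = proj S y := by
    ext i
    by_cases hi : i ∈ S
    · simp [proj, hi, h i hi]
    · simp [proj, hi]
  simp only [this]

@[simp] theorem proj_zero (S : Finset (Fin N)) : proj S (0 : CSpace N) = 0 := by ext i; simp [proj]

theorem continuous_proj (S : Finset (Fin N)) : Continuous (proj S : CSpace N → CSpace N) := by
  refine continuous_pi fun i => ?_
  by_cases hi : i ∈ S
  · simpa [proj, hi] using continuous_apply i
  · simpa [proj, hi] using continuous_const

theorem holAt_proj (S : Finset (Fin N)) (p : CSpace N) : HolAt (proj S) p := by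
  refine HolAt.pi fun i => ?_
  by_cases hi : i ∈ S
  · simpa [proj, hi] using holAt_coord i p
  · simpa [proj, hi] using holAt_const (0 : ℂ) p

theorem tendsto_proj (S : Finset (Fin N)) : Tendsto (proj S : CSpace N → CSpace N) (𝓝 0) (𝓝 0) := by
  have := (continuous_proj S).tendsto (0 : CSpace N)
  rwa [proj_zero] at this

theorem HolAt.comp_proj {E : Type*} [NormedAddCommGroup E] [NormedSpace ℂ E] {f : CSpace N → E}
    (hf : HolAt f 0) (S : Finset (Fin N)) : HolAt (fun x => f (proj S x)) 0 := by
  have : HolAt f (proj S 0) := by rw [proj_zero]; exact hf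
  exact this.comp (holAt_proj S 0)

end Game

section Germs

variable {N : ℕ}

/-- The point with coordinates `0` in `Z` and `s` elsewhere. -/
def testPt (Z : Finset (Fin N)) (s : ℂ) : CSpace N := fun i => if i ∈ Z then 0 else s

theorem tendsto_testPt (Z : Finset (Fin N)) : Tendsto (testPt Z) (𝓝[≠] 0) (𝓝 (0 : CSpace N)) := by
  have h : Continuous (testPt Z : ℂ → CSpace N) := by
    refine continuous_pi fun i => ?_
    by_cases hi : i ∈ Z
    · simpa [testPt, hi] using continuous_const
    · simpa [testPt, hi] using continuous_id'
  have h0 : testPt Z 0 = (0 : CSpace N) := by ext i; simp [testPt]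
  have := h.tendsto 0
  rw [h0] at this
  exact this.mono_left nhdsWithin_le_nhds

theorem mono_testPt_eq_zero {Z : Finset (Fin N)} {α : Fin N → ℕ} {i : Fin N} (hi : i ∈ Z)
    (h : α i ≠ 0) (s : ℂ) : mono α (testPt Z s) = 0 :=
  Finset.prod_eq_zero (Finset.mem_univ i) (by simp [testPt, hi, h])

theorem mono_testPt_ne_zero {Z : Finset (Fin N)} {α : Fin N → ℕ} (h : ∀ i ∈ Z, α i = 0) {s : ℂ}
    (hs : s ≠ 0) : mono α (testPt Z s) ≠ 0 :=
  Finset.prod_ne_zero_iff.2 fun i _ => by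
    by_cases hi : i ∈ Z
    · simp [h i hi]
    · simp [testPt, hi, hs]

theorem HolAt.eventually_ne {u : CSpace N → ℂ} (hu : HolAt u 0) (h : u 0 ≠ 0) : ∀ᶠ x in 𝓝 0, u x ≠ 0 :=
  hu.continuousAt.eventually_ne h

theorem exists_testPt {P : CSpace N → Prop} (h : ∀ᶠ x in 𝓝 0, P x) (Z : Finset (Fin N)) :
    ∃ s : ℂ, s ≠ 0 ∧ P (testPt Z s) :=
  (((tendsto_testPt Z).eventually h).and self_mem_nhdsWithin).exists.imp fun _ hs => ⟨hs.2, hs.1⟩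

theorem not_eventually_mono_zero (α : Fin N → ℕ) : ¬ ∀ᶠ x : CSpace N in 𝓝 0, mono α x = 0 := fun h => by
  obtain ⟨s, hs, h⟩ := exists_testPt h ∅
  exact mono_testPt_ne_zero (by simp) hs h

theorem not_eventually_coord_zero (i : Fin N) : ¬ ∀ᶠ x : CSpace N in 𝓝 0, x i = 0 := fun h => by
  obtain ⟨s, hs, h⟩ := exists_testPt h ∅
  exact hs (by simpa [testPt] using h)

theorem HolAt.cancel {m f g : CSpace N → ℂ} (hm : HolAt m 0) (hf : HolAt f 0) (hg : HolAt g 0)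
    (h0 : ¬ ∀ᶠ x in 𝓝 0, m x = 0) (h : ∀ᶠ x in 𝓝 0, m x * f x = m x * g x) : f =ᶠ[𝓝 0] g := by
  rcases hm.mul_eq_zero (hf.sub hg) (h.mono fun x hx => by rw [mul_sub, hx, sub_self]) with h1 | h1
  · exact absurd h1 h0
  · exact h1.mono fun x hx => sub_eq_zero.1 hx

theorem IsMono.holAt {F : CSpace N → ℂ} (h : IsMono F) : HolAt F 0 := by
  obtain ⟨α, u, hu, -, hF⟩ := h
  exact ((holAt_mono α 0).mul hu).congr hF.symm

theorem IsMono.not_zero {F : CSpace N → ℂ} (h : IsMono F) : ¬ ∀ᶠ x in 𝓝 0, F x = 0 := by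
  obtain ⟨α, u, hu, hu0, hF⟩ := h
  intro h0
  refine not_eventually_mono_zero α ?_
  filter_upwards [h0, hF, hu.eventually_ne hu0] with x h1 h2 h3
  rw [h1] at h2
  exact (mul_eq_zero.1 h2.symm).resolve_right h3

theorem IsMono.congr {F G : CSpace N → ℂ} (h : IsMono F) (hFG : F =ᶠ[𝓝 0] G) : IsMono G := by
  obtain ⟨α, u, hu, hu0, hF⟩ := h
  exact ⟨α, u, hu, hu0, hFG.symm.trans hF⟩

theorem isMono_of_ne_zero {F : CSpace N → ℂ} (h : HolAt F 0) (h0 : F 0 ≠ 0) : IsMono F :=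
  ⟨0, F, h, h0, Eventually.of_forall fun x => by simp [mono]⟩

theorem mono_add (α β : Fin N → ℕ) (x : CSpace N) : mono (α + β) x = mono α x * mono β x := by
  simp [mono, pow_add, Finset.prod_mul_distrib]

theorem mono_mul_right (α : Fin N → ℕ) (n : ℕ) (x : CSpace N) : mono (fun i => α i * n) x = mono α x ^ n := by
  simp [mono, pow_mul, Finset.prod_pow]

theorem mono_single (i : Fin N) (x : CSpace N) : mono (Pi.single i 1) x = x i := by
  rw [mono, Finset.prod_eq_single i] <;> simp +contextual

theorem IsMono.mul {F G : CSpace N → ℂ} (hF : IsMono F) (hG : IsMono G) : IsMono fun x => F x * G x := by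
  obtain ⟨α, u, hu, hu0, hF⟩ := hF
  obtain ⟨β, v, hv, hv0, hG⟩ := hG
  refine ⟨α + β, fun x => u x * v x, hu.mul hv, mul_ne_zero hu0 hv0, ?_⟩
  filter_upwards [hF, hG] with x h1 h2
  rw [h1, h2, mono_add]
  ring

theorem isMono_mono (α : Fin N → ℕ) : IsMono (mono α : CSpace N → ℂ) :=
  ⟨α, fun _ => 1, holAt_const _ _, one_ne_zero, Eventually.of_forall fun x => by simp⟩

theorem isMono_coord (i : Fin N) : IsMono fun x : CSpace N => x i :=
  (isMono_mono (Pi.single i 1)).congr (Eventually.of_forall fun x => mono_single i x)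

theorem IsMono.pow {F : CSpace N → ℂ} (hF : IsMono F) (n : ℕ) : IsMono fun x => F x ^ n := by
  induction n with
  | zero => simpa using isMono_of_ne_zero (holAt_const (1 : ℂ) 0) one_ne_zero
  | succ n ih => simpa only [pow_succ] using ih.mul hF

theorem mono_update_zero {α : Fin N → ℕ} {i : Fin N} (h : α i ≠ 0) (x : CSpace N) :
    mono α (Function.update x i 0) = 0 :=
  Finset.prod_eq_zero (Finset.mem_univ i) (by simp [h])

theorem mono_eq_coord_mul {α : Fin N → ℕ} {i : Fin N} (h : α i ≠ 0) (x : CSpace N) :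
    mono α x = x i * mono (Function.update α i (α i - 1)) x := by
  rw [mono, mono, ← Finset.mul_prod_erase _ _ (Finset.mem_univ i),
    ← Finset.mul_prod_erase _ (fun l => x l ^ Function.update α i (α i - 1) l) (Finset.mem_univ i),
    Finset.prod_congr rfl (f := fun l => x l ^ Function.update α i (α i - 1) l) (g := fun l => x l ^ α l)
      fun l hl => by rw [Function.update_of_ne (Finset.ne_of_mem_erase hl)], Function.update_self,
    ← mul_assoc, ← pow_succ', Nat.sub_add_cancel (Nat.one_le_iff_ne_zero.2 h)]

theorem tendsto_update_zero (i : Fin N) :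
    Tendsto (fun x : CSpace N => Function.update x i 0) (𝓝 0) (𝓝 0) := by
  have h : Continuous fun x : CSpace N => Function.update x i (0 : ℂ) := by fun_prop
  have h0 : Function.update (0 : CSpace N) i 0 = 0 := by simp
  have := h.tendsto (0 : CSpace N)
  rwa [h0] at this

theorem holAt_update_zero {F : CSpace N → ℂ} (hF : HolAt F 0) (i : Fin N) :
    HolAt (fun x => F (Function.update x i 0)) 0 := by
  have h0 : Function.update (0 : CSpace N) i 0 = 0 := by simp
  have : HolAt F ((fun x : CSpace N => Function.update x i (0 : ℂ)) 0) := by simpa only [h0] using hF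
  exact this.comp ((holAt_id 0).update (holAt_const 0 0) i)

/-- A divisor of a monomial is a monomial, up to units. -/
theorem isMono_of_mul : ∀ (m : ℕ) {F G u : CSpace N → ℂ} {α : Fin N → ℕ}, ∑ i, α i = m → HolAt F 0 →
    HolAt G 0 → HolAt u 0 → u 0 ≠ 0 → (∀ᶠ x in 𝓝 0, F x * G x = mono α x * u x) → IsMono F := by
  intro m
  induction m with
  | zero =>
    intro F G u α hα hF hG hu hu0 h
    refine isMono_of_ne_zero hF fun hF0 => hu0 ?_
    have := h.self_of_nhds
    have h1 : mono α (0 : CSpace N) = 1 := Finset.prod_eq_one fun i hi => by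
      rw [(Finset.sum_eq_zero_iff.1 hα) i hi, pow_zero]
    rw [h1, hF0] at this
    simpa using this.symm
  | succ m ih =>
    intro F G u α hα hF hG hu hu0 h
    obtain ⟨i, -, hi⟩ : ∃ i ∈ Finset.univ, α i ≠ 0 := by
      by_contra! h0
      rw [Finset.sum_eq_zero h0] at hα
      omega
    have hα' : ∑ l, Function.update α i (α i - 1) l = m := by
      rw [← Finset.add_sum_erase _ _ (Finset.mem_univ i)] at hα
      rw [← Finset.add_sum_erase _ _ (Finset.mem_univ i), Function.update_self,
        Finset.sum_congr rfl (g := fun l => α l)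
        fun l hl => by rw [Function.update_of_ne (Finset.ne_of_mem_erase hl)]]
      omega
    have key : ∀ {h k : CSpace N → ℂ}, HolAt h 0 → HolAt k 0 →
        (∀ᶠ x in 𝓝 0, x i * (h x * k x) = mono α x * u x) →
        ∀ᶠ x in 𝓝 0, h x * k x = mono (Function.update α i (α i - 1)) x * u x := by
      intro h' k hh hk he
      refine HolAt.cancel (holAt_coord i 0) (hh.mul hk) ((holAt_mono _ 0).mul hu)
        (not_eventually_coord_zero i) ?_
      filter_upwards [he] with x hx
      rw [hx, mono_eq_coord_mul hi]
      ring
    have hz : ∀ᶠ x in 𝓝 0, F (Function.update x i 0) * G (Function.update x i 0) = 0 := by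
      filter_upwards [(tendsto_update_zero i).eventually h] with x hx
      rw [hx, mono_update_zero hi, zero_mul]
    rcases (holAt_update_zero hF i).mul_eq_zero (holAt_update_zero hG i) hz with h0 | h0
    · obtain ⟨f', hf', he⟩ := hF.exists_eq_coord_mul i h0
      have := ih hα' hf' hG hu hu0 (key hf' hG (by
        filter_upwards [h, he] with x h1 h2
        rw [← h1, h2]; ring))
      exact ((isMono_coord i).mul this).congr (he.mono fun x hx => hx.symm)
    · obtain ⟨g', hg', he⟩ := hG.exists_eq_coord_mul i h0
      exact ih hα' hF hg' hu hu0 (key hF hg' (by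
        filter_upwards [h, he] with x h1 h2
        rw [← h1, h2]; ring))

theorem IsMono.left {F G : CSpace N → ℂ} (h : IsMono fun x => F x * G x) (hF : HolAt F 0)
    (hG : HolAt G 0) : IsMono F := by
  obtain ⟨α, u, hu, hu0, he⟩ := h
  exact isMono_of_mul _ rfl hF hG hu hu0 he

theorem IsMono.right {F G : CSpace N → ℂ} (h : IsMono fun x => F x * G x) (hF : HolAt F 0)
    (hG : HolAt G 0) : IsMono G := by
  simp only [mul_comm (F _)] at h
  exact h.left hG hF

theorem IsMono.of_prod {ι : Type*} {s : Finset ι} {f : ι → CSpace N → ℂ}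
    (h : IsMono fun x => ∏ i ∈ s, f i x) (hf : ∀ i ∈ s, HolAt (f i) 0) {i} (hi : i ∈ s) : IsMono (f i) := by
  classical
  simp only [← Finset.mul_prod_erase s _ hi] at h
  exact h.left (hf i hi) (HolAt.prod fun l hl => hf l (Finset.mem_of_mem_erase hl))

/-- If the difference of two monomials with unit coefficients is monomial or zero, then
the exponents are comparable. -/
theorem exponents_comparable {α β : Fin N → ℕ} {a b f : CSpace N → ℂ} (ha : HolAt a 0) (hb : HolAt b 0)
    (ha0 : a 0 ≠ 0) (hb0 : b 0 ≠ 0) (hf : f =ᶠ[𝓝 0] fun x => mono α x * a x - mono β x * b x)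
    (h : IsMono f ∨ ∀ᶠ x in 𝓝 0, f x = 0) : α ≤ β ∨ β ≤ α := by
  by_contra! hcon
  obtain ⟨h1, h2⟩ := hcon
  obtain ⟨k, hk⟩ := not_forall.1 h1
  obtain ⟨l, hl⟩ := not_forall.1 h2
  rw [not_le] at hk hl
  set m : Fin N → ℕ := fun i => min (α i) (β i) with hm
  set α' : Fin N → ℕ := fun i => α i - m i with hα'
  set β' : Fin N → ℕ := fun i => β i - m i with hβ'
  have eα : α = m + α' := by ext i; simp [hm, hα']
  have eβ : β = m + β' := by ext i; simp [hm, hβ']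
  set f' : CSpace N → ℂ := fun x => mono α' x * a x - mono β' x * b x with hf'
  have hf'h : HolAt f' 0 := ((holAt_mono α' 0).mul ha).sub ((holAt_mono β' 0).mul hb)
  have hff' : f =ᶠ[𝓝 0] fun x => mono m x * f' x := hf.mono fun x hx => by
    simp only [hx, hf']
    rw [eα, eβ, mono_add, mono_add]; ring
  have hαk : α' k ≠ 0 := by
    change α k - min (α k) (β k) ≠ 0
    rw [min_eq_right hk.le]; exact (Nat.sub_pos_of_lt hk).ne'
  have hβk : β' k = 0 := by
    change β k - min (α k) (β k) = 0
    rw [min_eq_right hk.le, Nat.sub_self]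
  have hβl : β' l ≠ 0 := by
    change β l - min (α l) (β l) ≠ 0
    rw [min_eq_left hl.le]; exact (Nat.sub_pos_of_lt hl).ne'
  have hαl : α' l = 0 := by
    change α l - min (α l) (β l) = 0
    rw [min_eq_left hl.le, Nat.sub_self]
  have hne : ∀ᶠ x in 𝓝 0, a x ≠ 0 ∧ b x ≠ 0 := (ha.eventually_ne ha0).and (hb.eventually_ne hb0)
  rcases h with h | h
  · obtain ⟨δ, v, hv, hv0, he⟩ := (h.congr hff').right (holAt_mono m 0) hf'h
    have h0 : f' 0 = 0 := by
      have z1 : mono α' (0 : CSpace N) = 0 := Finset.prod_eq_zero (Finset.mem_univ k) (by simp [hαk])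
      have z2 : mono β' (0 : CSpace N) = 0 := Finset.prod_eq_zero (Finset.mem_univ l) (by simp [hβl])
      simp [hf', z1, z2]
    have hδ : ∃ p, δ p ≠ 0 := by
      by_contra! hδ
      have := he.self_of_nhds
      rw [h0] at this
      simp [mono, hδ] at this
      exact hv0 this.symm
    obtain ⟨p, hp⟩ := hδ
    by_cases hβp : β' p = 0
    · obtain ⟨s, hs, ⟨e1, e2, e3⟩⟩ := exists_testPt (he.and hne) {p, k}
      simp only [hf', mono_testPt_eq_zero (Z := {p, k}) (i := p) (by simp) hp] at e1
      rw [mono_testPt_eq_zero (i := k) (by simp) hαk, zero_mul, zero_mul, zero_sub, neg_eq_zero,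
        mul_eq_zero] at e1
      exact e1.elim (mono_testPt_ne_zero (by simp [hβp, hβk]) hs) e3
    · have hαp : α' p = 0 := by simp only [hβ', hα', hm] at hβp ⊢; omega
      obtain ⟨s, hs, ⟨e1, e2, e3⟩⟩ := exists_testPt (he.and hne) {p, l}
      simp only [hf', mono_testPt_eq_zero (Z := {p, l}) (i := p) (by simp) hp] at e1
      rw [mono_testPt_eq_zero (i := l) (by simp) hβl, zero_mul, zero_mul, sub_zero,
        mul_eq_zero] at e1
      exact e1.elim (mono_testPt_ne_zero (by simp [hαp, hαl]) hs) e2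
  · have he : ∀ᶠ x in 𝓝 0, f' x = 0 := by
      refine ((holAt_mono m 0).mul_eq_zero hf'h ?_).resolve_left (not_eventually_mono_zero m)
      filter_upwards [h, hff'] with x h1 h2
      rw [← h2, h1]
    obtain ⟨s, hs, ⟨e1, e2, e3⟩⟩ := exists_testPt (he.and hne) {k}
    simp only [hf'] at e1
    rw [mono_testPt_eq_zero (i := k) (by simp) hαk, zero_mul, zero_sub, neg_eq_zero, mul_eq_zero] at e1
    exact e1.elim (mono_testPt_ne_zero (by simp [hβk]) hs) e3

theorem IsMono.strong {S : Finset (Fin N)} {f : CSpace N → ℂ} (h : IsMono f) (hd : DepOn S f) :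
    ∃ (α : Fin N → ℕ) (u : CSpace N → ℂ), (∀ i ∉ S, α i = 0) ∧ HolAt u 0 ∧ u 0 ≠ 0 ∧ DepOn S u ∧
      f =ᶠ[𝓝 0] fun x => mono α x * u x := by
  have hnz := h.not_zero
  obtain ⟨α, u, hu, hu0, he⟩ := h
  have hα : ∀ i ∉ S, α i = 0 := by
    intro i hi
    by_contra h0
    refine hnz ?_
    filter_upwards [(tendsto_update_zero i).eventually he] with x hx
    rw [mono_update_zero h0, zero_mul] at hx
    rw [← hx]
    exact hd _ _ fun l hl => by rw [Function.update_of_ne]; rintro rfl; exact hi hl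
  refine ⟨α, fun x => u (proj S x), hα, hu.comp_proj S, by simpa using hu0, depOn_proj S u, ?_⟩
  filter_upwards [(tendsto_proj S).eventually he] with x hx
  rw [hd.proj, (depOn_mono hα).proj] at hx
  exact hx

end Germs

section Taylor

variable {N : ℕ}

/-- The partial derivative with respect to the `j`-th coordinate. -/
noncomputable def partialD (j : Fin N) (g : CSpace N → ℂ) : CSpace N → ℂ :=
  fun x => lineDeriv ℂ g x (Pi.single j 1)

theorem partialD_eq_fderiv (j : Fin N) {g : CSpace N → ℂ} {x : CSpace N} (hg : DifferentiableAt ℂ g x) :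
    partialD j g x = fderiv ℂ g x (Pi.single j 1) := hg.lineDeriv_eq_fderiv

theorem HolAt.partialD {g : CSpace N → ℂ} {p : CSpace N} (hg : HolAt g p) (j : Fin N) :
    HolAt (partialD j g) p :=
  (hg.fderiv_apply (Pi.single j 1)).congr (hg.mono fun _ hx => (partialD_eq_fderiv j hx).symm)

theorem HolAt.partialD_iter {g : CSpace N → ℂ} {p : CSpace N} (hg : HolAt g p) (j : Fin N) (i : ℕ) :
    HolAt ((_root_.partialD j)^[i] g) p := by
  induction i with
  | zero => exact hg
  | succ i ih => rw [Function.iterate_succ_apply']; exact ih.partialD j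

theorem partialD_congr (j : Fin N) {f g : CSpace N → ℂ} {p : CSpace N} (h : f =ᶠ[𝓝 p] g) :
    partialD j f =ᶠ[𝓝 p] partialD j g := by
  filter_upwards [eventually_eventually_nhds.2 h] with x hx
  exact Filter.EventuallyEq.lineDeriv_eq hx

theorem partialD_iter_congr (j : Fin N) {f g : CSpace N → ℂ} {p : CSpace N} (h : f =ᶠ[𝓝 p] g) (i : ℕ) :
    (partialD j)^[i] f =ᶠ[𝓝 p] (partialD j)^[i] g := by
  induction i with
  | zero => exact h
  | succ i ih =>
    rw [Function.iterate_succ_apply', Function.iterate_succ_apply']; exact partialD_congr j ih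

theorem DepOn.partialD {S : Finset (Fin N)} {g : CSpace N → ℂ} (hg : DepOn S g) (j : Fin N) :
    DepOn S (partialD j g) := fun x y h => by
  simp only [_root_.partialD, lineDeriv]
  congr 1
  funext t
  exact hg _ _ fun i hi => by simp [h i hi]

theorem DepOn.partialD_iter {S : Finset (Fin N)} {g : CSpace N → ℂ} (hg : DepOn S g) (j : Fin N) (i : ℕ) :
    DepOn S ((_root_.partialD j)^[i] g) := by
  induction i with
  | zero => exact hg
  | succ i ih => rw [Function.iterate_succ_apply']; exact ih.partialD j

theorem partialD_of_depOn {S : Finset (Fin N)} {j : Fin N} (hj : j ∉ S) {g : CSpace N → ℂ}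
    (hg : DepOn S g) (x : CSpace N) : partialD j g x = 0 := by
  have : (fun t : ℂ => g (x + t • Pi.single j 1)) = fun _ => g x := by
    funext t
    refine hg _ _ fun i hi => ?_
    have : i ≠ j := by rintro rfl; exact hj hi
    simp [this]
  simp [partialD, lineDeriv, this]

theorem partialD_zero (j : Fin N) : partialD j (fun _ => 0) = fun _ => 0 := by
  funext x; simp [partialD, lineDeriv]

theorem partialD_iter_zero (j : Fin N) (i : ℕ) : (partialD j)^[i] (fun _ => 0) = fun _ => 0 := by
  induction i with
  | zero => rfl
  | succ i ih => rw [Function.iterate_succ_apply, partialD_zero, ih]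

theorem partialD_comp_shift (j : Fin N) {τ : CSpace N → CSpace N}
    (hτ : ∀ (x : CSpace N) (t : ℂ), τ (x + t • Pi.single j 1) = τ x + t • Pi.single j 1)
    (g : CSpace N → ℂ) (i : ℕ) :
    (partialD j)^[i] (fun x => g (τ x)) = fun x => (partialD j)^[i] g (τ x) := by
  induction i with
  | zero => rfl
  | succ i ih =>
    rw [Function.iterate_succ_apply', Function.iterate_succ_apply', ih]
    funext x
    simp only [partialD, lineDeriv, hτ]

theorem partialD_add (j : Fin N) {f g : CSpace N → ℂ} {p : CSpace N} (hf : HolAt f p) (hg : HolAt g p) :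
    partialD j (fun x => f x + g x) =ᶠ[𝓝 p] fun x => partialD j f x + partialD j g x := by
  filter_upwards [hf, hg] with x h1 h2
  rw [partialD_eq_fderiv j h1, partialD_eq_fderiv j h2, partialD_eq_fderiv j (h1.fun_add h2), fderiv_fun_add h1 h2]
  rfl

theorem partialD_iter_add (j : Fin N) {f g : CSpace N → ℂ} {p : CSpace N} (hf : HolAt f p)
    (hg : HolAt g p) (i : ℕ) : (partialD j)^[i] (fun x => f x + g x) =ᶠ[𝓝 p]
      fun x => (partialD j)^[i] f x + (partialD j)^[i] g x := by
  induction i generalizing f g with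
  | zero => exact EventuallyEq.rfl
  | succ i ih =>
    simp only [Function.iterate_succ_apply]
    exact (partialD_iter_congr j (partialD_add j hf hg) i).trans (ih (hf.partialD j) (hg.partialD j))

theorem partialD_iter_sum (j : Fin N) {ι : Type*} (s : Finset ι) {f : ι → CSpace N → ℂ} {p : CSpace N}
    (hf : ∀ l ∈ s, HolAt (f l) p) (i : ℕ) : (partialD j)^[i] (fun x => ∑ l ∈ s, f l x) =ᶠ[𝓝 p]
      fun x => ∑ l ∈ s, (partialD j)^[i] (f l) x := by
  classical
  induction s using Finset.induction_on with
  | empty => simp only [Finset.sum_empty, partialD_iter_zero]; exact EventuallyEq.rfl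
  | insert a s ha ih =>
    simp only [Finset.sum_insert ha]
    have hs : ∀ l ∈ s, HolAt (f l) p := fun l hl => hf l (Finset.mem_insert_of_mem hl)
    filter_upwards [ih hs, partialD_iter_add j (hf a (Finset.mem_insert_self a s)) (HolAt.sum hs) i]
      with x h1 h2
    rw [h2, h1]

theorem partialD_coord_pow_mul (j : Fin N) {u : CSpace N → ℂ} {p : CSpace N} (hu : HolAt u p) (m : ℕ) :
    partialD j (fun x => x j ^ (m + 1) * u x) =ᶠ[𝓝 p]
      fun x => x j ^ m * ((m + 1) * u x + x j * partialD j u x) := by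
  filter_upwards [hu] with x h
  have h1 : HasLineDerivAt ℂ u (partialD j u x) x (Pi.single j 1) := h.lineDifferentiableAt.hasLineDerivAt
  have h2 : HasDerivAt (fun t : ℂ => (x + t • (Pi.single j (1 : ℂ) : CSpace N)) j ^ (m + 1)) (((m + 1 : ℕ) : ℂ) * x j ^ m) 0 := by
    have := ((hasDerivAt_id' (0 : ℂ)).const_add (x j)).fun_pow (m + 1)
    simpa using this
  have h3 := h2.mul h1
  have : partialD j (fun x => x j ^ (m + 1) * u x) x = _ := h3.deriv
  rw [this]
  simp
  ring

theorem partialD_iter_coord_pow_mul (j : Fin N) (i : ℕ) : ∀ (m : ℕ) {u : CSpace N → ℂ}, i ≤ m →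
    HolAt u 0 → ∀ᶠ x : CSpace N in 𝓝 0, x j = 0 → (partialD j)^[i] (fun x => x j ^ m * u x) x =
      if i = m then (m.factorial : ℂ) * u x else 0 := by
  induction i with
  | zero =>
    intro m u hm hu
    refine Eventually.of_forall fun x hx => ?_
    rcases m with _ | m <;> simp [hx]
  | succ i ih =>
    intro m u hm hu
    obtain ⟨m, rfl⟩ : ∃ l, m = l + 1 := ⟨m - 1, by omega⟩
    have hu' : HolAt (fun x => ((m : ℂ) + 1) * u x + x j * partialD j u x) 0 :=
      ((holAt_const _ 0).mul hu).add ((holAt_coord j 0).mul (hu.partialD j))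
    simp only [Function.iterate_succ_apply]
    filter_upwards [ih m (by omega) hu', partialD_iter_congr j (partialD_coord_pow_mul j hu m) i] with x h1 h2 hx
    rw [h2, h1 hx]
    simp only [Nat.add_right_cancel_iff, hx, zero_mul, add_zero, Nat.factorial_succ]
    split_ifs <;> push_cast <;> ring

theorem partialD_iter_coord_pow_mul_of_depOn (j : Fin N) {S : Finset (Fin N)} (hj : j ∉ S) (i : ℕ) :
    ∀ (m : ℕ) {c : CSpace N → ℂ}, HolAt c 0 → DepOn S c →
    ∀ᶠ x : CSpace N in 𝓝 0, x j = 0 → (partialD j)^[i] (fun x => x j ^ m * c x) x =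
      if i = m then (m.factorial : ℂ) * c x else 0 := by
  induction i with
  | zero => intro m c hc _; exact partialD_iter_coord_pow_mul j 0 m (Nat.zero_le m) hc
  | succ i ih =>
    intro m c hc hd
    rcases m with _ | m
    · have : partialD j c = fun _ => 0 := funext (partialD_of_depOn hj hd)
      simp only [pow_zero, one_mul, Function.iterate_succ_apply, this, partialD_iter_zero]
      exact Eventually.of_forall fun x _ => by simp
    · have hu' : HolAt (fun x => ((m : ℂ) + 1) * c x) 0 := (holAt_const _ 0).mul hc
      simp only [Function.iterate_succ_apply]
      filter_upwards [ih m hu' ((depOn_const S _).mul hd),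
        partialD_iter_congr j (partialD_coord_pow_mul j hc m) i] with x h1 h2 hx
      simp only [partialD_of_depOn hj hd, mul_zero, add_zero] at h2
      rw [h2, h1 hx]
      simp only [Nat.add_right_cancel_iff, Nat.factorial_succ]
      split_ifs <;> push_cast <;> ring

/-- Taylor expansion in the `j`-th coordinate. -/
theorem exists_taylor {S : Finset (Fin N)} (j : Fin N) {g : CSpace N → ℂ}
    (hg : HolAt g 0) (hd : DepOn S g) (d : ℕ) :
    ∃ (c : ℕ → CSpace N → ℂ) (u : CSpace N → ℂ), (∀ i, HolAt (c i) 0) ∧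
      (∀ i, DepOn (S.erase j) (c i)) ∧ HolAt u 0 ∧ DepOn S u ∧
      g =ᶠ[𝓝 0] fun x => ∑ i ∈ Finset.range d, x j ^ i * c i x + x j ^ d * u x := by
  induction d with
  | zero =>
    exact ⟨fun _ _ => 0, g, fun _ => holAt_const 0 0, fun _ => depOn_const _ 0, hg, hd,
      Eventually.of_forall fun x => by simp⟩
  | succ d ih =>
    obtain ⟨c, u, hc, hcd, hu, hud, he⟩ := ih
    set e : CSpace N → ℂ := fun x => u (proj (S.erase j) x) with he'
    have heh : HolAt e 0 := hu.comp_proj _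
    obtain ⟨h, hh, hhe⟩ := (hu.sub heh).exists_eq_coord_mul j (Eventually.of_forall fun x => by
      rw [sub_eq_zero]
      refine hud _ _ fun i hi => ?_
      by_cases hij : i = j
      · subst hij; simp [proj]
      · simp [proj, hij, hi])
    have hsum : ∀ (v : CSpace N → ℂ) (x : CSpace N), ∑ i ∈ Finset.range d,
        x j ^ i * Function.update c d v i x = ∑ i ∈ Finset.range d, x j ^ i * c i x := fun v x =>
      Finset.sum_congr rfl fun i hi => by rw [Function.update_of_ne (Finset.mem_range.1 hi).ne]
    by_cases hjS : j ∈ S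
    · refine ⟨Function.update c d e, fun x => h (proj S x), fun i => ?_, fun i => ?_, hh.comp_proj S,
        depOn_proj S h, ?_⟩
      · by_cases hi : i = d
        · subst hi; simpa using heh
        · simpa [hi] using hc i
      · by_cases hi : i = d
        · subst hi; simpa using depOn_proj _ u
        · simpa [hi] using hcd i
      · filter_upwards [he, (tendsto_proj S).eventually hhe] with x h1 h2
        have h3 : u (proj S x) = u x := hud.proj x
        have h4 : e (proj S x) = e x := ((depOn_proj (S.erase j) u).mono (S.erase_subset j)).proj x
        have h5 : proj S x j = x j := by simp [proj, hjS]
        rw [h3, h4, h5] at h2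
        rw [h1, Finset.sum_range_succ, Function.update_self, hsum]
        linear_combination x j ^ d * h2
    · refine ⟨Function.update c d u, fun _ => 0, fun i => ?_, fun i => ?_, holAt_const 0 0,
        depOn_const _ 0, ?_⟩
      · by_cases hi : i = d
        · subst hi; simpa using hu
        · simpa [hi] using hc i
      · by_cases hi : i = d
        · subst hi; simpa [Finset.erase_eq_of_notMem hjS] using hud
        · simpa [hi] using hcd i
      · filter_upwards [he] with x h1
        rw [h1, Finset.sum_range_succ, Function.update_self, hsum]
        ring

theorem partialD_iter_taylor {S : Finset (Fin N)} (j : Fin N) {g : CSpace N → ℂ} {d : ℕ}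
    {c : ℕ → CSpace N → ℂ} {u : CSpace N → ℂ} (hc : ∀ i, HolAt (c i) 0)
    (hcd : ∀ i, DepOn (S.erase j) (c i)) (hu : HolAt u 0)
    (he : g =ᶠ[𝓝 0] fun x => ∑ i ∈ Finset.range d, x j ^ i * c i x + x j ^ d * u x) {i : ℕ} (hi : i ≤ d) :
    ∀ᶠ x : CSpace N in 𝓝 0, x j = 0 → (partialD j)^[i] g x = i.factorial * if i = d then u x else c i x := by
  have h1 : ∀ l ∈ Finset.range d, HolAt (fun x : CSpace N => x j ^ l * c l x) 0 :=
    fun l _ => ((holAt_coord j 0).pow l).mul (hc l)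
  have h2 : HolAt (fun x : CSpace N => x j ^ d * u x) 0 := ((holAt_coord j 0).pow d).mul hu
  have h3 : ∀ᶠ x : CSpace N in 𝓝 0, ∀ l ∈ Finset.range d, x j = 0 →
      (partialD j)^[i] (fun x => x j ^ l * c l x) x = if i = l then (l.factorial : ℂ) * c l x else 0 :=
    (Filter.eventually_all_finset _).2 fun l _ =>
      partialD_iter_coord_pow_mul_of_depOn j (Finset.notMem_erase j S) i l (hc l) (hcd l)
  filter_upwards [partialD_iter_congr j he i, partialD_iter_add j (HolAt.sum h1) h2 i,
    partialD_iter_sum j _ h1 i, h3, partialD_iter_coord_pow_mul j i d hi hu] with x e1 e2 e3 e4 e5 hx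
  rw [e1, e2, e3, e5 hx, Finset.sum_congr rfl fun l hl => e4 l hl hx]
  by_cases h : i = d
  · subst h
    simp
  · have : i < d := lt_of_le_of_ne hi h
    simp [h, this]

theorem partialD_axis (j : Fin N) {f : CSpace N → ℂ} (h : ∀ᶠ t : ℂ in 𝓝 0, f (Pi.single j t) = 0) (i : ℕ) :
    ∀ᶠ t : ℂ in 𝓝 0, (partialD j)^[i] f (Pi.single j t) = 0 := by
  induction i with
  | zero => exact h
  | succ i ih =>
    rw [Function.iterate_succ_apply']
    filter_upwards [eventually_eventually_nhds.2 ih] with t ht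
    have : Tendsto (fun s : ℂ => t + s) (𝓝 0) (𝓝 t) := by
      simpa using (continuous_const.add continuous_id').tendsto (x := (0 : ℂ)) (f := fun s : ℂ => t + s)
    have h0 : (fun s : ℂ => (partialD j)^[i] f (Pi.single j t + s • Pi.single j 1)) =ᶠ[𝓝 0] fun _ => 0 := by
      filter_upwards [this.eventually ht] with s hs
      rw [← Pi.single_smul, ← Pi.single_add, smul_eq_mul, mul_one, hs]
    change deriv _ _ = 0
    rw [h0.deriv_eq]
    simp

theorem partialD_iter_polynomial (j : Fin N) (p : Polynomial ℂ) (i : ℕ) :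
    (partialD j)^[i] (fun x => p.eval (x j)) = fun x => (Polynomial.derivative^[i] p).eval (x j) := by
  induction i generalizing p with
  | zero => rfl
  | succ i ih =>
    have : partialD j (fun x => p.eval (x j)) = fun x => (Polynomial.derivative p).eval (x j) := by
      funext x
      have h : HasDerivAt (fun t : ℂ => p.eval (x j + t)) (p.derivative.eval (x j)) 0 := by
        have := (p.hasDerivAt (x j + 0)).comp_const_add (x j) 0
        simpa using this
      have h2 : (fun t : ℂ => p.eval ((x + t • (Pi.single j (1 : ℂ) : CSpace N)) j)) = fun t => p.eval (x j + t) := by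
        simp
      change deriv _ _ = _
      rw [h2, h.deriv]
    rw [Function.iterate_succ_apply, Function.iterate_succ_apply, this, ih]

/-- The derivatives at the origin along an axis on which `g` is polynomial. -/
theorem partialD_iter_zero_of_axis (j : Fin N) {g : CSpace N → ℂ} (hg : HolAt g 0) (p : Polynomial ℂ)
    (h : ∀ᶠ t : ℂ in 𝓝 0, g (Pi.single j t) = p.eval t) (i : ℕ) :
    (partialD j)^[i] g 0 = i.factorial * p.coeff i := by
  have hp : HolAt (fun x : CSpace N => p.eval (x j)) 0 :=
    Eventually.of_forall fun x => by fun_prop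
  have hm : HolAt (fun x : CSpace N => g x - p.eval (x j)) 0 := hg.sub hp
  have h1 := (partialD_axis j (f := fun x => g x - p.eval (x j)) (by
    filter_upwards [h] with t ht
    simp [ht]) i).self_of_nhds
  have h2 := (partialD_iter_add j hm hp i).self_of_nhds
  simp only [sub_add_cancel] at h2
  rw [Pi.single_zero] at h1
  rw [h2, h1, zero_add, partialD_iter_polynomial]
  simp only [Pi.zero_apply, ← Polynomial.coeff_zero_eq_eval_zero, Polynomial.coeff_iterate_derivative,
    zero_add, Nat.descFactorial_self, nsmul_eq_mul]

end Taylor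

section Normal

variable {N : ℕ}

/-- The function `F` can be made monomial. -/
def Win (S : Finset (Fin N)) (F : CSpace N → ℂ) : Prop := Enf S fun σ => IsMono fun x => F (σ x)

theorem IsMono.win {S : Finset (Fin N)} {F : CSpace N → ℂ} (h : IsMono F) : Win S F := .leaf h

theorem Win.congr {S : Finset (Fin N)} {F G : CSpace N → ℂ} (h : Win S F) (hFG : F =ᶠ[𝓝 0] G) : Win S G :=
  Enf.imp h fun _ hσ hq => hq.congr (hσ.tendsto.eventually hFG)

theorem Win.bind {S T : Finset (Fin N)} (hST : S ⊆ T) {Q : (CSpace N → CSpace N) → Prop} (h : Enf S Q)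
    {F : CSpace N → ℂ} (hF : ∀ σ, SMap S σ → Q σ → Win T fun x => F (σ x)) : Win T F :=
  h.bind hST hF

/-- All germs in the coordinates of `S` can be made monomial. -/
def MonoGame (S : Finset (Fin N)) : Prop :=
  ∀ f : CSpace N → ℂ, HolAt f 0 → DepOn S f → (¬ ∀ᶠ x in 𝓝 0, f x = 0) → Win S f

/-- `g` vanishes to order at most `d` along the `j`-th axis. -/
def OrderLE (j : Fin N) (d : ℕ) (g : CSpace N → ℂ) : Prop := ∃ i ≤ d, (partialD j)^[i] g 0 ≠ 0

theorem IsMono.comp_unit {S : Finset (Fin N)} {u : CSpace N → ℂ} (hu : HolAt u 0) (h0 : u 0 ≠ 0)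
    {σ : CSpace N → CSpace N} (hσ : SMap S σ) : IsMono fun x => u (σ x) :=
  isMono_of_ne_zero (hu.comp_smap hσ) (by rwa [hσ.map_zero])

theorem MonoGame.win_coord_pow {S T : Finset (Fin N)} (hT : MonoGame T) (hTS : T ⊆ S) {j : Fin N}
    (hj : j ∉ T) {M u : CSpace N → ℂ} (hM : HolAt M 0) (hMd : DepOn T M) (hM0 : ¬ ∀ᶠ x in 𝓝 0, M x = 0)
    (hu : HolAt u 0) (hu0 : u 0 ≠ 0) (d : ℕ) : Win S fun x => M x * (x j ^ d * u x) := by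
  refine Win.bind hTS (hT M hM hMd hM0) fun σ hσ hq => IsMono.win ?_
  simp only [hσ.fix j hj]
  exact hq.mul (((isMono_coord j).pow d).mul (IsMono.comp_unit hu hu0 hσ))

theorem mono_update_mul (α : Fin N → ℕ) (k : Fin N) (x : CSpace N) (s : ℂ) :
    mono α (Function.update x k (s * x k)) = s ^ α k * mono α x := by
  rw [mono, mono, ← Finset.mul_prod_erase _ _ (Finset.mem_univ k),
    ← Finset.mul_prod_erase _ (fun l => x l ^ α l) (Finset.mem_univ k), Function.update_self, mul_pow,
    Finset.prod_congr rfl (g := fun l => x l ^ α l)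
      fun l hl => by rw [Function.update_of_ne (Finset.ne_of_mem_erase hl)], mul_assoc]

theorem mono_blow (α : Fin N → ℕ) (j k : Fin N) (x : CSpace N) :
    mono α (blowMap j k 0 x) = x j ^ α k * mono α x := by
  simp only [blowMap, upd, add_zero, mono_update_mul]

theorem IsMono.comp_blow {F : CSpace N → ℂ} (hF : IsMono F) (j k : Fin N) :
    IsMono fun x => F (blowMap j k 0 x) := by
  obtain ⟨α, u, hu, hu0, he⟩ := hF
  have hσ : SMap Finset.univ (blowMap j k 0 : CSpace N → CSpace N) :=
    smap_blow (Finset.mem_univ j) (Finset.mem_univ k) 0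
  refine ((((isMono_coord j).pow (α k)).mul (isMono_mono α)).mul (IsMono.comp_unit hu hu0 hσ)).congr ?_
  filter_upwards [hσ.tendsto.eventually he] with x hx
  rw [hx, mono_blow]

theorem mono_zero_of_ne {γ : Fin N → ℕ} {k : Fin N} (h : γ k ≠ 0) : mono γ (0 : CSpace N) = 0 :=
  Finset.prod_eq_zero (Finset.mem_univ k) (by simp [h])

/-- A polynomial with shifted arguments and no term of subleading degree. -/
theorem coeff_shifted (e : ℕ) (u c₀ : ℂ) (b : ℕ → ℂ) (hb : b e = 0) :
    (∑ i ∈ Finset.range (e + 1), (Polynomial.X + Polynomial.C c₀) ^ i * Polynomial.C (b i) +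
      (Polynomial.X + Polynomial.C c₀) ^ (e + 1) * Polynomial.C u).coeff e = (e + 1) * c₀ * u := by
  rw [Polynomial.coeff_add, Polynomial.finsetSum_coeff, Polynomial.coeff_mul_C,
    Polynomial.coeff_X_add_C_pow, Finset.sum_eq_zero]
  · rw [zero_add, Nat.add_sub_cancel_left, pow_one, Nat.choose_succ_self_right]
    push_cast
    ring
  · intro i hi
    rw [Polynomial.coeff_mul_C, Polynomial.coeff_X_add_C_pow]
    rcases (Nat.lt_succ_iff.1 (Finset.mem_range.1 hi)).lt_or_eq with h | h
    · simp [Nat.choose_eq_zero_of_lt h]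
    · simp [h, hb]

theorem win_normal {S : Finset (Fin N)} {j : Fin N} (hj : j ∈ S) (e : ℕ)
    (ih : ∀ M g : CSpace N → ℂ, HolAt M 0 → DepOn (S.erase j) M → (¬ ∀ᶠ x in 𝓝 0, M x = 0) →
      HolAt g 0 → DepOn S g → OrderLE j e g → Win S fun x => M x * g x) :
    ∀ (m : ℕ) {γ : Fin N → ℕ} {M u : CSpace N → ℂ} {c : ℕ → CSpace N → ℂ} {i₀ : ℕ}, ∑ k, γ k = m →
      (∀ k ∉ S.erase j, γ k = 0) → IsMono M → DepOn (S.erase j) M → HolAt u 0 → u 0 ≠ 0 → DepOn S u →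
      (∀ i, HolAt (c i) 0) → (∀ i, DepOn (S.erase j) (c i)) → (∀ x, c e x = 0) → i₀ ≤ e → c i₀ 0 ≠ 0 →
      Win S fun x => M x * (∑ i ∈ Finset.range (e + 1), x j ^ i * (mono γ x ^ (e + 1 - i) * c i x) +
        x j ^ (e + 1) * u x) := by
  have hsub : S.erase j ⊆ S := S.erase_subset j
  intro m
  induction m with
  | zero =>
    intro γ M u c i₀ hγ hγS hM hMd hu hu0 hud hc hcd hce hi hi0
    have hγ0 : ∀ x : CSpace N, mono γ x = 1 := fun x => Finset.prod_eq_one fun k hk => by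
      rw [(Finset.sum_eq_zero_iff.1 hγ) k hk, pow_zero]
    simp only [hγ0, one_pow, one_mul]
    refine ih M _ hM.holAt hMd hM.not_zero
      ((HolAt.sum fun i _ => ((holAt_coord j 0).pow i).mul (hc i)).add (((holAt_coord j 0).pow _).mul hu))
      ((DepOn.sum fun i _ => ((depOn_coord hj).pow i).mul ((hcd i).mono hsub)).add
        (((depOn_coord hj).pow _).mul hud)) ⟨i₀, hi, ?_⟩
    have := (partialD_iter_taylor j (d := e + 1) hc hcd hu EventuallyEq.rfl (i := i₀) (by omega)).self_of_nhds rfl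
    rw [this, if_neg (by omega)]
    exact mul_ne_zero (Nat.cast_ne_zero.2 (Nat.factorial_ne_zero _)) hi0
  | succ m ihm =>
    intro γ M u c i₀ hγ hγS hM hMd hu hu0 hud hc hcd hce hi hi0
    obtain ⟨k, -, hk⟩ : ∃ k ∈ Finset.univ, γ k ≠ 0 := by
      by_contra! h0
      rw [Finset.sum_eq_zero h0] at hγ
      omega
    have hkS' : k ∈ S.erase j := by
      by_contra h
      exact hk (hγS k h)
    have hkS : k ∈ S := hsub hkS'
    have hkj : k ≠ j := Finset.ne_of_mem_erase hkS'
    refine Enf.blow k j hkS hj hkj (fun c₀ => ?_) ?_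
    · have hσ : SMap S (blowMap k j c₀ : CSpace N → CSpace N) := smap_blow hkS hj c₀
      have hinv : ∀ {f : CSpace N → ℂ}, DepOn (S.erase j) f → ∀ x, f (blowMap k j c₀ x) = f x :=
        fun hf x => hf _ _ fun i hi => upd_of_ne (Finset.ne_of_mem_erase hi) _ _
      have hσj : ∀ x : CSpace N, blowMap k j c₀ x j = x k * (x j + c₀) := fun x => by simp [blowMap]
      set γ' := Function.update γ k (γ k - 1) with hγ'
      have hγ'm : ∑ l, γ' l = m := by
        rw [← Finset.add_sum_erase _ _ (Finset.mem_univ k)] at hγ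
        rw [← Finset.add_sum_erase _ _ (Finset.mem_univ k), hγ', Function.update_self,
          Finset.sum_congr rfl (g := fun l => γ l)
          fun l hl => by rw [Function.update_of_ne (Finset.ne_of_mem_erase hl)]]
        omega
      have hγ'S : ∀ l ∉ S.erase j, γ' l = 0 := fun l hl => by
        have : l ≠ k := by rintro rfl; exact hl hkS'
        rw [hγ', Function.update_of_ne this, hγS l hl]
      have hF : ∀ x : CSpace N, M x * x k ^ (e + 1) * (∑ i ∈ Finset.range (e + 1),
            (x j + c₀) ^ i * (mono γ' x ^ (e + 1 - i) * c i x) + (x j + c₀) ^ (e + 1) * u (blowMap k j c₀ x)) =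
          M (blowMap k j c₀ x) * (∑ i ∈ Finset.range (e + 1), blowMap k j c₀ x j ^ i *
            (mono γ (blowMap k j c₀ x) ^ (e + 1 - i) * c i (blowMap k j c₀ x)) +
            blowMap k j c₀ x j ^ (e + 1) * u (blowMap k j c₀ x)) := by
        intro x
        rw [hinv hMd, hinv (depOn_mono hγS), hσj, mono_eq_coord_mul hk, mul_assoc, mul_add, Finset.mul_sum]
        congr 2
        · refine Finset.sum_congr rfl fun i hi => ?_
          rw [hinv (hcd i), mul_pow, mul_pow]
          have : x k ^ (e + 1) = x k ^ i * x k ^ (e + 1 - i) := by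
            rw [← pow_add]; congr 1; have := Finset.mem_range.1 hi; omega
          rw [this]; ring
        · rw [mul_pow]; ring
      have hM' : IsMono fun x => M x * x k ^ (e + 1) := hM.mul ((isMono_coord k).pow _)
      have hM'd : DepOn (S.erase j) fun x => M x * x k ^ (e + 1) := hMd.mul ((depOn_coord hkS').pow _)
      have huσ := hu.comp_smap hσ
      have huσ0 : u (blowMap k j c₀ 0) = u 0 := by rw [hσ.map_zero]
      simp only [← hF]
      by_cases hc₀ : c₀ = 0
      · have := ihm (u := fun x => u (blowMap k j c₀ x)) hγ'm hγ'S hM' hM'd huσ (by rwa [huσ0])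
          (hud.comp_smap hσ) hc hcd hce hi hi0
        simp only [hc₀, add_zero] at this ⊢
        exact this
      · set G : CSpace N → ℂ := fun x => ∑ i ∈ Finset.range (e + 1),
            (x j + c₀) ^ i * (mono γ' x ^ (e + 1 - i) * c i x) + (x j + c₀) ^ (e + 1) * u (blowMap k j c₀ x)
          with hG
        have hGh : HolAt G 0 :=
          (HolAt.sum fun i _ => (((holAt_coord j 0).add (holAt_const c₀ 0)).pow i).mul
            (((holAt_mono γ' 0).pow _).mul (hc i))).add
            ((((holAt_coord j 0).add (holAt_const c₀ 0)).pow _).mul huσ)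
        have hGd : DepOn S G :=
          (DepOn.sum fun i _ => (((depOn_coord hj).add (depOn_const S c₀)).pow i).mul
            ((((depOn_mono hγ'S).mono hsub).pow _).mul ((hcd i).mono hsub))).add
            ((((depOn_coord hj).add (depOn_const S c₀)).pow _).mul (hud.comp_smap hσ))
        refine ih _ G hM'.holAt hM'd hM'.not_zero hGh hGd ⟨e, le_rfl, ?_⟩
        rw [partialD_iter_zero_of_axis j hGh (∑ i ∈ Finset.range (e + 1),
          (Polynomial.X + Polynomial.C c₀) ^ i * Polynomial.C (mono γ' 0 ^ (e + 1 - i) * c i 0) +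
          (Polynomial.X + Polynomial.C c₀) ^ (e + 1) * Polynomial.C (u 0))
          (Eventually.of_forall fun t => ?_), coeff_shifted e _ _ _ (by simp [hce])]
        · exact mul_ne_zero (Nat.cast_ne_zero.2 (Nat.factorial_ne_zero _))
            (mul_ne_zero (mul_ne_zero (Nat.cast_add_one_ne_zero e) hc₀) hu0)
        · have hax : ∀ {f : CSpace N → ℂ}, DepOn (S.erase j) f → f (Pi.single j t) = f 0 :=
            fun hf => hf _ _ fun i hi => by simp [Finset.ne_of_mem_erase hi]
          have hb : blowMap k j c₀ (Pi.single j t) = 0 := by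
            ext i
            by_cases hij : i = j
            · subst hij; simp [hσj, hkj]
            · simp [blowMap, upd_of_ne hij, hij]
          simp only [hG, hb, hax (depOn_mono hγ'S), hax (hcd _), Pi.single_eq_same, Polynomial.eval_add,
            Polynomial.eval_finsetSum, Polynomial.eval_mul, Polynomial.eval_pow, Polynomial.eval_X,
            Polynomial.eval_C]
    · have hσ : SMap S (blowMap j k 0 : CSpace N → CSpace N) := smap_blow hj hkS 0
      have hσj : ∀ x : CSpace N, blowMap j k 0 x j = x j := fun x => upd_of_ne hkj.symm _ _
      set n : CSpace N → ℂ := fun x => x j ^ (γ k - 1) * mono γ x with hn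
      have hnγ : ∀ x, mono γ (blowMap j k 0 x) = x j * n x := fun x => by
        rw [mono_blow, hn, ← mul_assoc, ← pow_succ', Nat.sub_add_cancel (Nat.one_le_iff_ne_zero.2 hk)]
      set V : CSpace N → ℂ := fun x => ∑ i ∈ Finset.range (e + 1),
        n x ^ (e + 1 - i) * c i (blowMap j k 0 x) + u (blowMap j k 0 x) with hV
      have hVh : HolAt V 0 :=
        (HolAt.sum fun i _ => ((((holAt_coord j 0).pow _).mul (holAt_mono γ 0)).pow _).mul
          ((hc i).comp_smap hσ)).add (hu.comp_smap hσ)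
      have hV0 : V 0 ≠ 0 := by
        have : n 0 = 0 := by simp [hn, mono_zero_of_ne hk]
        simp only [hV, this, hσ.map_zero]
        rw [Finset.sum_eq_zero fun i hi => by
          rw [zero_pow (by have := Finset.mem_range.1 hi; omega), zero_mul], zero_add]
        exact hu0
      refine Enf.leaf (IsMono.congr (F := fun x => M (blowMap j k 0 x) * (x j ^ (e + 1) * V x))
        ((hM.comp_blow j k).mul (((isMono_coord j).pow (e + 1)).mul (isMono_of_ne_zero hVh hV0)))
        (Eventually.of_forall fun x => ?_))
      simp only [hσj, hnγ, hV]
      rw [mul_add, Finset.mul_sum]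
      congr 2
      refine Finset.sum_congr rfl fun i hi => ?_
      have : x j ^ (e + 1) = x j ^ i * x j ^ (e + 1 - i) := by
        rw [← pow_add]; congr 1; have := Finset.mem_range.1 hi; omega
      rw [this, mul_pow]; ring

end Normal

section Preparation

variable {N : ℕ}

/-- The `d`-th power map in the coordinates of `T`. -/
def powAll (T : Finset (Fin N)) (d : ℕ) (x : CSpace N) : CSpace N := fun i => if i ∈ T then x i ^ d else x i

theorem smap_powAll (T : Finset (Fin N)) {d : ℕ} (hd : 0 < d) : SMap T (powAll T d) := by
  refine ⟨HolAt.pi fun i => ?_, ?_, fun i hi x => by simp [powAll, hi], fun i hi x y h => by simp [powAll, hi, h i hi]⟩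
  · by_cases hi : i ∈ T
    · simpa [powAll, hi] using (holAt_coord i 0).pow d
    · simpa [powAll, hi] using holAt_coord i 0
  · ext i
    simp [powAll, hd.ne']

theorem Enf.powAll {S T : Finset (Fin N)} (hTS : T ⊆ S) {d : ℕ} (hd : 0 < d) :
    ∀ {Q : (CSpace N → CSpace N) → Prop}, (Enf S fun σ => Q fun x => powAll T d (σ x)) → Enf S Q := by
  induction T using Finset.induction_on with
  | empty =>
    intro Q h
    have h0 : ∀ x : CSpace N, _root_.powAll ∅ d x = x := fun x => by ext i; simp [_root_.powAll]
    simp only [h0] at h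
    exact h
  | insert k T hk ih =>
    intro Q h
    refine Enf.pow k d (hTS (Finset.mem_insert_self k T)) hd (ih ((Finset.subset_insert k T).trans hTS) ?_)
    convert h using 4 with σ x
    ext i
    by_cases hi : i = k
    · subst hi; simp [powMap, _root_.powAll, hk]
    · simp [powMap, _root_.powAll, hi, upd_of_ne hi]

theorem mono_powAll (T : Finset (Fin N)) (d : ℕ) (α : Fin N → ℕ) (x : CSpace N) :
    mono α (powAll T d x) = mono (fun i => if i ∈ T then α i * d else α i) x := by
  refine Finset.prod_congr rfl fun i _ => ?_
  by_cases hi : i ∈ T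
  · simp only [powAll, hi, if_true, ← pow_mul, mul_comm]
  · simp [powAll, hi]

theorem IsMono.comp_powAll {F : CSpace N → ℂ} (hF : IsMono F) (T : Finset (Fin N)) {d : ℕ} (hd : 0 < d) :
    IsMono fun x => F (powAll T d x) := by
  obtain ⟨α, u, hu, hu0, he⟩ := hF
  refine ((isMono_mono fun i => if i ∈ T then α i * d else α i).mul
    (IsMono.comp_unit hu hu0 (smap_powAll T hd))).congr ?_
  filter_upwards [(smap_powAll T hd).tendsto.eventually he] with x hx
  rw [hx, mono_powAll]

theorem exists_tschirnhaus {S : Finset (Fin N)} {j : Fin N} (hj : j ∈ S) {w : CSpace N → ℂ}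
    (hw : HolAt w 0) (hd : DepOn S w) (h0 : w 0 = 0) (h1 : partialD j w 0 ≠ 0) :
    ∃ a : CSpace N → ℂ, HolAt a 0 ∧ a 0 = 0 ∧ DepOn (S.erase j) a ∧ ∀ᶠ x in 𝓝 0, w (upd j a x) = 0 := by
  rw [partialD_eq_fderiv j hw.differentiableAt] at h1
  obtain ⟨b, hb, hb0, he, -, -⟩ := exists_upd_inverse hw h0 h1
  refine ⟨fun x => b (proj (S.erase j) x), hb.comp_proj _, by simpa using hb0, depOn_proj _ b, ?_⟩
  filter_upwards [(tendsto_proj (S.erase j)).eventually he] with x hx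
  have := congrFun hx j
  rw [upd_self] at this
  have h2 : proj (S.erase j) x j = 0 := by simp [proj]
  rw [← h2, ← this]
  refine hd _ _ fun i hi => ?_
  by_cases hij : i = j
  · subst hij; simp
  · simp [upd_of_ne hij, proj, hij, hi]

theorem exists_prepared {S : Finset (Fin N)} {j : Fin N} (hj : j ∈ S) {g : CSpace N → ℂ}
    (hg : HolAt g 0) (hd : DepOn S g) {e : ℕ} (h0 : (partialD j)^[e] g 0 = 0)
    (h1 : (partialD j)^[e + 1] g 0 ≠ 0) :
    ∃ (a : CSpace N → ℂ) (c : ℕ → CSpace N → ℂ) (u : CSpace N → ℂ), HolAt a 0 ∧ a 0 = 0 ∧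
      DepOn (S.erase j) a ∧ (∀ i, HolAt (c i) 0) ∧ (∀ i, DepOn (S.erase j) (c i)) ∧ (∀ x, c e x = 0) ∧
      HolAt u 0 ∧ u 0 ≠ 0 ∧ DepOn S u ∧ (fun x => g (upd j (fun x => x j + a x) x)) =ᶠ[𝓝 0]
        fun x => ∑ i ∈ Finset.range (e + 1), x j ^ i * c i x + x j ^ (e + 1) * u x := by
  have h1' := h1
  rw [Function.iterate_succ_apply'] at h1'
  obtain ⟨a, ha, ha0, had, hae⟩ := exists_tschirnhaus hj (hg.partialD_iter j e) (hd.partialD_iter j e) h0 h1'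
  set τ : CSpace N → CSpace N := upd j fun x => x j + a x with hτ
  have hτs : SMap S τ := SMap.upd hj ((holAt_coord j 0).add ha) (by simp [ha0])
    ((depOn_coord hj).add (had.mono (S.erase_subset j)))
  have hshift : ∀ (x : CSpace N) (t : ℂ), τ (x + t • Pi.single j 1) = τ x + t • Pi.single j 1 := by
    intro x t
    have hax : a (x + t • Pi.single j 1) = a x :=
      had _ _ fun i hi => by simp [Finset.ne_of_mem_erase hi]
    ext i
    by_cases hij : i = j
    · subst hij; simp [hτ, hax]; ring
    · simp [hτ, upd_of_ne hij, hij]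
  have hD := partialD_comp_shift j hshift g
  obtain ⟨c, u, hc, hcd, hu, hud, he⟩ := exists_taylor j (hg.comp_smap hτs) (hd.comp_smap hτs) (e + 1)
  have hce : ∀ᶠ x in 𝓝 0, c e x = 0 := by
    have := partialD_iter_taylor j hc hcd hu he (i := e) (by omega)
    filter_upwards [(tendsto_proj (S.erase j)).eventually this, (tendsto_proj (S.erase j)).eventually hae]
      with x e1 e2
    have hx : proj (S.erase j) x j = 0 := by simp [proj]
    have e3 := e1 hx
    have e4 : τ (proj (S.erase j) x) = upd j a (proj (S.erase j) x) := by
      simp only [hτ, upd, hx, zero_add]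
    rw [hD] at e3
    simp only [e4] at e3
    rw [e2, if_neg (by omega), (hcd e).proj] at e3
    exact (mul_eq_zero.1 e3.symm).resolve_left (Nat.cast_ne_zero.2 (Nat.factorial_ne_zero _))
  have hu0 : u 0 ≠ 0 := by
    have := (partialD_iter_taylor j hc hcd hu he le_rfl).self_of_nhds rfl
    rw [hD, if_pos rfl] at this
    simp only [hτs.map_zero] at this
    intro h
    rw [h, mul_zero] at this
    exact h1 this
  refine ⟨a, Function.update c e fun _ => 0, u, ha, ha0, had, fun i => ?_, fun i => ?_, fun x => by simp,
    hu, hu0, hud, ?_⟩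
  · by_cases hi : i = e
    · subst hi; simpa using holAt_const (0 : ℂ) 0
    · simpa [hi] using hc i
  · by_cases hi : i = e
    · subst hi; simpa using depOn_const _ (0 : ℂ)
    · simpa [hi] using hcd i
  · filter_upwards [he, hce] with x e1 e2
    rw [e1]
    congr 1
    refine Finset.sum_congr rfl fun i _ => ?_
    by_cases hi : i = e
    · subst hi; simp [e2]
    · simp [hi]

theorem win_prepared {S : Finset (Fin N)} {j : Fin N} (hj : j ∈ S) (e : ℕ) (hS : MonoGame (S.erase j))
    (ih : ∀ M g : CSpace N → ℂ, HolAt M 0 → DepOn (S.erase j) M → (¬ ∀ᶠ x in 𝓝 0, M x = 0) →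
      HolAt g 0 → DepOn S g → OrderLE j e g → Win S fun x => M x * g x)
    {M u : CSpace N → ℂ} {c : ℕ → CSpace N → ℂ} (hM : HolAt M 0) (hMd : DepOn (S.erase j) M)
    (hM0 : ¬ ∀ᶠ x in 𝓝 0, M x = 0) (hu : HolAt u 0) (hu0 : u 0 ≠ 0) (hud : DepOn S u)
    (hc : ∀ i, HolAt (c i) 0) (hcd : ∀ i, DepOn (S.erase j) (c i)) (hce : ∀ x, c e x = 0) :
    Win S fun x => M x * (∑ i ∈ Finset.range (e + 1), x j ^ i * c i x + x j ^ (e + 1) * u x) := by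
  classical
  have hsub : S.erase j ⊆ S := S.erase_subset j
  have hjS' : j ∉ S.erase j := Finset.notMem_erase j S
  set I := (Finset.range (e + 1)).filter fun i => ¬ ∀ᶠ x in 𝓝 0, c i x = 0 with hI
  have hIe : ∀ i ∈ I, i ≤ e := fun i hi => Nat.lt_succ_iff.1 (Finset.mem_range.1 (Finset.mem_filter.1 hi).1)
  have hIz : ∀ᶠ x in 𝓝 0, ∀ i ∈ Finset.range (e + 1), i ∉ I → c i x = 0 := by
    refine (Filter.eventually_all_finset _).2 fun i hi => ?_
    by_cases h : i ∈ I
    · exact Eventually.of_forall fun x h' => absurd h h'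
    · rw [hI, Finset.mem_filter, not_and, not_not] at h
      exact (h hi).mono fun x hx _ => hx
  rcases I.eq_empty_or_nonempty with hIe' | hIne
  · refine Win.congr (hS.win_coord_pow hsub hjS' hM hMd hM0 hu hu0 (e + 1)) ?_
    filter_upwards [hIz] with x hx
    rw [Finset.sum_eq_zero fun i hi => by rw [hx i hi (by simp [hIe']), mul_zero], zero_add]
  set D := (e + 1).factorial with hD
  set E : ℕ → ℕ := fun i => D / (e + 1 - i) with hE
  have hDE : ∀ i ≤ e, E i * (e + 1 - i) = D := fun i hi =>
    Nat.div_mul_cancel (Nat.dvd_factorial (by omega) (by omega))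
  have hD0 : 0 < D := Nat.factorial_pos _
  set q : ℕ × ℕ → CSpace N → ℂ := fun p =>
    if ∀ᶠ x in 𝓝 0, c p.1 x ^ E p.1 - c p.2 x ^ E p.2 = 0 then fun _ => 1
    else fun x => c p.1 x ^ E p.1 - c p.2 x ^ E p.2 with hq
  have hqh : ∀ p, HolAt (q p) 0 := fun p => by
    simp only [hq]
    split_ifs
    · exact holAt_const 1 0
    · exact ((hc _).pow _).sub ((hc _).pow _)
  have hqd : ∀ p, DepOn (S.erase j) (q p) := fun p => by
    simp only [hq]
    split_ifs
    · exact depOn_const _ 1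
    · exact ((hcd _).pow _).sub ((hcd _).pow _)
  have hq0 : ∀ p, ¬ ∀ᶠ x in 𝓝 0, q p x = 0 := fun p => by
    simp only [hq]
    split_ifs with h
    · exact fun h' => one_ne_zero h'.self_of_nhds
    · exact h
  have hP1 : HolAt (fun x => ∏ i ∈ I, c i x) 0 := HolAt.prod fun i _ => hc i
  have hP2 : HolAt (fun x => ∏ p ∈ I ×ˢ I, q p x) 0 := HolAt.prod fun p _ => hqh p
  refine Win.bind hsub (hS (fun x => M x * (∏ i ∈ I, c i x) * ∏ p ∈ I ×ˢ I, q p x)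
    ((hM.mul hP1).mul hP2)
    ((hMd.mul (DepOn.prod fun i _ => hcd i)).mul (DepOn.prod fun p _ => hqd p)) ?_) fun σ hσ hmono => ?_
  · intro h0
    rcases (hM.mul hP1).mul_eq_zero hP2 h0 with h | h
    · rcases hM.mul_eq_zero hP1 h with h | h
      · exact hM0 h
      · obtain ⟨i, hi, h⟩ := eventually_eq_zero_of_prod I (fun i _ => hc i) h
        exact (Finset.mem_filter.1 hi).2 h
    · obtain ⟨p, -, h⟩ := eventually_eq_zero_of_prod _ (fun p _ => hqh p) h
      exact hq0 p h
  have hσP1 : HolAt (fun x => ∏ i ∈ I, c i (σ x)) 0 := hP1.comp_smap hσ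
  have hσP2 : HolAt (fun x => ∏ p ∈ I ×ˢ I, q p (σ x)) 0 := hP2.comp_smap hσ
  have hMP := hmono.left ((hM.comp_smap hσ).mul hσP1) hσP2
  have hMσ : IsMono fun x => M (σ x) := hMP.left (hM.comp_smap hσ) hσP1
  have hcσ : ∀ i ∈ I, IsMono fun x => c i (σ x) := fun i hi =>
    (hMP.right (hM.comp_smap hσ) hσP1).of_prod (fun i _ => (hc i).comp_smap hσ) hi
  have hqσ : ∀ p ∈ I ×ˢ I, IsMono fun x => q p (σ x) := fun p hp =>
    (hmono.right ((hM.comp_smap hσ).mul hσP1) hσP2).of_prod (fun p _ => (hqh p).comp_smap hσ) hp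
  have hstrong : ∀ i : ℕ, ∃ (α : Fin N → ℕ) (v : CSpace N → ℂ), i ∈ I → (∀ k ∉ S.erase j, α k = 0) ∧
      HolAt v 0 ∧ v 0 ≠ 0 ∧ DepOn (S.erase j) v ∧ (fun x => c i (σ x)) =ᶠ[𝓝 0] fun x => mono α x * v x := by
    intro i
    by_cases hi : i ∈ I
    · obtain ⟨α, v, h⟩ := (hcσ i hi).strong ((hcd i).comp_smap hσ)
      exact ⟨α, v, fun _ => h⟩
    · exact ⟨0, 0, fun h => absurd h hi⟩
  choose α v hαv using hstrong
  set β : ℕ → Fin N → ℕ := fun i k => α i k * E i with hβ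
  have hcmp : ∀ i ∈ I, ∀ l ∈ I, β i ≤ β l ∨ β l ≤ β i := by
    intro i hi l hl
    obtain ⟨-, hv, hv0, -, he⟩ := hαv i hi
    obtain ⟨-, hw, hw0, -, he'⟩ := hαv l hl
    refine exponents_comparable (f := fun x => c i (σ x) ^ E i - c l (σ x) ^ E l) (hv.pow (E i)) (hw.pow (E l))
      (pow_ne_zero _ hv0) (pow_ne_zero _ hw0) ?_ ?_
    · filter_upwards [he, he'] with x h1 h2
      rw [h1, h2, hβ, mono_mul_right, mono_mul_right, mul_pow, mul_pow]
    · by_cases h : ∀ᶠ x in 𝓝 0, c i x ^ E i - c l x ^ E l = 0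
      · exact Or.inr (hσ.tendsto.eventually h)
      · have := hqσ (i, l) (Finset.mk_mem_product hi hl)
        simp only [hq, h, if_false] at this
        exact Or.inl this
  obtain ⟨i₀, hi₀, hmin⟩ := Finset.exists_minimalFor β I hIne
  have hmin' : ∀ i ∈ I, β i₀ ≤ β i := fun i hi => (hcmp i₀ hi₀ i hi).elim id fun h => hmin hi h
  have hρ : SMap (S.erase j) (powAll (S.erase j) D) := smap_powAll _ hD0
  refine Enf.powAll hsub hD0 ?_
  set ρ : CSpace N → CSpace N := powAll (S.erase j) D with hρdef
  set c' : ℕ → CSpace N → ℂ := fun i => if i ∈ I then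
    fun x => mono (β i - β i₀) x ^ (e + 1 - i) * v i (ρ x) else fun _ => 0 with hc'
  have hβS : ∀ i ∈ I, ∀ k ∉ S.erase j, β i k = 0 := fun i hi k hk => by
    simp [hβ, (hαv i hi).1 k hk]
  have hcc' : ∀ᶠ x in 𝓝 0, ∀ i ∈ I, c i (σ (ρ x)) = mono (β i₀) x ^ (e + 1 - i) * c' i x := by
    refine (Filter.eventually_all_finset _).2 fun i hi => ?_
    obtain ⟨h1, -, -, -, he⟩ := hαv i hi
    filter_upwards [hρ.tendsto.eventually he] with x hx
    rw [hx]
    simp only [hc', hi, if_true]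
    rw [← mul_assoc, ← mul_pow, ← mono_add, add_tsub_cancel_of_le (hmin' i hi), hρdef, mono_powAll,
      ← mono_mul_right]
    congr 2
    funext k
    by_cases hk : k ∈ S.erase j
    · rw [if_pos hk, hβ, mul_assoc, hDE i (hIe i hi)]
    · rw [if_neg hk, h1 k hk, hβS i hi k hk, zero_mul]
  have huσ : HolAt (fun x => u (σ (ρ x))) 0 := (hu.comp_smap hσ).comp_smap hρ
  have hnf := win_normal hj e ih _ (γ := β i₀) (M := fun x => M (σ (ρ x))) (u := fun x => u (σ (ρ x)))
    (c := c') (i₀ := i₀) rfl (hβS i₀ hi₀) (hMσ.comp_powAll (S.erase j) hD0)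
    ((hMd.comp_smap hσ).comp_smap hρ) huσ (by rwa [hρ.map_zero, hσ.map_zero])
    ((hud.comp_smap (hσ.mono hsub)).comp_smap (hρ.mono hsub))
    (fun i => by
      simp only [hc']
      split_ifs with h
      · exact ((holAt_mono _ 0).pow _).mul ((hαv i h).2.1.comp_smap hρ)
      · exact holAt_const 0 0)
    (fun i => by
      simp only [hc']
      split_ifs with h
      · exact ((depOn_mono fun k hk => by simp [hβS i h k hk]).pow _).mul ((hαv i h).2.2.2.1.comp_smap hρ)
      · exact depOn_const _ 0)
    (fun x => by
      have : e ∉ I := fun h => (Finset.mem_filter.1 h).2 (Eventually.of_forall hce)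
      simp [hc', this])
    (hIe i₀ hi₀)
    (by
      simp only [hc', hi₀, if_true, hρ.map_zero]
      refine mul_ne_zero (pow_ne_zero _ ?_) (hαv i₀ hi₀).2.2.1
      simp [mono])
  refine Win.congr (G := fun x => M (σ (ρ x)) * (∑ i ∈ Finset.range (e + 1), σ (ρ x) j ^ i * c i (σ (ρ x)) +
    σ (ρ x) j ^ (e + 1) * u (σ (ρ x)))) hnf ?_
  filter_upwards [hcc', (hσ.comp hρ).tendsto.eventually hIz] with x h1 h2
  simp only [hσ.fix j hjS', hρ.fix j hjS']
  congr 2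
  refine Finset.sum_congr rfl fun i hi => ?_
  by_cases h : i ∈ I
  · rw [h1 i h]
  · rw [h2 i hi h]; simp [hc', h]

theorem MonoGame.win_of_orderLE {S : Finset (Fin N)} {j : Fin N} (hj : j ∈ S) (hS : MonoGame (S.erase j))
    (d : ℕ) : ∀ M g : CSpace N → ℂ, HolAt M 0 → DepOn (S.erase j) M → (¬ ∀ᶠ x in 𝓝 0, M x = 0) →
      HolAt g 0 → DepOn S g → OrderLE j d g → Win S fun x => M x * g x := by
  induction d with
  | zero =>
    rintro M g hM hMd hM0 hg - ⟨i, hi, h⟩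
    obtain rfl : i = 0 := by omega
    simpa using hS.win_coord_pow (S.erase_subset j) (Finset.notMem_erase j S) hM hMd hM0 hg h 0
  | succ e ih =>
    rintro M g hM hMd hM0 hg hgd ⟨i, hi, h⟩
    by_cases hlow : OrderLE j e g
    · exact ih M g hM hMd hM0 hg hgd hlow
    have h0 : ∀ i ≤ e, (partialD j)^[i] g 0 = 0 := by simpa [OrderLE] using hlow
    obtain rfl : i = e + 1 := by
      by_contra hne
      exact h (h0 i (by omega))
    obtain ⟨a, c, u, ha, ha0, had, hc, hcd, hce, hu, hu0, hud, he⟩ := exists_prepared hj hg hgd (h0 e le_rfl) h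
    have hτ : HolAt (fun x : CSpace N => x j + a x) 0 := (holAt_coord j 0).add ha
    refine Enf.iso j _ hj hτ (by simp [ha0])
      ((depOn_coord hj).add (had.mono (S.erase_subset j))) ?_ ?_
    · have h1 : HasFDerivAt (fun x : CSpace N => x j) (ContinuousLinearMap.proj (R := ℂ) j) 0 :=
        (ContinuousLinearMap.proj (R := ℂ) (φ := fun _ : Fin N => ℂ) j).hasFDerivAt
      rw [(h1.fun_add ha.differentiableAt.hasFDerivAt).fderiv]
      have : fderiv ℂ a 0 (Pi.single j 1) = 0 := by
        rw [← partialD_eq_fderiv j ha.differentiableAt, partialD_of_depOn (Finset.notMem_erase j S) had]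
      simp [this]
    · set τ : CSpace N → CSpace N := upd j fun x => x j + a x with hτ
      refine Win.congr (G := fun x => M (τ x) * g (τ x)) (win_prepared hj e hS ih hM hMd hM0 hu hu0 hud hc hcd hce) ?_
      filter_upwards [he] with x hx
      rw [← hx, hMd (τ x) x fun i hi => upd_of_ne (Finset.ne_of_mem_erase hi) _ _]

end Preparation

section Resolution

variable {N : ℕ}

/-- Adding multiples of the `j`-th coordinate to the coordinates in `T`. -/
def shear (T : Finset (Fin N)) (j : Fin N) (q : CSpace N) (x : CSpace N) : CSpace N :=
  fun i => if i ∈ T then x i + q i * x j else x i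

theorem smap_shear {S T : Finset (Fin N)} (hTS : T ⊆ S) {j : Fin N} (hj : j ∈ S) (q : CSpace N) :
    SMap S (shear T j q) := by
  refine ⟨HolAt.pi fun i => ?_, ?_, fun i hi x => ?_, fun i hi x y h => ?_⟩
  · by_cases hi : i ∈ T
    · simpa [shear, hi] using (holAt_coord i 0).add ((holAt_const (q i) 0).mul (holAt_coord j 0))
    · simpa [shear, hi] using holAt_coord i 0
  · ext i
    simp [shear]
  · simp [shear, show i ∉ T from fun h => hi (hTS h)]
  · simp [shear, h i hi, h j hj]

theorem Enf.shear {S T : Finset (Fin N)} (hTS : T ⊆ S) {j : Fin N} (hj : j ∈ S) (hjT : j ∉ T) (q : CSpace N) :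
    ∀ {Q : (CSpace N → CSpace N) → Prop}, (Enf S fun σ => Q fun x => shear T j q (σ x)) → Enf S Q := by
  induction T using Finset.induction_on with
  | empty =>
    intro Q h
    have h0 : ∀ x : CSpace N, _root_.shear ∅ j q x = x := fun x => by ext i; simp [_root_.shear]
    simp only [h0] at h
    exact h
  | insert k T hk ih =>
    intro Q h
    have hjk : j ≠ k := by rintro rfl; exact hjT (Finset.mem_insert_self j T)
    have hjT' : j ∉ T := fun h => hjT (Finset.mem_insert_of_mem h)
    have hkS : k ∈ S := hTS (Finset.mem_insert_self k T)
    have h1 : HasFDerivAt (fun x : CSpace N => x k + q k * x j)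
        (ContinuousLinearMap.proj (R := ℂ) (φ := fun _ : Fin N => ℂ) k +
          q k • ContinuousLinearMap.proj (R := ℂ) (φ := fun _ : Fin N => ℂ) j) 0 :=
      (ContinuousLinearMap.proj (R := ℂ) (φ := fun _ : Fin N => ℂ) k +
          q k • ContinuousLinearMap.proj (R := ℂ) (φ := fun _ : Fin N => ℂ) j).hasFDerivAt
    refine Enf.iso k (fun x => x k + q k * x j) hkS
      ((holAt_coord k 0).add ((holAt_const _ 0).mul (holAt_coord j 0))) (by simp)
      ((depOn_coord hkS).add ((depOn_const S _).mul (depOn_coord hj))) (by rw [h1.fderiv]; simp [hjk])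
      (ih ((Finset.subset_insert k T).trans hTS) hjT' ?_)
    convert h using 4 with σ x
    ext i
    by_cases hi : i = k
    · subst hi; simp [_root_.shear, hk, hjT']
    · simp [_root_.shear, hi, upd_of_ne hi]

theorem partialD_iter_axis_eq (j : Fin N) (g : CSpace N → ℂ) (i : ℕ) :
    (fun t : ℂ => (partialD j)^[i] g (Pi.single j t)) = iteratedDeriv i fun t => g (Pi.single j t) := by
  induction i with
  | zero => simp
  | succ i ih =>
    rw [iteratedDeriv_succ, ← ih, Function.iterate_succ_apply']
    funext t
    have : (fun s : ℂ => (partialD j)^[i] g (Pi.single j t + s • Pi.single j 1)) =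
        fun s => (fun t => (partialD j)^[i] g (Pi.single j t)) (t + s) := by
      funext s
      rw [← Pi.single_smul, ← Pi.single_add, smul_eq_mul, mul_one]
    change deriv _ _ = _
    rw [this]
    exact (deriv_comp_const_add (fun t => (partialD j)^[i] g (Pi.single j t)) t 0).trans (by rw [add_zero])

theorem exists_orderLE (j : Fin N) {g : CSpace N → ℂ} (hg : HolAt g 0)
    (h : ¬ ∀ᶠ t : ℂ in 𝓝 0, g (Pi.single j t) = 0) : ∃ d, OrderLE j d g := by
  by_contra! hcon
  refine h ?_
  have h0 : ∀ i, (partialD j)^[i] g 0 = 0 := fun i => by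
    by_contra hi
    exact hcon i ⟨i, le_rfl, hi⟩
  have hs : Tendsto (fun t : ℂ => (Pi.single j t : CSpace N)) (𝓝 0) (𝓝 0) := by
    have : Continuous fun t : ℂ => (Pi.single j t : CSpace N) :=
      (ContinuousLinearMap.single ℂ (fun _ : Fin N => ℂ) j).continuous
    simpa using this.tendsto 0
  have ha : AnalyticAt ℂ (fun t : ℂ => g (Pi.single j t)) 0 := by
    rw [Complex.analyticAt_iff_eventually_differentiableAt]
    filter_upwards [hs.eventually hg] with t ht
    exact ht.comp t (ContinuousLinearMap.single ℂ (fun _ : Fin N => ℂ) j).differentiableAt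
  rw [← analyticOrderAt_eq_top, ENat.eq_top_iff_forall_ge]
  intro m
  rw [natCast_le_analyticOrderAt_iff_iteratedDeriv_eq_zero ha]
  intro i _
  rw [← partialD_iter_axis_eq]
  simpa using h0 i

theorem exists_shear {T : Finset (Fin N)} {j : Fin N} (hj : j ∉ T) {f : CSpace N → ℂ} (hf : HolAt f 0)
    (hd : DepOn (insert j T) f) (h0 : ¬ ∀ᶠ x in 𝓝 0, f x = 0) :
    ∃ q, ¬ ∀ᶠ t : ℂ in 𝓝 0, f (shear T j q (Pi.single j t)) = 0 := by
  obtain ⟨r, hr, hdf⟩ := hf.exists_ball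
  obtain ⟨y, hy, hyr⟩ : ∃ y, f y * y j ≠ 0 ∧ y ∈ Metric.ball (0 : CSpace N) r := by
    by_contra! hcon
    rcases hf.mul_eq_zero (holAt_coord j 0) (by
      filter_upwards [Metric.ball_mem_nhds 0 hr] with x hx
      by_contra h
      exact hcon x h hx) with h | h
    · exact h0 h
    · exact not_eventually_coord_zero j h
  obtain ⟨hfy, hyj⟩ := mul_ne_zero_iff.1 hy
  refine ⟨fun i => y i / y j, fun hz => hfy ?_⟩
  set v : CSpace N := fun i => if i ∈ insert j T then y i / y j else 0 with hv
  have hvj : v j = 1 := by simp [hv, hyj]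
  have hsh : ∀ t : ℂ, f (shear T j (fun i => y i / y j) (Pi.single j t)) = f (t • v) := fun t => by
    refine hd _ _ fun i hi => ?_
    rcases Finset.mem_insert.1 hi with rfl | hiT
    · simp [shear, hj, hvj]
    · have : i ≠ j := by rintro rfl; exact hj hiT
      simp [shear, hiT, hv, this, mul_comm]
  simp only [hsh] at hz
  have hvpos : 0 < ‖v‖ := norm_pos_iff.2 fun h => by
    rw [h] at hvj
    exact zero_ne_one hvj
  have hmem : ∀ t : ℂ, t ∈ Metric.ball (0 : ℂ) (r / ‖v‖) ↔ t • v ∈ Metric.ball (0 : CSpace N) r := fun t => by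
    rw [mem_ball_zero_iff, mem_ball_zero_iff, norm_smul, lt_div_iff₀ hvpos]
  have han : AnalyticOnNhd ℂ (fun t : ℂ => f (t • v)) (Metric.ball (0 : ℂ) (r / ‖v‖)) := by
    refine DifferentiableOn.analyticOnNhd (fun t ht => ?_) Metric.isOpen_ball
    have h1 : DifferentiableAt ℂ f (t • v) :=
      hdf.differentiableAt (Metric.isOpen_ball.mem_nhds ((hmem t).1 ht))
    have h2 : DifferentiableAt ℂ (fun t : ℂ => t • v) t := by fun_prop
    exact (h1.comp t h2).differentiableWithinAt
  have hyv : ∀ i ∈ insert j T, (y j • v) i = y i := fun i hi => by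
    simp only [Pi.smul_apply, hv, hi, if_true, smul_eq_mul]
    field_simp
  have hyv' : y j ∈ Metric.ball (0 : ℂ) (r / ‖v‖) := by
    rw [hmem, mem_ball_zero_iff]
    rw [mem_ball_zero_iff] at hyr
    refine lt_of_le_of_lt ((pi_norm_le_iff_of_nonneg (norm_nonneg _)).2 fun i => ?_) hyr
    by_cases hi : i ∈ insert j T
    · rw [hyv i hi]; exact norm_le_pi_norm y i
    · simp only [Pi.smul_apply, hv, hi, if_false, smul_zero, norm_zero]; exact norm_nonneg _
  have := han.eqOn_zero_of_preconnected_of_eventuallyEq_zero (convex_ball _ _).isPreconnected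
    (Metric.mem_ball_self (by positivity)) hz hyv'
  rw [← hd _ _ hyv]
  exact this

theorem monoGame (S : Finset (Fin N)) : MonoGame S := by
  induction S using Finset.induction_on with
  | empty =>
    intro f hf hd h0
    have hc : ∀ x, f x = f 0 := fun x => hd x 0 (by simp)
    exact IsMono.win (isMono_of_ne_zero hf fun h => h0 (Eventually.of_forall fun x => by rw [hc, h]))
  | insert j T hj ih =>
    intro f hf hd h0
    have hjS := Finset.mem_insert_self j T
    obtain ⟨q, hq⟩ := exists_shear hj hf hd h0
    have hs : SMap (insert j T) (shear T j q) := smap_shear (Finset.subset_insert j T) hjS q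
    obtain ⟨d, hd'⟩ := exists_orderLE j (hf.comp_smap hs) hq
    have hT : MonoGame ((insert j T).erase j) := by rwa [Finset.erase_insert hj]
    have := hT.win_of_orderLE hjS d (fun _ => 1) _ (holAt_const 1 0) (depOn_const _ 1)
      (fun h => one_ne_zero h.self_of_nhds) (hf.comp_smap hs) (hd.comp_smap hs) hd'
    simp only [one_mul] at this
    exact Enf.shear (Finset.subset_insert j T) hjS hj q this

theorem goodAt_of_not_zero {f : CSpace N → ℂ} (hf : HolAt f 0) (h0 : ¬ ∀ᶠ x in 𝓝 0, f x = 0) :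
    GoodAt f 0 :=
  (monoGame Finset.univ f hf (depOn_univ f) h0).goodAt hf fun _ _ h => h.goodAt

theorem goodAt_of_not_eventually_zero {f : CSpace N → ℂ} {p : CSpace N} (hf : HolAt f p)
    (h0 : ¬ ∀ᶠ x in 𝓝 p, f x = 0) : GoodAt f p := by
  have hm : map (fun x : CSpace N => x + p) (𝓝 0) = 𝓝 p := by simp
  have hF : HolAt (fun x => f (x + p)) 0 := by
    have h1 : HolAt f ((fun x : CSpace N => x + p) 0) := by simpa using hf
    exact HolAt.comp (σ := fun x : CSpace N => x + p) h1 (Eventually.of_forall fun x => by fun_prop)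
  have := goodAt_of_not_zero hF fun h => h0 (by rw [← hm]; exact h)
  simpa using GoodAt.of_translate this

end Resolution

section Cutoff

variable {N : ℕ}

theorem not_eventually_zero_of_component {Ω : Set (CSpace N)} (hΩ : IsOpen Ω) {f : CSpace N → ℂ}
    (hf : DifferentiableOn ℂ f Ω) {p : CSpace N} (hp : p ∈ Ω)
    (hnz : ∃ y ∈ connectedComponentIn Ω p, f y ≠ 0) : ¬ ∀ᶠ x in 𝓝 p, f x = 0 := by
  intro h
  obtain ⟨y, hy, hfy⟩ := hnz
  have := (isPreconnected_connectedComponentIn (x := p) (F := Ω)).subset_of_closure_inter_subset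
    (u := {x | ∀ᶠ z in 𝓝 x, f z = 0}) isOpen_setOfPred_eventually_nhds
    ⟨p, mem_connectedComponentIn hp, h⟩ ?_
  · exact hfy (this hy).self_of_nhds
  · rintro x ⟨hx, hxC⟩
    obtain ⟨r, hr, hb⟩ := Metric.isOpen_iff.1 hΩ x (connectedComponentIn_subset Ω p hxC)
    obtain ⟨q, hq, hqu⟩ := mem_closure_iff.1 hx _ Metric.isOpen_ball (Metric.mem_ball_self hr)
    filter_upwards [Metric.ball_mem_nhds x hr] with z hz
    exact eventuallyEq_zero_of_lines (hf.mono hb) hq hqu z hz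

theorem measurable_pvInt {F θ : CSpace N → ℂ} (hF : Measurable F) (hθ : Measurable θ) (ε : ℝ) :
    Measurable fun z : ℝ × CSpace N => pvInt F θ (ε * z.1) z.2 := by
  unfold pvInt
  exact Measurable.ite (measurableSet_lt (by fun_prop) (by fun_prop)) (by fun_prop) (by fun_prop)

theorem setIntegral_deriv_ite {χ : ℝ → ℝ} (hχ : ContDiff ℝ ∞ χ) {c C : ℝ}
    (h0 : ∀ t ∈ Set.Icc 0 c, χ t = 0) (h1 : ∀ t, C ≤ t → χ t = 1) (hc : 0 < c) (hC : c ≤ C) {u : ℝ}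
    (hu : 0 ≤ u) : ∫ s in Set.Ioc c C, (if s < u then deriv χ s else 0) = χ u := by
  have hd : ∀ b, ∫ s in c..b, deriv χ s = χ b := fun b => by
    rw [intervalIntegral.integral_deriv_eq_sub (fun x _ => (hχ.differentiable (by simp)) x)
      ((hχ.continuous_deriv (by simp)).intervalIntegrable _ _), h0 c ⟨hc.le, le_rfl⟩, sub_zero]
  have hi : ∫ s in Set.Ioc c C, (if s < u then deriv χ s else 0) =
      ∫ s in Set.Ioc c C, (Set.Iic u).indicator (deriv χ) s := by
    refine setIntegral_congr_ae measurableSet_Ioc ?_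
    have : ∀ᵐ s : ℝ, s ≠ u := by simp [ae_iff]
    filter_upwards [this] with s hs _
    rcases lt_or_gt_of_ne hs with h | h
    · simp [h, h.le]
    · simp [h.not_gt, h]
  rw [hi, setIntegral_indicator measurableSet_Iic, Set.Ioc_inter_Iic]
  rcases le_or_gt u c with h | h
  · rw [Set.Ioc_eq_empty (by simp [h]), h0 u ⟨hu, h⟩]
    simp
  · rw [← intervalIntegral.integral_of_le (le_min hC h.le), hd]
    rcases le_total C u with h' | h'
    · rw [min_eq_left h', h1 C le_rfl, h1 u h']
    · rw [min_eq_right h']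

theorem tendsto_integral_cutoff {F θ : CSpace N → ℂ} {U : Set (CSpace N)} (hU : IsOpen U)
    (hF : ContinuousOn F U) (hθ : Continuous θ) (hc : HasCompactSupport θ) (hs : tsupport θ ⊆ U)
    {L : ℂ} (hL : Tendsto (fun ε : ℝ => ∫ x, pvInt F θ ε x) (𝓝[>] 0) (𝓝 L))
    {χ : ℝ → ℝ} (hχ : ContDiff ℝ ∞ χ) (hχ0 : ∀ᶠ t in 𝓝 0, χ t = 0)
    (hχ1 : ∀ᶠ t in atTop, χ t = 1) :
    Tendsto (fun ε : ℝ => ∫ x, ((χ (‖F x‖ ^ 2 / ε) : ℝ) : ℂ) * θ x / F x) (𝓝[>] 0) (𝓝 L) := by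
  wlog hFm : Measurable F generalizing F
  · classical
    have hFU : ∀ x, θ x ≠ 0 → U.indicator F x = F x := fun x hx =>
      Set.indicator_of_mem (hs (subset_tsupport _ hx)) F
    have key := this (F := U.indicator F) (hF.congr fun x hx => Set.indicator_of_mem hx F) ?_ ?_
    · refine key.congr fun ε => ?_
      congr 1
      ext x
      by_cases hx : θ x = 0
      · simp [hx]
      · rw [hFU x hx]
    · refine hL.congr fun ε => ?_
      congr 1
      ext x
      by_cases hx : θ x = 0
      · rw [pvInt_of_zero hx, pvInt_of_zero hx]
      · simp [pvInt, hFU x hx]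
    · rw [← Set.piecewise_eq_indicator]
      exact hF.measurable_piecewise continuousOn_const hU.measurableSet
  obtain ⟨r, hr, hr0⟩ := Metric.eventually_nhds_iff.1 hχ0
  obtain ⟨C₀, hC₀⟩ := eventually_atTop.1 hχ1
  set c := r / 2 with hcdef
  set C := max C₀ c with hCdef
  have hcpos : 0 < c := by positivity
  have hcC : c ≤ C := le_max_right _ _
  have h0 : ∀ t ∈ Set.Icc 0 c, χ t = 0 := fun t ht => hr0 (by
    rw [Real.dist_0_eq_abs, abs_of_nonneg ht.1]
    linarith [ht.2])
  have h1 : ∀ t, C ≤ t → χ t = 1 := fun t ht => hC₀ t ((le_max_left _ _).trans ht)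
  have hdc : Continuous (deriv χ) := hχ.continuous_deriv (by simp)
  obtain ⟨M, hM⟩ := (isCompact_Icc (a := c) (b := C)).exists_bound_of_continuousOn hdc.continuousOn
  set μ := volume.restrict (Set.Ioc c C) with hμ
  have hdi : Integrable (fun s => ((deriv χ s : ℝ) : ℂ)) μ :=
    (((Complex.continuous_ofReal.comp hdc).integrableOn_Icc).mono_set Set.Ioc_subset_Icc_self)
  have hpt : ∀ ε > 0, ∀ x, ((χ (‖F x‖ ^ 2 / ε) : ℝ) : ℂ) * θ x / F x =
      ∫ s, ((deriv χ s : ℝ) : ℂ) * pvInt F θ (ε * s) x ∂μ := by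
    intro ε hε x
    rw [← setIntegral_deriv_ite hχ h0 h1 hcpos hcC (u := ‖F x‖ ^ 2 / ε) (by positivity),
      ← integral_complex_ofReal, mul_div_assoc, ← integral_mul_const]
    congr 1
    ext s
    have : s < ‖F x‖ ^ 2 / ε ↔ ε * s < ‖F x‖ ^ 2 := by rw [lt_div_iff₀ hε, mul_comm]
    simp only [pvInt, this]
    split_ifs <;> simp
  have hjm : ∀ ε, AEStronglyMeasurable
      (fun z : ℝ × CSpace N => ((deriv χ z.1 : ℝ) : ℂ) * pvInt F θ (ε * z.1) z.2)
      (μ.prod volume) := fun ε => by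
    have h2 := measurable_pvInt hFm hθ.measurable ε
    exact (((Complex.measurable_ofReal.comp hdc.measurable).comp measurable_fst).mul
      h2).aestronglyMeasurable
  have hji : ∀ ε > 0, Integrable
      (fun z : ℝ × CSpace N => ((deriv χ z.1 : ℝ) : ℂ) * pvInt F θ (ε * z.1) z.2)
      (μ.prod volume) := by
    intro ε hε
    have hb : Integrable (fun z : ℝ × CSpace N => ‖((deriv χ z.1 : ℝ) : ℂ)‖ * (‖θ z.2‖ / √(ε * c)))
        (μ.prod volume) :=
      hdi.norm.mul_prod (((hθ.integrable_of_hasCompactSupport hc).norm).div_const _)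
    refine hb.mono' (hjm ε) ?_
    have hms : MeasurableSet (Set.Ioc c C ×ˢ (Set.univ : Set (CSpace N))) :=
      measurableSet_Ioc.prod MeasurableSet.univ
    have hr' : μ.prod (volume : Measure (CSpace N)) =
        (volume.prod volume).restrict (Set.Ioc c C ×ˢ Set.univ) := by
      rw [← Measure.prod_restrict, Measure.restrict_univ]
    rw [hr']
    filter_upwards [ae_restrict_mem hms] with z hz
    rw [norm_mul]
    refine mul_le_mul_of_nonneg_left ?_ (norm_nonneg _)
    unfold pvInt
    split_ifs with h
    · have hz1 : ε * c ≤ ε * z.1 := mul_le_mul_of_nonneg_left hz.1.1.le hε.le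
      have : √(ε * c) ≤ ‖F z.2‖ := Real.sqrt_le_iff.2 ⟨norm_nonneg _, hz1.trans h.le⟩
      have : 0 < √(ε * c) := Real.sqrt_pos.2 (by positivity)
      rw [norm_div]
      gcongr
    · simp; positivity
  have hfub : ∀ ε > 0, ∫ x, ((χ (‖F x‖ ^ 2 / ε) : ℝ) : ℂ) * θ x / F x =
      ∫ s, ((deriv χ s : ℝ) : ℂ) * (∫ x, pvInt F θ (ε * s) x) ∂μ := by
    intro ε hε
    simp only [hpt ε hε]
    rw [integral_integral_swap (f := fun x s => ((deriv χ s : ℝ) : ℂ) * pvInt F θ (ε * s) x)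
      (hji ε hε).swap]
    simp only [integral_const_mul]
  have hLint : ∫ s, ((deriv χ s : ℝ) : ℂ) * L ∂μ = L := by
    have h2 := setIntegral_deriv_ite hχ h0 h1 hcpos hcC (u := C + 1) (by linarith)
    have h3 : ∫ s in Set.Ioc c C, deriv χ s = 1 := by
      rw [← h1 (C + 1) (by linarith), ← h2]
      refine setIntegral_congr_fun measurableSet_Ioc fun s hs => ?_
      simp [show s < C + 1 by linarith [hs.2]]
    rw [integral_mul_const, integral_complex_ofReal, h3]
    simp
  obtain ⟨δ, hδ, hδb⟩ : ∃ δ > 0, ∀ ε, 0 < ε → ε < δ → ‖∫ x, pvInt F θ ε x‖ ≤ ‖L‖ + 1 := by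
    have := hL.norm.eventually (eventually_le_nhds (lt_add_one ‖L‖))
    obtain ⟨δ, hδ, h⟩ := mem_nhdsGT_iff_exists_Ioo_subset.1 this
    exact ⟨δ, hδ, fun ε h1 h2 => h ⟨h1, h2⟩⟩
  have hmain : Tendsto (fun ε : ℝ => ∫ s, ((deriv χ s : ℝ) : ℂ) * (∫ x, pvInt F θ (ε * s) x) ∂μ)
      (𝓝[>] 0) (𝓝 (∫ s, ((deriv χ s : ℝ) : ℂ) * L ∂μ)) := by
    refine tendsto_integral_filter_of_dominated_convergence
      (fun s => ‖((deriv χ s : ℝ) : ℂ)‖ * (‖L‖ + 1)) ?_ ?_ (hdi.norm.mul_const _) ?_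
    · filter_upwards [self_mem_nhdsWithin] with ε hε
      have := (hji ε hε).integral_prod_left.aestronglyMeasurable
      simpa only [integral_const_mul] using this
    · have hC0 : 0 < C := hcpos.trans_le hcC
      filter_upwards [Ioo_mem_nhdsGT (show (0 : ℝ) < δ / C by positivity)] with ε hε
      filter_upwards [ae_restrict_mem measurableSet_Ioc] with s hs
      rw [norm_mul]
      refine mul_le_mul_of_nonneg_left (hδb _ (mul_pos hε.1 (hcpos.trans hs.1)) ?_) (norm_nonneg _)
      calc ε * s ≤ ε * C := mul_le_mul_of_nonneg_left hs.2 hε.1.le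
        _ < δ := (lt_div_iff₀ hC0).1 hε.2
    · filter_upwards [ae_restrict_mem measurableSet_Ioc] with s hs
      refine Tendsto.const_mul _ (hL.comp ?_)
      refine tendsto_nhdsWithin_iff.2 ⟨?_, ?_⟩
      · have : Tendsto (fun ε : ℝ => ε * s) (𝓝 0) (𝓝 (0 * s)) := tendsto_id.mul_const s
        rw [zero_mul] at this
        exact this.mono_left nhdsWithin_le_nhds
      · filter_upwards [self_mem_nhdsWithin] with ε hε
        exact mul_pos hε (hcpos.trans hs.1)
  rw [hLint] at hmain
  refine hmain.congr' ?_
  filter_upwards [self_mem_nhdsWithin] with ε hε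
  exact (hfub ε hε).symm

end Cutoff

section Dbar

variable {N : ℕ}

theorem dbarCoord_congr {i : Fin N} {g h : CSpace N → ℂ} {x} (hgh : g =ᶠ[𝓝 x] h) :
    dbarCoord N i g x = dbarCoord N i h x := by
  simp only [dbarCoord, hgh.fderiv_eq]

theorem dbarCoord_eq_zero {i : Fin N} {g : CSpace N → ℂ} {x} (h : g =ᶠ[𝓝 x] fun _ => 0) :
    dbarCoord N i g x = 0 := by
  rw [dbarCoord_congr h]
  simp [dbarCoord]

theorem dbarCoord_mul {i : Fin N} {g h : CSpace N → ℂ} {x} (hg : DifferentiableAt ℝ g x)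
    (hh : DifferentiableAt ℝ h x) : dbarCoord N i (fun y => g y * h y) x =
      g x * dbarCoord N i h x + dbarCoord N i g x * h x := by
  simp only [dbarCoord, fderiv_fun_mul hg hh, add_apply,
    smul_apply, smul_eq_mul]
  ring

theorem dbarCoord_hol {i : Fin N} {g : CSpace N → ℂ} {x} (hg : DifferentiableAt ℂ g x) :
    dbarCoord N i g x = 0 := by
  have h1 : (Pi.single i Complex.I : CSpace N) = Complex.I • Pi.single i 1 := by
    rw [← Pi.single_smul, smul_eq_mul, mul_one]
  simp only [dbarCoord, hg.fderiv_restrictScalars ℝ, ContinuousLinearMap.coe_restrictScalars', h1,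
    map_smul, smul_eq_mul, ← mul_assoc, Complex.I_mul_I]
  ring

theorem contDiff_dbarCoord (i : Fin N) {g : CSpace N → ℂ} (hg : ContDiff ℝ ∞ g) :
    ContDiff ℝ ∞ (dbarCoord N i g) :=
  ((contDiff_fderiv_apply_real hg _).add
    (contDiff_const.mul (contDiff_fderiv_apply_real hg _))).div_const _

theorem dbarCoord_of_notMem_tsupport (i : Fin N) {g : CSpace N → ℂ} {x} (hx : x ∉ tsupport g) :
    dbarCoord N i g x = 0 :=
  dbarCoord_eq_zero (notMem_tsupport_iff_eventuallyEq.1 hx)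

theorem integral_fderiv_apply_eq_zero {g : CSpace N → ℂ} (hg : ContDiff ℝ ∞ g)
    (hc : HasCompactSupport g) (v : CSpace N) : ∫ x, fderiv ℝ g x v = 0 := by
  have h1 := (contDiff_fderiv_apply_real hg v).continuous.integrable_of_hasCompactSupport
    (μ := volume) (hasCompactSupport_fderiv_apply hc v)
  have h2 := hg.continuous.integrable_of_hasCompactSupport (μ := volume) hc
  have := integral_mul_fderiv_eq_neg_fderiv_mul_of_integrable (μ := (volume : Measure (CSpace N)))
    (f := fun _ => (1 : ℂ)) (g := g) (v := v) (by simp)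
    (by simpa using h1) (by simpa using h2) (fun _ _ => differentiableAt_const _)
    fun x _ => hg.differentiable (by simp) x
  simpa using this

theorem integrable_dbarCoord (i : Fin N) {g : CSpace N → ℂ} (hg : ContDiff ℝ ∞ g)
    (hc : HasCompactSupport g) : Integrable (dbarCoord N i g) :=
  (contDiff_dbarCoord i hg).continuous.integrable_of_hasCompactSupport
    (HasCompactSupport.intro hc.isCompact fun _ hx => dbarCoord_of_notMem_tsupport i hx)

theorem integral_dbarCoord (i : Fin N) {g : CSpace N → ℂ} (hg : ContDiff ℝ ∞ g)
    (hc : HasCompactSupport g) : ∫ x, dbarCoord N i g x = 0 := by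
  have h : ∀ v : CSpace N, Integrable fun x => fderiv ℝ g x v := fun v =>
    (contDiff_fderiv_apply_real hg v).continuous.integrable_of_hasCompactSupport
      (hasCompactSupport_fderiv_apply hc v)
  simp only [dbarCoord]
  rw [integral_div, integral_add (h _) ((h _).const_mul _), integral_const_mul,
    integral_fderiv_apply_eq_zero hg hc, integral_fderiv_apply_eq_zero hg hc]
  simp

/-- The smoothed version `χ (‖f‖ ^ 2 / ε) / f` of `1 / f`. -/
noncomputable def smoothInv (f : CSpace N → ℂ) (χ : ℝ → ℝ) (ε : ℝ) (x : CSpace N) : ℂ :=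
  ((χ (‖f x‖ ^ 2 / ε) : ℝ) : ℂ) / f x

variable {Ω : Set (CSpace N)} {f : CSpace N → ℂ} {χ : ℝ → ℝ} {ε : ℝ}

theorem eventually_cutoff_eq_zero (hΩ : IsOpen Ω) (hf : DifferentiableOn ℂ f Ω)
    (hχ0 : ∀ᶠ t in 𝓝 0, χ t = 0) {x : CSpace N} (hx : x ∈ Ω) (h0 : f x = 0) :
    ∀ᶠ y in 𝓝 x, χ (‖f y‖ ^ 2 / ε) = 0 := by
  have hc : ContinuousAt (fun y => ‖f y‖ ^ 2 / ε) x :=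
    (((hf.differentiableAt (hΩ.mem_nhds hx)).continuousAt.norm).pow 2).div_const ε
  have : Tendsto (fun y => ‖f y‖ ^ 2 / ε) (𝓝 x) (𝓝 0) := by simpa [ContinuousAt, h0] using hc
  exact this.eventually hχ0

theorem contDiffAt_cutoff (hΩ : IsOpen Ω) (hf : DifferentiableOn ℂ f Ω) (hχ : ContDiff ℝ ∞ χ)
    {x : CSpace N} (hx : x ∈ Ω) :
    ContDiffAt ℝ ∞ (fun y => ((χ (‖f y‖ ^ 2 / ε) : ℝ) : ℂ)) x := by
  have h1 : ContDiffAt ℝ ∞ f x := (holAt_of_open hΩ hf hx).contDiffAt.restrict_scalars ℝ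
  exact Complex.ofRealCLM.contDiff.contDiffAt.comp x
    (hχ.contDiffAt.comp x ((h1.norm_sq ℝ).div_const ε))

theorem contDiffOn_smoothInv (hΩ : IsOpen Ω) (hf : DifferentiableOn ℂ f Ω) (hχ : ContDiff ℝ ∞ χ)
    (hχ0 : ∀ᶠ t in 𝓝 0, χ t = 0) : ContDiffOn ℝ ∞ (smoothInv f χ ε) Ω := by
  intro x hx
  refine ContDiffAt.contDiffWithinAt ?_
  by_cases h0 : f x = 0
  · refine (contDiffAt_const (c := (0 : ℂ))).congr_of_eventuallyEq ?_
    filter_upwards [eventually_cutoff_eq_zero (ε := ε) hΩ hf hχ0 hx h0] with y hy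
    simp [smoothInv, hy]
  · have h1 : smoothInv f χ ε = fun y => ((χ (‖f y‖ ^ 2 / ε) : ℝ) : ℂ) * (f y)⁻¹ := by
      ext y
      simp [smoothInv, div_eq_mul_inv]
    rw [h1]
    exact (contDiffAt_cutoff hΩ hf hχ hx).mul
      (((holAt_of_open hΩ hf hx).contDiffAt.inv h0).restrict_scalars ℝ)

theorem dbarCoord_smoothInv (hΩ : IsOpen Ω) (hf : DifferentiableOn ℂ f Ω) (hχ : ContDiff ℝ ∞ χ)
    (hχ0 : ∀ᶠ t in 𝓝 0, χ t = 0) {x : CSpace N} (hx : x ∈ Ω) (i : Fin N) :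
    dbarCoord N i (smoothInv f χ ε) x =
      dbarCoord N i (fun y => ((χ (‖f y‖ ^ 2 / ε) : ℝ) : ℂ)) x / f x := by
  by_cases h0 : f x = 0
  · rw [h0, div_zero]
    refine dbarCoord_eq_zero ?_
    filter_upwards [eventually_cutoff_eq_zero (ε := ε) hΩ hf hχ0 hx h0] with y hy
    simp [smoothInv, hy]
  · have hd : DifferentiableAt ℂ (fun y => (f y)⁻¹) x :=
      (hf.differentiableAt (hΩ.mem_nhds hx)).inv h0
    have : smoothInv f χ ε = fun y => ((χ (‖f y‖ ^ 2 / ε) : ℝ) : ℂ) * (f y)⁻¹ := by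
      ext y
      simp [smoothInv, div_eq_mul_inv]
    rw [this, dbarCoord_mul ((contDiffAt_cutoff hΩ hf hχ hx).differentiableAt (by simp))
      (hd.restrictScalars ℝ), dbarCoord_hol hd, mul_zero, zero_add, div_eq_mul_inv]

theorem integral_dbar_cutoff (hΩ : IsOpen Ω) (hf : DifferentiableOn ℂ f Ω) (hχ : ContDiff ℝ ∞ χ)
    (hχ0 : ∀ᶠ t in 𝓝 0, χ t = 0) {φ : Fin N → CSpace N → ℂ} (hφ : ∀ i, ContDiff ℝ ∞ (φ i))
    (hφc : ∀ i, HasCompactSupport (φ i)) (hφΩ : ∀ i, tsupport (φ i) ⊆ Ω) :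
    ∫ x in Ω, (∑ i : Fin N, (-1 : ℂ) ^ (i : ℕ) *
        dbarCoord N i (fun y => ((χ (‖f y‖ ^ 2 / ε) : ℝ) : ℂ)) x * φ i x) / f x =
      -∫ x, smoothInv f χ ε x * ∑ i : Fin N, (-1 : ℂ) ^ (i : ℕ) * dbarCoord N i (φ i) x := by
  have hK := contDiffOn_smoothInv (ε := ε) hΩ hf hχ hχ0
  have hoff : ∀ i, ∀ x ∉ Ω, φ i x = 0 ∧ dbarCoord N i (φ i) x = 0 := fun i x hx =>
    have h := fun h => hx (hφΩ i h)
    ⟨image_eq_zero_of_notMem_tsupport h, dbarCoord_of_notMem_tsupport i h⟩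
  have hG : ∀ i, ContDiff ℝ ∞ (fun x => smoothInv f χ ε x * φ i x) ∧
      HasCompactSupport fun x => smoothInv f χ ε x * φ i x := fun i => by
    obtain ⟨h1, h2, -⟩ := contDiff_of_zero_off_compact
      (g := fun x => smoothInv f χ ε x * φ i x) hΩ (hK.mul (hφ i).contDiffOn)
      (hφc i).isCompact (hφΩ i) fun x hx => by simp [image_eq_zero_of_notMem_tsupport hx]
    exact ⟨h1, h2⟩
  have hGt : ∀ i, ∀ x ∉ Ω, dbarCoord N i (fun x => smoothInv f χ ε x * φ i x) x = 0 := fun i x hx =>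
    dbarCoord_of_notMem_tsupport i fun h => hx (hφΩ i (tsupport_mul_subset_right h))
  have hD : ∀ i, Integrable fun x => smoothInv f χ ε x * dbarCoord N i (φ i) x := fun i => by
    obtain ⟨h1, h2, -⟩ := contDiff_of_zero_off_compact
      (g := fun x => smoothInv f χ ε x * dbarCoord N i (φ i) x) hΩ
      (hK.mul (contDiff_dbarCoord i (hφ i)).contDiffOn)
      (hφc i).isCompact (hφΩ i) fun x hx => by simp [dbarCoord_of_notMem_tsupport i hx]
    exact h1.continuous.integrable_of_hasCompactSupport h2
  have hB : Integrable fun x => smoothInv f χ ε x *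
      ∑ i : Fin N, (-1 : ℂ) ^ (i : ℕ) * dbarCoord N i (φ i) x := by
    simp only [Finset.mul_sum, mul_left_comm (smoothInv f χ ε _)]
    exact integrable_finsetSum _ fun i _ => (hD i).const_mul _
  have hA : ∀ i : Fin N, Integrable fun x =>
      (-1 : ℂ) ^ (i : ℕ) * dbarCoord N i (fun x => smoothInv f χ ε x * φ i x) x := fun i =>
    (integrable_dbarCoord i (hG i).1 (hG i).2).const_mul _
  calc _ = ∫ x in Ω, ((∑ i : Fin N, (-1 : ℂ) ^ (i : ℕ) *
            dbarCoord N i (fun x => smoothInv f χ ε x * φ i x) x) -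
          smoothInv f χ ε x * ∑ i : Fin N, (-1 : ℂ) ^ (i : ℕ) * dbarCoord N i (φ i) x) := by
        refine setIntegral_congr_fun hΩ.measurableSet fun x hx => ?_
        simp only [Finset.mul_sum, Finset.sum_div, ← Finset.sum_sub_distrib]
        refine Finset.sum_congr rfl fun i _ => ?_
        rw [dbarCoord_mul ((hK.contDiffAt (hΩ.mem_nhds hx)).differentiableAt (by simp))
          ((hφ i).differentiable (by simp) x), dbarCoord_smoothInv hΩ hf hχ hχ0 hx]
        ring
    _ = ∫ x, ((∑ i : Fin N, (-1 : ℂ) ^ (i : ℕ) *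
            dbarCoord N i (fun x => smoothInv f χ ε x * φ i x) x) -
          smoothInv f χ ε x * ∑ i : Fin N, (-1 : ℂ) ^ (i : ℕ) * dbarCoord N i (φ i) x) := by
        refine setIntegral_eq_integral_of_forall_compl_eq_zero fun x hx => ?_
        simp [hGt _ x hx, (hoff _ x hx).2]
    _ = _ := by
        rw [integral_sub (integrable_finsetSum _ fun i _ => hA i) hB,
          integral_finsetSum _ fun i _ => hA i]
        simp only [integral_const_mul, integral_dbarCoord _ (hG _).1 (hG _).2]
        simp

end Dbar

/-- for f holomorphic on Ω, not identically 0 on any component, and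
a test (n,n−1)-form φ = Σ_i ± φ_i dz ∧ (dz̄ omitting i) (represented by its
coefficients φ i, the fixed form dz ∧ dz̄ being folded into the scalar
integrals), lim_{ε→0⁺} ∫ (∂̄χ(|f|²/ε))/f ∧ φ = ⟨∂̄(1/f), φ⟩ = −⟨1/f, ∂̄φ⟩, where
⟨1/f, ∂̄φ⟩ is the Herrera–Lieberman principal value
lim_{ε→0⁺} ∫_{|f|²>ε} ∂̄φ/f — which, by Stokes' theorem, is also the limit of
the residue integrals ∫_{|f|²=ε} φ/f over regular values ε (the χ = 1_{[1,∞)}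
case). -/
theorem stmt19 (n : ℕ) (Ω : Set (Fin n → ℂ)) (hΩ : IsOpen Ω)
    (f : (Fin n → ℂ) → ℂ) (hf : DifferentiableOn ℂ f Ω)
    (hnz : ∀ x ∈ Ω, ∃ y ∈ connectedComponentIn Ω x, f y ≠ 0)
    (χ : ℝ → ℝ) (hχs : ContDiff ℝ (⊤ : ℕ∞) χ)
    (hχ0 : ∀ᶠ t in nhds 0, χ t = 0) (hχ1 : ∀ᶠ t in atTop, χ t = 1)
    (hχr : ∀ t, χ t ∈ Set.Icc (0 : ℝ) 1)
    (φ : Fin n → (Fin n → ℂ) → ℂ)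
    (hφ : ∀ i, ContDiff ℝ (⊤ : ℕ∞) (φ i)) (hφc : ∀ i, HasCompactSupport (φ i))
    (hφΩ : ∀ i, tsupport (φ i) ⊆ Ω) :
    ∃ L : ℂ,
      Tendsto (fun ε : ℝ =>
          ∫ x in {x | x ∈ Ω ∧ ε < ‖f x‖ ^ 2},
            (∑ i : Fin n, (-1 : ℂ) ^ (i : ℕ) * dbarCoord n i (φ i) x) / f x)
        (nhdsWithin 0 (Set.Ioi 0)) (nhds L) ∧
      Tendsto (fun ε : ℝ =>
          ∫ x in Ω,
            (∑ i : Fin n, (-1 : ℂ) ^ (i : ℕ) *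
              dbarCoord n i (fun y => ((χ (‖f y‖ ^ 2 / ε) : ℝ) : ℂ)) x * φ i x) / f x)
        (nhdsWithin 0 (Set.Ioi 0)) (nhds (-L)) := by
  set ψ : CSpace n → ℂ := fun x => ∑ i : Fin n, (-1 : ℂ) ^ (i : ℕ) * dbarCoord n i (φ i) x with hψ
  set K : Set (CSpace n) := ⋃ i, tsupport (φ i) with hK
  have hKc : IsCompact K := isCompact_iUnion fun i => (hφc i).isCompact
  have hKΩ : K ⊆ Ω := Set.iUnion_subset hφΩ
  have hψK : ∀ x ∉ K, ψ x = 0 := fun x hx => Finset.sum_eq_zero fun i _ => by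
    rw [dbarCoord_of_notMem_tsupport i fun h => hx (Set.mem_iUnion.2 ⟨i, h⟩), mul_zero]
  have hψs : ContDiff ℝ ∞ ψ :=
    ContDiff.sum fun i _ => contDiff_const.mul (contDiff_dbarCoord i (hφ i))
  have hψc : HasCompactSupport ψ := HasCompactSupport.intro hKc hψK
  have hψt : tsupport ψ ⊆ K := closure_minimal (fun x hx => by
    by_contra h
    exact hx (hψK x h)) hKc.isClosed
  obtain ⟨V, hV, hKV, hfV, hgood⟩ := exists_goodOn_of_compact (F := f) hKc fun p hp =>
    goodAt_of_not_eventually_zero (holAt_of_open hΩ hf (hKΩ hp))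
      (not_eventually_zero_of_component hΩ hf (hKΩ hp) (hnz p (hKΩ hp)))
  obtain ⟨L, hL⟩ := hgood ψ hψs hψc (hψt.trans hKV)
  refine ⟨L, hL.congr fun ε => ?_, ?_⟩
  · have hm : MeasurableSet {x | x ∈ Ω ∧ ε < ‖f x‖ ^ 2} :=
      ((hf.continuousOn.norm.pow 2).isOpen_inter_preimage hΩ isOpen_Ioi).measurableSet
    rw [← integral_indicator hm]
    congr 1
    ext x
    by_cases hx : x ∈ Ω
    · simp [pvInt, Set.indicator, hx, hψ]
    · have h0 := hψK x fun h => hx (hKΩ h)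
      rw [pvInt_of_zero h0, Set.indicator_of_notMem fun h => hx h.1]
  · have := (tendsto_integral_cutoff hV hfV hψs.continuous hψc (hψt.trans hKV) hL hχs hχ0 hχ1).neg
    refine this.congr fun ε => ?_
    rw [integral_dbar_cutoff hΩ hf hχs hχ0 hφ hφc hφΩ]
    congr 2
    ext x
    simp only [smoothInv, hψ]
    ring
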